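/- Let B = B(0,1) ⊂ ℝ^d, let A₀ be a constant symmetric real d×d matrix satisfying λ|ξ|² ≤ A₀ξ·ξ for all ξ ∈ ℝ^d and |A₀| ≤ Λ for some λ, Λ > 0, and let f = (f^{kl}) : ℝ^d → ℝ^{d×d} be smooth. Suppose u is continuous on the closed ball B̄ and satisfies ∫_B u tr(A₀ D²v) = ∫_B tr(f D²v) for every smooth function v on ℝ^d with v = 0 on ∂B. Then for every α > 0, the Lebesgue measure of {x ∈ B : |u(x)| > α} is at most (C/α) ∫_B |f| dx, where C depends only on d, λ, Λ. -/

import Mathlib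

open MeasureTheory Metric Matrix Set

/-- The Hessian matrix `D²v` of a real-valued function. -/
noncomputable def hess {d : ℕ} (u : EuclideanSpace ℝ (Fin d) → ℝ)
    (x : EuclideanSpace ℝ (Fin d)) : Fin d → Fin d → ℝ :=
  fun i j => iteratedFDeriv ℝ 2 u x ![EuclideanSpace.single i 1, EuclideanSpace.single j 1]

namespace WeakType

/-- Euclidean space of dimension `d`. -/
abbrev Euc (d : ℕ) := EuclideanSpace ℝ (Fin d)

/-- Real polynomials in `d` variables. -/
abbrev Pol (d : ℕ) := MvPolynomial (Fin d) ℝ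

/-- Evaluation of a polynomial at a point of Euclidean space. -/
noncomputable abbrev ev {d : ℕ} (x : Euc d) : Pol d →+* ℝ := MvPolynomial.eval (fun i => x i)

/-- The partial derivative of a polynomial. -/
noncomputable abbrev pd {d : ℕ} (i : Fin d) : Derivation ℝ (Pol d) (Pol d) := MvPolynomial.pderiv i

section Basic

variable {d : ℕ}

/-- The gradient of a polynomial as a continuous linear form. -/
noncomputable def gradL (p : Pol d) (x : Euc d) : Euc d →L[ℝ] ℝ :=
  ∑ i, ev x (pd i p) • (EuclideanSpace.proj i : Euc d →L[ℝ] ℝ)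

lemma gradL_apply (p : Pol d) (x h : Euc d) : gradL p x h = ∑ i, ev x (pd i p) * h i := by
  simp [gradL]

lemma gradL_single (p : Pol d) (x : Euc d) (j : Fin d) :
    gradL p x (EuclideanSpace.single j 1) = ev x (pd j p) := by
  simp [gradL_apply]

lemma hasFDerivAt_ev (p : Pol d) (x : Euc d) :
    HasFDerivAt (fun y : Euc d => ev y p) (gradL p x) x := by
  induction p using MvPolynomial.induction_on with
  | C a =>
    have : gradL (MvPolynomial.C a) x = 0 := by ext h; simp [gradL_apply]
    rw [this]; simpa using hasFDerivAt_const a x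
  | add p q hp hq =>
    have : gradL (p + q) x = gradL p x + gradL q x := by
      ext h; simp [gradL_apply, add_mul, Finset.sum_add_distrib]
    rw [this]; simpa using hp.fun_add hq
  | mul_X p n hp =>
    have hX : HasFDerivAt (fun y : Euc d => y n) (EuclideanSpace.proj n : Euc d →L[ℝ] ℝ) x :=
      (EuclideanSpace.proj n : Euc d →L[ℝ] ℝ).hasFDerivAt
    have h := hp.fun_mul hX
    have e : gradL (p * MvPolynomial.X n) x
        = ev x p • (EuclideanSpace.proj n : Euc d →L[ℝ] ℝ) + x n • gradL p x := by
      ext h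
      simp only [gradL_apply, Derivation.leibniz, MvPolynomial.pderiv_X, smul_eq_mul, map_add,
        map_mul, MvPolynomial.eval_X, _root_.add_apply, _root_.smul_apply,
        PiLp.proj_apply, add_mul, Finset.sum_add_distrib, Finset.mul_sum]
      congr 1
      · simp [Pi.single_apply, apply_ite]
      · exact Finset.sum_congr rfl fun i _ => by ring
    rw [e]; simpa using h

lemma contDiff_ev (p : Pol d) {n : WithTop ℕ∞} : ContDiff ℝ n (fun y : Euc d => ev y p) := by
  induction p using MvPolynomial.induction_on with
  | C a => simpa using contDiff_const
  | add p q hp hq => simpa using hp.add hq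
  | mul_X p m hp =>
    simpa using hp.mul (EuclideanSpace.proj m : Euc d →L[ℝ] ℝ).contDiff

lemma continuous_ev (p : Pol d) : Continuous (fun y : Euc d => ev y p) :=
  (contDiff_ev p (n := 0)).continuous

lemma pd_comm (i j : Fin d) (p : Pol d) : pd i (pd j p) = pd j (pd i p) := by
  have h : ⁅pd i, pd j⁆ = (0 : Derivation ℝ (Pol d) (Pol d)) := by
    apply MvPolynomial.derivation_ext
    intro k
    simp [Derivation.commutator_apply, MvPolynomial.pderiv_X, Pi.single_apply, apply_ite]
  have := congrArg (fun D : Derivation ℝ (Pol d) (Pol d) => D p) h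
  simpa [Derivation.commutator_apply, sub_eq_zero] using this

lemma hess_ev (p : Pol d) (x : Euc d) (i j : Fin d) :
    hess (fun y : Euc d => ev y p) x i j = ev x (pd i (pd j p)) := by
  have h1 : fderiv ℝ (fun y : Euc d => ev y p) = gradL p := by
    funext y; exact (hasFDerivAt_ev p y).fderiv
  rw [hess, iteratedFDeriv_two_apply, h1]
  have h2 : HasFDerivAt (gradL p) (∑ k, (gradL (pd k p) x).smulRight
      (EuclideanSpace.proj k : Euc d →L[ℝ] ℝ)) x := by
    exact HasFDerivAt.fun_sum fun k _ => (hasFDerivAt_ev (pd k p) x).smul_const (EuclideanSpace.proj k : Euc d →L[ℝ] ℝ)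
  rw [h2.fderiv]
  simp only [Matrix.cons_val_zero, Matrix.cons_val_one, _root_.sum_apply,
    ContinuousLinearMap.smulRight_apply, gradL_single, _root_.smul_apply]
  simp

lemma eq_zero_of_ev_ball {p : Pol d} {y : Euc d} {r : ℝ} (hr : 0 < r)
    (h : ∀ x ∈ ball y r, ev x p = 0) : p = 0 := by
  obtain ⟨s, hs, hsub⟩ : ∃ s > 0, ∀ z : Fin d → ℝ, (∀ i, z i ∈ Ioo (y i - s) (y i + s)) →
      WithLp.toLp 2 z ∈ ball y r := by
    have hc : Continuous fun z : Fin d → ℝ => (WithLp.toLp 2 z : Euc d) :=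
      PiLp.continuous_toLp 2 _
    have := (hc.isOpen_preimage _ (isOpen_ball (x := y) (ε := r)))
    obtain ⟨s, hs, h⟩ := Metric.isOpen_iff.1 this (fun i => y i) (by
      show WithLp.toLp 2 (fun i => y i) ∈ ball y r
      exact mem_ball_self hr)
    refine ⟨s, hs, fun z hz => h ?_⟩
    rw [mem_ball, dist_pi_lt_iff hs]
    intro i
    rw [Real.dist_eq, abs_lt]
    constructor <;> linarith [(hz i).1, (hz i).2]
  refine MvPolynomial.funext_set (fun i => Ioo (y i - s) (y i + s))
    (fun i => Set.Ioo_infinite (by linarith)) fun z hz => ?_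
  have := h _ (hsub z fun i => hz i (Set.mem_univ i))
  simpa using this

end Basic

end WeakType

namespace WeakType

section Domain

variable {d : ℕ}

/-- Bounded convex open sets. -/
structure CDom (D : Set (Euc d)) : Prop where
  isOpen : IsOpen D
  convex : Convex ℝ D
  bdd : Bornology.IsBounded D

/-- The integral of a polynomial over a domain. -/
noncomputable def I (D : Set (Euc d)) (p : Pol d) : ℝ := ∫ x in D, ev x p

lemma CDom.measurableSet {D : Set (Euc d)} (hD : CDom D) : MeasurableSet D :=
  hD.isOpen.measurableSet

lemma CDom.integrableOn {D : Set (Euc d)} (hD : CDom D) {g : Euc d → ℝ} (hg : Continuous g) :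
    IntegrableOn g D :=
  (hg.continuousOn.integrableOn_compact hD.bdd.isCompact_closure).mono_set subset_closure

lemma I_add {D : Set (Euc d)} (hD : CDom D) (p q : Pol d) : I D (p + q) = I D p + I D q := by
  simp only [I, map_add]
  exact integral_add (hD.integrableOn (continuous_ev p)) (hD.integrableOn (continuous_ev q))

lemma I_sub {D : Set (Euc d)} (hD : CDom D) (p q : Pol d) : I D (p - q) = I D p - I D q := by
  simp only [I, map_sub]
  exact integral_sub (hD.integrableOn (continuous_ev p)) (hD.integrableOn (continuous_ev q))

lemma I_neg {D : Set (Euc d)} (p : Pol d) : I D (-p) = -I D p := by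
  simp only [I, map_neg, integral_neg]

lemma I_zero {D : Set (Euc d)} : I D (0 : Pol d) = 0 := by simp [I]

lemma I_C_mul {D : Set (Euc d)} (c : ℝ) (p : Pol d) :
    I D (MvPolynomial.C c * p) = c * I D p := by
  simp only [I, map_mul, MvPolynomial.eval_C, integral_const_mul]

lemma I_sum {D : Set (Euc d)} (hD : CDom D) {ι : Type*} (s : Finset ι) (p : ι → Pol d) :
    I D (∑ i ∈ s, p i) = ∑ i ∈ s, I D (p i) := by
  simp only [I, map_sum]
  exact integral_finsetSum _ fun i _ => hD.integrableOn (continuous_ev _)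

lemma I_mono {D : Set (Euc d)} (hD : CDom D) {p q : Pol d} (h : ∀ x ∈ D, ev x p ≤ ev x q) :
    I D p ≤ I D q :=
  setIntegral_mono_on (hD.integrableOn (continuous_ev p)) (hD.integrableOn (continuous_ev q))
    hD.measurableSet h

lemma I_nonneg {D : Set (Euc d)} (hD : CDom D) {p : Pol d} (h : ∀ x ∈ D, 0 ≤ ev x p) :
    0 ≤ I D p :=
  setIntegral_nonneg hD.measurableSet h

lemma I_mono_set {D D' : Set (Euc d)} (hD : CDom D) (hs : D' ⊆ D) {p : Pol d}
    (h : ∀ x ∈ D, 0 ≤ ev x p) : I D' p ≤ I D p :=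
  setIntegral_mono_set (hD.integrableOn (continuous_ev p))
    (ae_restrict_of_forall_mem hD.measurableSet h) (Filter.Eventually.of_forall hs)

lemma I_sq_nonneg {D : Set (Euc d)} (hD : CDom D) (p : Pol d) : 0 ≤ I D (p ^ 2) :=
  I_nonneg hD fun x _ => by rw [map_pow]; positivity

lemma lipschitz_indicator {D : Set (Euc d)} (hD : CDom D) {ψ : Pol d}
    (hψ : ∀ x ∈ frontier D, ev x ψ = 0) :
    ∃ K, LipschitzWith K (D.indicator fun x => ev x ψ) := by
  obtain ⟨K, hK⟩ := ContDiffOn.exists_lipschitzOnWith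
    (contDiff_ev ψ (n := 1)).contDiffOn one_ne_zero hD.convex.closure hD.bdd.isCompact_closure
  have key : ∀ x ∈ D, ∀ y ∉ D, |ev x ψ| ≤ K * dist x y := by
    intro x hx y hy
    obtain ⟨z, hz, hzf⟩ : ∃ z ∈ segment ℝ x y, z ∈ frontier D := by
      by_contra! hno
      have hcov : ∀ z ∈ segment ℝ x y, z ∈ D ∨ z ∈ (closure D)ᶜ := fun z hz => by
        by_contra! hc
        exact hno z hz ⟨not_not.1 hc.2, by rw [hD.isOpen.interior_eq]; exact hc.1⟩
      obtain ⟨z, -, hz, hz'⟩ := (convex_segment x y).isPreconnected D (closure D)ᶜ hD.isOpen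
        isClosed_closure.isOpen_compl hcov ⟨x, left_mem_segment ℝ x y, hx⟩
        ⟨y, right_mem_segment ℝ x y, (hcov y (right_mem_segment ℝ x y)).resolve_left hy⟩
      exact hz' (subset_closure hz)
    have h1 := hK.dist_le_mul x (subset_closure hx) z (frontier_subset_closure hzf)
    rw [hψ z hzf, Real.dist_eq, sub_zero] at h1
    refine h1.trans (mul_le_mul_of_nonneg_left ?_ K.2)
    linarith [dist_add_dist_of_mem_segment hz, dist_nonneg (x := z) (y := y)]
  refine ⟨K, LipschitzWith.of_dist_le_mul fun x y => ?_⟩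
  by_cases hx : x ∈ D <;> by_cases hy : y ∈ D
  · rw [indicator_of_mem hx, indicator_of_mem hy]
    exact hK.dist_le_mul x (subset_closure hx) y (subset_closure hy)
  · rw [indicator_of_mem hx, indicator_of_notMem hy, Real.dist_eq, sub_zero]
    exact key x hx y hy
  · rw [indicator_of_notMem hx, indicator_of_mem hy, dist_comm, Real.dist_eq, sub_zero, dist_comm]
    exact key y hy x hx
  · rw [indicator_of_notMem hx, indicator_of_notMem hy, dist_self]; positivity

/-- The divergence theorem for polynomials vanishing on the boundary. -/
lemma I_pd_eq_zero {D : Set (Euc d)} (hD : CDom D) {ψ : Pol d}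
    (hψ : ∀ x ∈ frontier D, ev x ψ = 0) (i : Fin d) : I D (pd i ψ) = 0 := by
  obtain ⟨K, hK⟩ := lipschitz_indicator hD hψ
  have hcs : HasCompactSupport (D.indicator fun x : Euc d => ev x ψ) :=
    HasCompactSupport.intro hD.bdd.isCompact_closure fun x hx =>
      indicator_of_notMem (fun h => hx (subset_closure h)) _
  have h := (LipschitzWith.const (1 : ℝ) : LipschitzWith 0 fun _ : Euc d => (1 : ℝ))
    |>.integral_lineDeriv_mul_eq (μ := volume) hK hcs (-EuclideanSpace.single i 1)
  have e1 : ∀ x : Euc d, lineDeriv ℝ (fun _ : Euc d => (1 : ℝ)) x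
      (-EuclideanSpace.single i 1) = 0 := fun x => by simp [lineDeriv]
  simp only [e1, zero_mul, integral_zero, neg_neg, mul_one] at h
  rw [I, ← integral_indicator hD.measurableSet, h]
  apply integral_congr_ae
  have hf : volume (frontier D) = 0 := hD.convex.addHaar_frontier volume
  filter_upwards [measure_eq_zero_iff_ae_notMem.1 hf] with x hx
  by_cases hxD : x ∈ D
  · rw [indicator_of_mem hxD]
    have he : (D.indicator fun x : Euc d => ev x ψ) =ᶠ[nhds x] fun x => ev x ψ := by
      filter_upwards [hD.isOpen.mem_nhds hxD] with y hy using indicator_of_mem hy _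
    rw [he.lineDeriv_eq, ((hasFDerivAt_ev ψ x).hasLineDerivAt _).lineDeriv, gradL_single]
  · have hxc : x ∉ closure D := fun hc => hx ⟨hc, by rwa [hD.isOpen.interior_eq]⟩
    have he : (D.indicator fun x : Euc d => ev x ψ) =ᶠ[nhds x] fun _ => 0 := by
      filter_upwards [isClosed_closure.isOpen_compl.mem_nhds hxc] with y hy
      exact indicator_of_notMem (fun h => hy (subset_closure h)) _
    rw [indicator_of_notMem hxD, he.lineDeriv_eq]
    simp [lineDeriv]

lemma CDom.ball (y : Euc d) (r : ℝ) : CDom (ball y r) := ⟨isOpen_ball, convex_ball y r, isBounded_ball⟩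

lemma CDom.inter {D D' : Set (Euc d)} (h : CDom D) (h' : CDom D') : CDom (D ∩ D') :=
  ⟨h.isOpen.inter h'.isOpen, h.convex.inter h'.convex, h.bdd.subset inter_subset_left⟩

/-- The unit ball cut with a ball. -/
def cut (y : Euc d) (r : ℝ) : Set (Euc d) := Metric.ball 0 1 ∩ Metric.ball y r

lemma CDom.cut (y : Euc d) (r : ℝ) : CDom (cut y r) := (CDom.ball 0 1).inter (CDom.ball y r)

lemma cut_mono (y : Euc d) {r s : ℝ} (h : r ≤ s) : cut y r ⊆ cut y s :=
  inter_subset_inter_right _ (ball_subset_ball h)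

end Domain

end WeakType

namespace WeakType

section Elliptic

variable {d : ℕ}

/-- Symmetric, bounded, coercive matrices. -/
structure Ell (lam Lam : ℝ) (A : Matrix (Fin d) (Fin d) ℝ) : Prop where
  symm : ∀ i j, A i j = A j i
  coer : ∀ ξ : Fin d → ℝ, lam * ∑ i, ξ i ^ 2 ≤ ∑ i, ∑ j, A i j * (ξ i * ξ j)
  bdd : ∀ i j, |A i j| ≤ Lam

@[simp] lemma ev_smul (x : Euc d) (c : ℝ) (p : Pol d) : ev x (c • p) = c * ev x p :=
  MvPolynomial.smul_eval _ _ _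

lemma I_smul {D : Set (Euc d)} (c : ℝ) (p : Pol d) : I D (c • p) = c * I D p := by
  rw [MvPolynomial.smul_eq_C_mul, I_C_mul]

/-- The constant coefficient operator `∑ A i j ∂ᵢ ∂ⱼ`. -/
noncomputable def LA (A : Matrix (Fin d) (Fin d) ℝ) : Pol d →ₗ[ℝ] Pol d :=
  ∑ i, ∑ j, A i j • ((pd i : Pol d →ₗ[ℝ] Pol d) ∘ₗ (pd j : Pol d →ₗ[ℝ] Pol d))

lemma LA_apply (A : Matrix (Fin d) (Fin d) ℝ) (p : Pol d) :
    LA A p = ∑ i, ∑ j, A i j • pd i (pd j p) := by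
  simp [LA, LinearMap.sum_apply]

/-- The squared length of the gradient. -/
noncomputable def gradSq (p : Pol d) : Pol d := ∑ i, pd i p ^ 2

/-- The polynomial `1 - |x|²`. -/
noncomputable def om : Pol d := 1 - ∑ i, MvPolynomial.X i ^ 2

lemma ev_om (x : Euc d) : ev x (om : Pol d) = 1 - ‖x‖ ^ 2 := by
  simp [om, EuclideanSpace.norm_sq_eq]

lemma ev_om_sphere {x : Euc d} (hx : x ∈ sphere (0 : Euc d) 1) : ev x (om : Pol d) = 0 := by
  rw [ev_om, mem_sphere_zero_iff_norm.1 hx]; norm_num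

lemma ev_om_mul_sphere (q : Pol d) {x : Euc d} (hx : x ∈ sphere (0 : Euc d) 1) :
    ev x (om * q) = 0 := by
  rw [map_mul, ev_om_sphere hx, zero_mul]

lemma frontier_ball_zero {x : Euc d} (hx : x ∈ frontier (ball (0 : Euc d) 1)) :
    x ∈ sphere (0 : Euc d) 1 := by
  rwa [frontier_ball _ one_ne_zero] at hx

lemma ev_gradSq (x : Euc d) (p : Pol d) : ev x (gradSq p) = ∑ i, ev x (pd i p) ^ 2 := by
  simp [gradSq]

lemma gradSq_nonneg (x : Euc d) (p : Pol d) : 0 ≤ ev x (gradSq p) := by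
  rw [ev_gradSq]; positivity

/-- Poincaré inequality in a slab. -/
lemma poincare {D : Set (Euc d)} (hD : CDom D) (e : Fin d → ℝ) (he : ∑ i, e i ^ 2 = 1) (c ℓ : ℝ)
    (hs : ∀ x ∈ D, |∑ i, e i * x i - c| ≤ ℓ) (v : Pol d)
    (hv : ∀ x ∈ frontier D, (∑ i, e i * x i - c) * ev x v ^ 2 = 0) :
    I D (v ^ 2) ≤ 4 * ℓ ^ 2 * I D (gradSq v) := by
  set s : Pol d := ∑ i, e i • MvPolynomial.X i - MvPolynomial.C c with hsdef
  have hsx : ∀ x : Euc d, ev x s = ∑ i, e i * x i - c := fun x => by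
    simp [hsdef]
  have hds : ∀ i, pd i s = MvPolynomial.C (e i) := fun i => by
    simp [hsdef, MvPolynomial.pderiv_X, Pi.single_apply, MvPolynomial.smul_eq_C_mul]
  have h0 : I D (∑ i, e i • pd i (s * v ^ 2)) = 0 := by
    rw [I_sum hD]
    refine Finset.sum_eq_zero fun i _ => ?_
    rw [I_smul, I_pd_eq_zero hD, mul_zero]
    intro x hx
    rw [map_mul, map_pow, hsx, hv x hx]
  have h1 : I D ((1 / 2 : ℝ) • v ^ 2 - (2 * ℓ ^ 2) • gradSq v) ≤ 0 := by
    rw [← h0]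
    refine I_mono hD fun x hx => ?_
    have hsl := hs x hx
    rw [← hsx] at hsl
    have hs2 : ev x s ^ 2 ≤ ℓ ^ 2 := sq_le_sq' (by linarith [(abs_le.1 hsl).1]) (abs_le.1 hsl).2
    have hcs : (∑ i, e i * ev x (pd i v)) ^ 2 ≤ ∑ i, ev x (pd i v) ^ 2 := by
      have := Finset.sum_mul_sq_le_sq_mul_sq Finset.univ e fun i => ev x (pd i v)
      rwa [he, one_mul] at this
    have e1 : ev x (∑ i, e i • pd i (s * v ^ 2))
        = ev x v ^ 2 + 2 * ev x s * ev x v * ∑ i, e i * ev x (pd i v) := by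
      simp only [map_sum, ev_smul, Derivation.leibniz, Derivation.leibniz_pow, hds, smul_eq_mul,
        map_add, map_mul, map_pow, MvPolynomial.eval_C, Nat.add_one_sub_one, pow_one, nsmul_eq_mul,
        Nat.cast_ofNat, map_ofNat, mul_add, Finset.sum_add_distrib]
      rw [add_comm]
      congr 1
      · trans (∑ i, e i ^ 2) * ev x v ^ 2
        swap; · rw [he, one_mul]
        rw [Finset.sum_mul]
        exact Finset.sum_congr rfl fun i _ => by ring
      · rw [Finset.mul_sum]
        exact Finset.sum_congr rfl fun i _ => by ring
    rw [e1, map_sub, ev_smul, ev_smul, map_pow, ev_gradSq]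
    set g := ∑ i, e i * ev x (pd i v)
    nlinarith [sq_nonneg (ev x v + 2 * ev x s * g), mul_le_mul hs2 hcs (sq_nonneg g) (sq_nonneg ℓ)]
  rw [I_sub hD, I_smul, I_smul] at h1
  linarith

/-- Global Poincaré inequality. -/
lemma poincare_ball (hd : 1 ≤ d) (v : Pol d) (hv : ∀ x ∈ sphere (0 : Euc d) 1, ev x v = 0) :
    I (ball 0 1) (v ^ 2) ≤ 4 * I (ball (0 : Euc d) 1) (gradSq v) := by
  have := poincare (CDom.ball (0 : Euc d) 1) (Pi.single ⟨0, hd⟩ 1) (by simp [Pi.single_apply]) 0 1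
    (fun x hx => by
      simp only [Pi.single_apply, ite_mul, one_mul, zero_mul, Finset.sum_ite_eq', Finset.mem_univ,
        if_true, sub_zero]
      exact (PiLp.norm_apply_le x _).trans (mem_ball_zero_iff.1 hx).le) v
    (fun x hx => by rw [hv x (frontier_ball_zero hx)]; ring)
  linarith

/-- Poincaré inequality in a cap of the ball. -/
lemma poincare_cap (v : Pol d) (hv : ∀ x ∈ sphere (0 : Euc d) 1, ev x v = 0)
    {y : Euc d} {ρ : ℝ} (hρ : 0 < ρ) (hy : y ≠ 0) (hy1 : 1 - ‖y‖ ≤ ρ) :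
    I (cut y (16 * ρ)) (v ^ 2) ≤ 4 * (17 * ρ) ^ 2 * I (ball (0 : Euc d) 1) (gradSq v) := by
  have hyn : 0 < ‖y‖ := norm_pos_iff.2 hy
  set e : Euc d := ‖y‖⁻¹ • y with hedef
  have hen : ‖e‖ = 1 := by rw [hedef, norm_smul, norm_inv, norm_norm, inv_mul_cancel₀ hyn.ne']
  have hin : ∀ x : Euc d, ∑ i, e i * x i = inner ℝ e x := fun x => by
    simp [PiLp.inner_apply, mul_comm]
  set H : Set (Euc d) := {x | 1 - 17 * ρ < inner ℝ e x} with hH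
  have hHo : IsOpen H := isOpen_lt continuous_const (by fun_prop)
  have hHc : Convex ℝ H := convex_halfSpace_gt (IsLinearMap.mk
    (fun a b => inner_add_right _ _ _) (fun c a => by simp [inner_smul_right])) _
  have hD : CDom (ball (0 : Euc d) 1 ∩ H) := ⟨isOpen_ball.inter hHo,
    (convex_ball _ _).inter hHc, isBounded_ball.subset inter_subset_left⟩
  have hle : ∀ x : Euc d, ‖x‖ < 1 → inner ℝ e x ≤ 1 := fun x hx => by
    have := real_inner_le_norm e x
    rw [hen] at this; linarith
  have h1 := poincare hD (fun i => e i) (by rw [← EuclideanSpace.real_norm_sq_eq, hen]; norm_num)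
    (1 - 17 * ρ) (17 * ρ) (fun x hx => by
      rw [hin, abs_le]
      have h2 := hle x (mem_ball_zero_iff.1 hx.1)
      have h3 : 1 - 17 * ρ < inner ℝ e x := hx.2
      constructor <;> linarith) v (fun x hx => by
      rw [hin]
      rcases frontier_inter_subset _ _ hx with h | h
      · rw [hv x (frontier_ball_zero h.1)]; ring
      · have : (1 - 17 * ρ) = inner ℝ e x :=
          frontier_lt_subset_eq continuous_const (by fun_prop) h.2
        rw [← this]; ring)
  refine (I_mono_set hD ?_ fun x _ => by rw [map_pow]; positivity).trans (h1.trans ?_)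
  · rintro x ⟨hx1, hx2⟩
    refine ⟨hx1, ?_⟩
    have h2 : inner ℝ e y = ‖y‖ := by
      rw [hedef, real_inner_smul_left, real_inner_self_eq_norm_sq]; field_simp
    have h3 : inner ℝ e x = inner ℝ e y - inner ℝ e (y - x) := by rw [inner_sub_right]; ring
    have h4 := real_inner_le_norm e (y - x)
    rw [hen, ← dist_eq_norm, dist_comm] at h4
    have h5 := mem_ball.1 hx2
    show 1 - 17 * ρ < inner ℝ e x
    linarith
  · refine mul_le_mul_of_nonneg_left (I_mono_set (CDom.ball 0 1) inter_subset_left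
      fun x _ => gradSq_nonneg x v) (by positivity)

/-- Energy inequality. -/
lemma energy {lam Lam : ℝ} {A : Matrix (Fin d) (Fin d) ℝ} (hA : Ell lam Lam A)
    {D : Set (Euc d)} (hD : CDom D) (v : Pol d) (hv : ∀ x ∈ frontier D, ev x v = 0) :
    lam * I D (gradSq v) ≤ -I D (v * LA A v) := by
  have h0 : I D (∑ i, pd i (∑ j, A i j • (v * pd j v))) = 0 := by
    rw [I_sum hD]
    refine Finset.sum_eq_zero fun i _ => I_pd_eq_zero hD (fun x hx => ?_) i
    simp [hv x hx]
  have h1 : I D (lam • gradSq v) ≤ I D (∑ i, pd i (∑ j, A i j • (v * pd j v)) - v * LA A v) := by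
    refine I_mono hD fun x _ => ?_
    have := hA.coer fun i => ev x (pd i v)
    rw [ev_smul, ev_gradSq]
    refine this.trans (le_of_eq ?_)
    rw [eq_comm, map_sub, sub_eq_iff_eq_add, LA_apply]
    simp only [map_sum, Derivation.map_smul, ev_smul, Derivation.leibniz, smul_eq_mul, map_add,
      map_mul, Finset.mul_sum, ← Finset.sum_add_distrib]
    exact Finset.sum_congr rfl fun i _ => Finset.sum_congr rfl fun j _ => by ring
  rw [I_smul, I_sub hD, h0] at h1
  linarith

/-- The Dirichlet energy is controlled by the right-hand side. -/
lemma energy_le (hd : 1 ≤ d) {lam Lam : ℝ} (hlam : 0 < lam) {A : Matrix (Fin d) (Fin d) ℝ}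
    (hA : Ell lam Lam A) (v : Pol d) (hv : ∀ x ∈ sphere (0 : Euc d) 1, ev x v = 0) :
    I (ball 0 1) (gradSq v) ≤ 4 / lam ^ 2 * I (ball (0 : Euc d) 1) (LA A v ^ 2) := by
  have hB := CDom.ball (0 : Euc d) 1
  have h1 := energy hA hB v fun x hx => hv x (frontier_ball_zero hx)
  have h2 := poincare_ball hd v hv
  have h3 : I (ball 0 1) (-(v * LA A v)) ≤
      I (ball (0 : Euc d) 1) ((lam / 8) • v ^ 2 + (2 / lam) • LA A v ^ 2) := by
    refine I_mono hB fun x _ => ?_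
    simp only [map_neg, map_mul, map_add, ev_smul, map_pow]
    set a := ev x v
    set b := ev x (LA A v)
    have : 0 ≤ (lam * a + 4 * b) ^ 2 / (8 * lam) := by positivity
    have e : (lam * a + 4 * b) ^ 2 / (8 * lam) = lam / 8 * a ^ 2 + 2 / lam * b ^ 2 + a * b := by
      field_simp; ring
    linarith
  rw [I_neg, I_add hB, I_smul, I_smul] at h3
  have h4 : lam / 2 * I (ball (0 : Euc d) 1) (gradSq v)
      ≤ 2 / lam * I (ball (0 : Euc d) 1) (LA A v ^ 2) := by nlinarith
  have h5 : 2 / lam * (lam / 2 * I (ball (0 : Euc d) 1) (gradSq v)) ≤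
    2 / lam * (2 / lam * I (ball (0 : Euc d) 1) (LA A v ^ 2)) :=
    mul_le_mul_of_nonneg_left h4 (by positivity)
  have e1 : 2 / lam * (lam / 2 * I (ball (0 : Euc d) 1) (gradSq v)) =
      I (ball (0 : Euc d) 1) (gradSq v) := by field_simp
  have e2 : 2 / lam * (2 / lam * I (ball (0 : Euc d) 1) (LA A v ^ 2))
     = 4 / lam ^ 2 * I (ball (0 : Euc d) 1) (LA A v ^ 2) := by field_simp; ring
  rwa [e1, e2] at h5

end Elliptic

end WeakType

namespace WeakType

section Existence

variable {d : ℕ}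

lemma totalDegree_pd_le (i : Fin d) (p : Pol d) : (pd i p).totalDegree ≤ p.totalDegree - 1 := by
  conv_lhs => rw [p.as_sum, map_sum]
  refine (MvPolynomial.totalDegree_finsetSum _ _).trans (Finset.sup_le fun s hs => ?_)
  rw [MvPolynomial.pderiv_monomial]
  by_cases h0 : s i = 0
  · simp [h0]
  have h1 : Finsupp.single i 1 ≤ s := by
    rw [Finsupp.single_le_iff]; omega
  refine (MvPolynomial.totalDegree_monomial_le _ _).trans ?_
  have h2 := MvPolynomial.le_totalDegree hs
  change ((s - Finsupp.single i 1).sum fun _ e => e) ≤ _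
  have h3 : ((s - Finsupp.single i 1).sum fun _ e => e) + 1 = s.sum fun _ e => e := by
    conv_rhs => rw [← tsub_add_cancel_of_le h1]
    rw [Finsupp.sum_add_index' (fun _ => rfl) (fun _ _ _ => rfl), Finsupp.sum_single_index rfl]
  omega

lemma totalDegree_om_le : (om : Pol d).totalDegree ≤ 2 := by
  refine (MvPolynomial.totalDegree_sub _ _).trans (max_le (by simp) ?_)
  refine (MvPolynomial.totalDegree_finsetSum _ _).trans (Finset.sup_le fun i _ => ?_)
  refine (MvPolynomial.totalDegree_pow _ _).trans ?_
  simp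

/-- The operator on polynomials `q ↦ L (ω q)`. -/
noncomputable def LOm (A : Matrix (Fin d) (Fin d) ℝ) : Pol d →ₗ[ℝ] Pol d :=
  LA A ∘ₗ LinearMap.mulLeft ℝ om

lemma LOm_apply (A : Matrix (Fin d) (Fin d) ℝ) (q : Pol d) : LOm A q = LA A (om * q) := rfl

lemma totalDegree_LOm_le (A : Matrix (Fin d) (Fin d) ℝ) (q : Pol d) :
    (LOm A q).totalDegree ≤ q.totalDegree := by
  rw [LOm_apply, LA_apply]
  have h1 : (om * q).totalDegree ≤ 2 + q.totalDegree :=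
    (MvPolynomial.totalDegree_mul _ _).trans (Nat.add_le_add_right totalDegree_om_le _)
  refine (MvPolynomial.totalDegree_finsetSum _ _).trans (Finset.sup_le fun i _ => ?_)
  refine (MvPolynomial.totalDegree_finsetSum _ _).trans (Finset.sup_le fun j _ => ?_)
  refine (MvPolynomial.totalDegree_smul_le _ _).trans ?_
  have h2 := totalDegree_pd_le i (pd j (om * q))
  have h3 := totalDegree_pd_le j (om * q)
  omega

lemma om_ne_zero : (om : Pol d) ≠ 0 := fun h => by
  have := ev_om (0 : Euc d)
  rw [h] at this
  simp at this

lemma eq_zero_of_I_sq {p : Pol d} (h : I (ball (0 : Euc d) 1) (p ^ 2) = 0) : p = 0 := by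
  have hB := CDom.ball (0 : Euc d) 1
  refine eq_zero_of_ev_ball (y := 0) one_pos fun x hx => ?_
  have h1 := (setIntegral_eq_zero_iff_of_nonneg_ae
    (ae_restrict_of_forall_mem hB.measurableSet fun x _ => by
      show (0 : ℝ) ≤ ev x (p ^ 2); rw [map_pow]; positivity)
    (hB.integrableOn (continuous_ev (p ^ 2)))).1 h
  have h2 := Measure.eqOn_open_of_ae_eq h1 hB.isOpen (continuous_ev _).continuousOn
    continuousOn_const hx
  simpa using h2

variable {lam Lam : ℝ} {A : Matrix (Fin d) (Fin d) ℝ}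

lemma LOm_injective (hd : 1 ≤ d) (hlam : 0 < lam) (hA : Ell lam Lam A) :
    Function.Injective (LOm A) := by
  rw [← LinearMap.ker_eq_bot, LinearMap.ker_eq_bot']
  intro q hq
  have hv := fun x hx => ev_om_mul_sphere q (x := x) hx
  have h1 := energy_le hd hlam hA _ hv
  have h2 := poincare_ball hd _ hv
  rw [← LOm_apply, hq] at h1
  have h3 : I (ball (0 : Euc d) 1) ((om * q) ^ 2) = 0 :=
    le_antisymm (by simp [I_zero] at h1; linarith) (I_sq_nonneg (CDom.ball 0 1) _)
  exact (mul_eq_zero.1 (eq_zero_of_I_sq h3)).resolve_left om_ne_zero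

lemma LOm_surjective (hd : 1 ≤ d) (hlam : 0 < lam) (hA : Ell lam Lam A) :
    Function.Surjective (LOm A) := by
  intro p
  set W := MvPolynomial.restrictTotalDegree (Fin d) ℝ p.totalDegree with hW
  have hmap : ∀ q ∈ W, LOm A q ∈ W := fun q hq => by
    rw [MvPolynomial.mem_restrictTotalDegree] at hq ⊢
    exact (totalDegree_LOm_le A q).trans hq
  have hinj : Function.Injective ((LOm A).restrict hmap) := fun a b h =>
    Subtype.ext (LOm_injective hd hlam hA (congrArg Subtype.val h))
  obtain ⟨q, hq⟩ := LinearMap.injective_iff_surjective.1 hinj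
    ⟨p, (MvPolynomial.mem_restrictTotalDegree _ _ _).2 le_rfl⟩
  exact ⟨q, congrArg Subtype.val hq⟩

/-- Solvability of the Dirichlet problem in polynomials. -/
lemma exists_solution (hd : 1 ≤ d) (hlam : 0 < lam) (hA : Ell lam Lam A) :
    ∃ V : Pol d →ₗ[ℝ] Pol d, (∀ p, LA A (V p) = p) ∧ ∀ p, ∃ q, V p = om * q := by
  set e := LinearEquiv.ofBijective (LOm A)
    ⟨LOm_injective hd hlam hA, LOm_surjective hd hlam hA⟩ with he
  refine ⟨LinearMap.mulLeft ℝ om ∘ₗ e.symm.toLinearMap, fun p => ?_, fun p => ⟨e.symm p, rfl⟩⟩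
  exact e.apply_symm_apply p

end Existence

end WeakType

namespace WeakType

section Caccioppoli

variable {d : ℕ}

lemma cacc_pointwise {lam Lam : ℝ} (hlam : 0 < lam) {A : Matrix (Fin d) (Fin d) ℝ}
    (hA : Ell lam Lam A) (g n f : Fin d → ℝ) (z k : ℝ) :
    -(2 * ∑ i, ∑ j, A i j * (n i * g j)) - z * k + ∑ i, g i * f i + 2 * ∑ i, n i * f i
      ≤ lam / 2 * ∑ i, g i ^ 2 + ((d + 1) ^ 2 * Lam ^ 2 * 4 / lam + 2 / lam + 2) *
        (∑ i, n i ^ 2 + ∑ i, f i ^ 2 + z ^ 2 + k ^ 2) := by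
  set ε := lam / (4 * (d + 1)) with hε
  have hd1 : (0 : ℝ) < d + 1 := by positivity
  have hε0 : 0 < ε := by positivity
  have h1 : -(2 * ∑ i, ∑ j, A i j * (n i * g j))
      ≤ ∑ i : Fin d, ∑ j, (ε * g j ^ 2 + Lam ^ 2 / ε * n i ^ 2) := by
    rw [Finset.mul_sum, ← Finset.sum_neg_distrib]
    refine Finset.sum_le_sum fun i _ => ?_
    rw [Finset.mul_sum, ← Finset.sum_neg_distrib]
    refine Finset.sum_le_sum fun j _ => ?_
    have ha : A i j ^ 2 ≤ Lam ^ 2 := by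
      have := hA.bdd i j
      exact sq_le_sq' (by linarith [(abs_le.1 this).1]) (abs_le.1 this).2
    have h2 : 0 ≤ (ε * g j + A i j * n i) ^ 2 / ε := by positivity
    have e2 : (ε * g j + A i j * n i) ^ 2 / ε
        = ε * g j ^ 2 + A i j ^ 2 / ε * n i ^ 2 + 2 * (A i j * (n i * g j)) := by
      field_simp; ring
    have h3 : A i j ^ 2 / ε * n i ^ 2 ≤ Lam ^ 2 / ε * n i ^ 2 := by gcongr
    linarith
  have h2 : ∑ i : Fin d, ∑ j, (ε * g j ^ 2 + Lam ^ 2 / ε * n i ^ 2)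
      = d * ε * ∑ i, g i ^ 2 + d * (Lam ^ 2 / ε) * ∑ i, n i ^ 2 := by
    simp only [Finset.sum_add_distrib, ← Finset.mul_sum, Finset.sum_const, Finset.card_univ,
      Fintype.card_fin, nsmul_eq_mul]
    ring
  have h3 : ∑ i, g i * f i ≤ lam / 8 * ∑ i, g i ^ 2 + 2 / lam * ∑ i, f i ^ 2 := by
    rw [Finset.mul_sum, Finset.mul_sum, ← Finset.sum_add_distrib]
    refine Finset.sum_le_sum fun i _ => ?_
    have h2 : 0 ≤ (lam * g i - 4 * f i) ^ 2 / (8 * lam) := by positivity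
    have e2 : (lam * g i - 4 * f i) ^ 2 / (8 * lam)
        = lam / 8 * g i ^ 2 + 2 / lam * f i ^ 2 - g i * f i := by field_simp; ring
    linarith
  have h4 : 2 * ∑ i, n i * f i ≤ ∑ i, n i ^ 2 + ∑ i, f i ^ 2 := by
    rw [Finset.mul_sum, ← Finset.sum_add_distrib]
    exact Finset.sum_le_sum fun i _ => by nlinarith [sq_nonneg (n i - f i)]
  have h5 : -(z * k) ≤ z ^ 2 + k ^ 2 := by nlinarith [sq_nonneg (z + k), sq_nonneg z, sq_nonneg k]
  have hG : 0 ≤ ∑ i, g i ^ 2 := by positivity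
  have hN : 0 ≤ ∑ i, n i ^ 2 := by positivity
  have hF : 0 ≤ ∑ i, f i ^ 2 := by positivity
  have h6 : d * ε ≤ lam / 4 := by
    rw [hε, ← mul_div_assoc, div_le_div_iff₀ (by positivity) (by norm_num)]
    nlinarith
  have h7 : d * (Lam ^ 2 / ε) ≤ (d + 1) ^ 2 * Lam ^ 2 * 4 / lam := by
    have : d * (Lam ^ 2 / ε) = d * (d + 1) * Lam ^ 2 * 4 / lam := by
      rw [hε]; field_simp
    rw [this]
    gcongr
    nlinarith
  have h8 := mul_le_mul_of_nonneg_right h6 hG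
  have h9 := mul_le_mul_of_nonneg_right h7 hN
  have hz : 0 ≤ z ^ 2 := sq_nonneg z
  have hk : 0 ≤ k ^ 2 := sq_nonneg k
  have hc1 : 0 ≤ (d + 1) ^ 2 * Lam ^ 2 * 4 / lam := by positivity
  have hc2 : 0 ≤ 2 / lam := by positivity
  set c1 := (d + 1) ^ 2 * Lam ^ 2 * 4 / lam
  set c2 := 2 / lam
  have : c1 * ∑ i, n i ^ 2 + c2 * ∑ i, f i ^ 2 + (∑ i, n i ^ 2 + ∑ i, f i ^ 2) + (z ^ 2 + k ^ 2)
    ≤ (c1 + c2 + 2) * (∑ i, n i ^ 2 + ∑ i, f i ^ 2 + z ^ 2 + k ^ 2) := by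
    nlinarith [mul_nonneg hc1 hF, mul_nonneg hc1 hz, mul_nonneg hc1 hk, mul_nonneg hc2 hN,
      mul_nonneg hc2 hz, mul_nonneg hc2 hk]
  have := mul_nonneg hlam.le hG
  linarith

/-- Caccioppoli inequality. -/
lemma cacc (d : ℕ) {lam Lam : ℝ} (hlam : 0 < lam) :
    ∃ C : ℝ, 0 < C ∧ ∀ (A : Matrix (Fin d) (Fin d) ℝ), Ell lam Lam A →
      ∀ (D : Set (Euc d)), CDom D → ∀ (w η h : Pol d) (F : Fin d → Pol d),
      (∀ x ∈ frontier D, ev x (η * w) = 0) → LA A w = h + ∑ i, pd i (F i) →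
      I D (η ^ 2 * gradSq w) ≤ C * I D (w ^ 2 * gradSq η + η ^ 2 * ∑ i, F i ^ 2
        + η ^ 2 * w ^ 2 + η ^ 2 * h ^ 2) := by
  set C0 := (d + 1) ^ 2 * Lam ^ 2 * 4 / lam + 2 / lam + 2 with hC0
  refine ⟨2 / lam * C0, by positivity, fun A hA D hD w η h F hbd hw => ?_⟩
  have h0 : I D (∑ i, pd i (η ^ 2 * w * (∑ j, A i j • pd j w - F i))) = 0 := by
    rw [I_sum hD]
    refine Finset.sum_eq_zero fun i _ => I_pd_eq_zero hD (fun x hx => ?_) i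
    have : η ^ 2 * w * (∑ j, A i j • pd j w - F i)
      = (η * w) * (η * (∑ j, A i j • pd j w - F i)) := by ring
    rw [this, map_mul, hbd x hx, zero_mul]
  have hdiv : ∑ i, pd i (∑ j, A i j • pd j w - F i) = h := by
    simp only [map_sub, Finset.sum_sub_distrib, map_sum, Derivation.map_smul]
    rw [← LA_apply, hw]; ring
  have h1 : I D (lam • (η ^ 2 * gradSq w)) ≤
      I D (∑ i, pd i (η ^ 2 * w * (∑ j, A i j • pd j w - F i)) + (lam / 2) • (η ^ 2 * gradSq w)
      + C0 • (w ^ 2 * gradSq η + η ^ 2 * ∑ i, F i ^ 2 + η ^ 2 * w ^ 2 + η ^ 2 * h ^ 2)) := by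
    refine I_mono hD fun x _ => ?_
    have hc := hA.coer fun i => ev x η * ev x (pd i w)
    have hp := cacc_pointwise hlam hA (fun i => ev x η * ev x (pd i w))
      (fun i => ev x w * ev x (pd i η)) (fun i => ev x η * ev x (F i)) (ev x η * ev x w)
      (ev x η * ev x h)
    have e1 : ∑ i, pd i (η ^ 2 * w * (∑ j, A i j • pd j w - F i))
        = η ^ 2 * w * h + ∑ i, (η ^ 2 * pd i w + 2 * η * w * pd i η) *
          (∑ j, A i j • pd j w - F i) := by
      simp only [Derivation.leibniz (pd _) (η ^ 2 * w)]
      rw [Finset.sum_add_distrib]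
      congr 1
      · rw [← hdiv, Finset.mul_sum]; rfl
      · refine Finset.sum_congr rfl fun i _ => ?_
        simp only [Derivation.leibniz, Derivation.leibniz_pow, smul_eq_mul, nsmul_eq_mul]
        push_cast
        ring
    rw [e1]
    simp only [map_add, map_sub, map_mul, map_pow, map_sum, ev_smul, ev_gradSq, map_ofNat]
    have e2 : ∑ i, (ev x η ^ 2 * ev x (pd i w) + 2 * ev x η * ev x w * ev x (pd i η)) *
          (∑ j, A i j * ev x (pd j w) - ev x (F i))
        = ∑ i, ∑ j, A i j * (ev x η * ev x (pd i w) * (ev x η * ev x (pd j w)))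
          + 2 * ∑ i, ∑ j, A i j * (ev x w * ev x (pd i η) * (ev x η * ev x (pd j w)))
          - ∑ i, (ev x η * ev x (pd i w)) * (ev x η * ev x (F i))
          - 2 * ∑ i, (ev x w * ev x (pd i η)) * (ev x η * ev x (F i)) := by
      simp only [Finset.mul_sum, ← Finset.sum_add_distrib, ← Finset.sum_sub_distrib]
      refine Finset.sum_congr rfl fun i _ => ?_
      rw [mul_sub, Finset.mul_sum, sub_sub, ← sub_eq_zero]
      have : ∀ a b c e : ℝ, a = b → c = e → a - c - (b - e) = 0 := fun a b c e h h' => by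
        rw [h, h']; ring
      refine this _ _ _ _ (Finset.sum_congr rfl fun j _ => by ring) (by ring)
    rw [e2]
    simp only [mul_pow, ← Finset.mul_sum] at hp hc ⊢
    nlinarith [hp, hc]
  rw [I_smul, I_add hD, I_add hD, h0, I_smul, I_smul] at h1
  set X := I D (η ^ 2 * gradSq w)
  set Y := I D (w ^ 2 * gradSq η + η ^ 2 * ∑ i, F i ^ 2 + η ^ 2 * w ^ 2 + η ^ 2 * h ^ 2)
  have h2 : lam / 2 * X ≤ C0 * Y := by linarith
  have h3 := mul_le_mul_of_nonneg_left h2 (show 0 ≤ 2 / lam by positivity)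
  have e3 : 2 / lam * (lam / 2 * X) = X := by field_simp
  linarith

/-- The cut-off polynomial `r² - |x - y|²`. -/
noncomputable def etaP (y : Euc d) (r : ℝ) : Pol d :=
  MvPolynomial.C (r ^ 2) - ∑ i, (MvPolynomial.X i - MvPolynomial.C (y i)) ^ 2

lemma ev_etaP (y x : Euc d) (r : ℝ) : ev x (etaP y r) = r ^ 2 - dist x y ^ 2 := by
  simp [etaP, EuclideanSpace.dist_eq, Real.sq_sqrt (Finset.sum_nonneg fun i _ => sq_nonneg _),
    Real.dist_eq, sq_abs]

lemma ev_gradSq_etaP (y x : Euc d) (r : ℝ) : ev x (gradSq (etaP y r)) = 4 * dist x y ^ 2 := by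
  have : ∀ i, pd i (etaP y r) = -(2 * (MvPolynomial.X i - MvPolynomial.C (y i))) := fun i => by
    simp [etaP, Derivation.leibniz_pow, MvPolynomial.pderiv_X, Pi.single_apply]
  rw [ev_gradSq]
  simp only [this, EuclideanSpace.dist_eq, Real.dist_eq, sq_abs]
  rw [Real.sq_sqrt (Finset.sum_nonneg fun i _ => sq_nonneg _), Finset.mul_sum]
  refine Finset.sum_congr rfl fun i _ => ?_
  simp
  ring

/-- Caccioppoli inequality on balls cut with the unit ball. -/
lemma cacc_local (d : ℕ) {lam Lam : ℝ} (hlam : 0 < lam) :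
    ∃ C : ℝ, 0 < C ∧ ∀ (A : Matrix (Fin d) (Fin d) ℝ), Ell lam Lam A →
      ∀ (y : Euc d) (r : ℝ), 0 < r → r ≤ 1 → ∀ (w h : Pol d) (F : Fin d → Pol d),
      (∀ x ∈ sphere (0 : Euc d) 1, x ∈ ball y r → ev x w = 0) → LA A w = h + ∑ i, pd i (F i) →
      I (cut y (r / 2)) (gradSq w) ≤ C * (r⁻¹ ^ 2 * I (cut y r) (w ^ 2)
        + I (cut y r) (∑ i, F i ^ 2) + I (cut y r) (h ^ 2)) := by
  obtain ⟨C, hC, hcacc⟩ := cacc d (Lam := Lam) hlam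
  refine ⟨10 * C, by positivity, fun A hA y r hr hr1 w h F hbd hw => ?_⟩
  have hD := CDom.cut y r
  have h1 := hcacc A hA (cut y r) hD w (etaP y r) h F (fun x hx => by
    rw [map_mul]
    rcases frontier_inter_subset _ _ hx with h | h
    · have hx1 := closure_ball_subset_closedBall h.2
      rcases (mem_closedBall.1 hx1).lt_or_eq with h2 | h2
      · rw [hbd x (frontier_ball_zero h.1) h2, mul_zero]
      · rw [ev_etaP, h2]; ring
    · have : dist x y = r := by
        have := h.2
        rw [frontier_ball _ hr.ne'] at this
        exact this
      rw [ev_etaP, this]; ring) hw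
  have h2 : I (cut y r) (w ^ 2 * gradSq (etaP y r) + etaP y r ^ 2 * ∑ i, F i ^ 2
        + etaP y r ^ 2 * w ^ 2 + etaP y r ^ 2 * h ^ 2) ≤
      I (cut y r) (r ^ 4 • ((5 * r⁻¹ ^ 2) • w ^ 2 + ∑ i, F i ^ 2 + h ^ 2)) := by
    refine I_mono hD fun x hx => ?_
    have hx2 : dist x y < r := hx.2
    have hd0 : 0 ≤ dist x y := dist_nonneg
    have hη0 : 0 ≤ r ^ 2 - dist x y ^ 2 := by nlinarith
    have hη : (r ^ 2 - dist x y ^ 2) ^ 2 ≤ r ^ 4 := by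
      have : r ^ 2 - dist x y ^ 2 ≤ r ^ 2 := by nlinarith
      calc _ ≤ (r ^ 2) ^ 2 := pow_le_pow_left₀ hη0 this 2
        _ = _ := by ring
    simp only [map_add, map_mul, map_pow, map_sum, ev_smul, ev_gradSq_etaP, ev_etaP]
    have hF : 0 ≤ ∑ i, ev x (F i) ^ 2 := by positivity
    have hw0 := sq_nonneg (ev x w)
    have hh0 := sq_nonneg (ev x h)
    have e1 : r ^ 4 * (5 * r⁻¹ ^ 2 * ev x w ^ 2 + ∑ i, ev x (F i) ^ 2 + ev x h ^ 2)
      = 5 * r ^ 2 * ev x w ^ 2 + r ^ 4 * (∑ i, ev x (F i) ^ 2) + r ^ 4 * ev x h ^ 2 := by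
      field_simp
    rw [e1]
    have h3 := mul_le_mul_of_nonneg_right hη hF
    have h4 := mul_le_mul_of_nonneg_right hη hw0
    have h5 := mul_le_mul_of_nonneg_right hη hh0
    have h6 : r ^ 4 * ev x w ^ 2 ≤ r ^ 2 * ev x w ^ 2 :=
      mul_le_mul_of_nonneg_right (pow_le_pow_of_le_one hr.le hr1 (by norm_num)) hw0
    have h7 : dist x y ^ 2 ≤ r ^ 2 := by nlinarith
    have h8 := mul_le_mul_of_nonneg_left h7 hw0
    linarith
  have h3 : I (cut y (r / 2)) ((r ^ 4 / 2) • gradSq w) ≤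
      I (cut y r) (etaP y r ^ 2 * gradSq w) := by
    refine le_trans (I_mono (CDom.cut y (r / 2)) (q := etaP y r ^ 2 * gradSq w) fun x hx => ?_)
      (I_mono_set hD (cut_mono y (by linarith)) fun x _ => by
        rw [map_mul, map_pow]; exact mul_nonneg (sq_nonneg _) (gradSq_nonneg _ _))
    rw [map_mul, map_pow, ev_smul, ev_etaP]
    refine mul_le_mul_of_nonneg_right ?_ (gradSq_nonneg _ _)
    have hx2 : dist x y < r / 2 := hx.2
    have hd0 : 0 ≤ dist x y := dist_nonneg
    have : 3 / 4 * r ^ 2 ≤ r ^ 2 - dist x y ^ 2 := by nlinarith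
    calc r ^ 4 / 2 ≤ (3 / 4 * r ^ 2) ^ 2 := by nlinarith [pow_pos hr 4]
      _ ≤ _ := pow_le_pow_left₀ (by positivity) this 2
  rw [I_smul] at h3
  rw [I_smul (r ^ 4), I_add hD (_ • _ + _) (h ^ 2), I_add hD _ (∑ i, F i ^ 2), I_smul] at h2
  have h4 := h3.trans (h1.trans (mul_le_mul_of_nonneg_left h2 hC.le))
  set X := I (cut y (r / 2)) (gradSq w)
  have hW := I_sq_nonneg hD w
  have hH := I_sq_nonneg hD h
  have hF : 0 ≤ I (cut y r) (∑ i, F i ^ 2) := I_nonneg hD fun x _ => by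
    simp only [map_sum, map_pow]; positivity
  set W := I (cut y r) (w ^ 2)
  set H := I (cut y r) (h ^ 2)
  set G := I (cut y r) (∑ i, F i ^ 2)
  have hr4 : 0 < r ^ 4 := by positivity
  have h5 : r ^ 4 * X ≤ r ^ 4 * (2 * C * (5 * r⁻¹ ^ 2 * W + G + H)) := by linarith
  have h6 := le_of_mul_le_mul_left h5 hr4
  refine h6.trans ?_
  have := mul_nonneg hC.le hH
  have := mul_nonneg hC.le hF
  linarith

end Caccioppoli

end WeakType

namespace WeakType

section Seminorm

variable {d : ℕ} {D : Set (Euc d)}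

/-- The `L²` seminorm of a polynomial over a domain. -/
noncomputable def nrm (D : Set (Euc d)) (p : Pol d) : ℝ := √(I D (p ^ 2))

lemma nrm_nonneg (p : Pol d) : 0 ≤ nrm D p := Real.sqrt_nonneg _

lemma nrm_sq (hD : CDom D) (p : Pol d) : nrm D p ^ 2 = I D (p ^ 2) :=
  Real.sq_sqrt (I_sq_nonneg hD p)

lemma nrm_le {p : Pol d} {M : ℝ} (hM : 0 ≤ M) (h : I D (p ^ 2) ≤ M ^ 2) : nrm D p ≤ M :=
  (Real.sqrt_le_left hM).2 h

lemma I_mul_le (hD : CDom D) (p q : Pol d) : I D (p * q) ≤ nrm D p * nrm D q := by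
  have h : ∀ t : ℝ, 0 ≤ I D (q ^ 2) * (t * t) + (2 * I D (p * q)) * t + I D (p ^ 2) := fun t => by
    have e : I D ((p + t • q) ^ 2)
        = I D (q ^ 2) * (t * t) + (2 * I D (p * q)) * t + I D (p ^ 2) := by
      have : (p + t • q) ^ 2 = p ^ 2 + (2 * t) • (p * q) + (t * t) • q ^ 2 := by
        simp only [MvPolynomial.smul_eq_C_mul, MvPolynomial.C_mul]
        rw [show (MvPolynomial.C 2 : Pol d) = 2 from map_ofNat _ 2]
        ring
      rw [this, I_add hD, I_add hD, I_smul, I_smul]; ring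
    rw [← e]; exact I_sq_nonneg hD _
  have h1 := discrim_le_zero h
  rw [discrim, ← nrm_sq hD, ← nrm_sq hD] at h1
  refine abs_le_of_sq_le_sq' ?_ (mul_nonneg (nrm_nonneg p) (nrm_nonneg q)) |>.2
  nlinarith

lemma nrm_add_le (hD : CDom D) (p q : Pol d) : nrm D (p + q) ≤ nrm D p + nrm D q := by
  refine nrm_le (add_nonneg (nrm_nonneg p) (nrm_nonneg q)) ?_
  have : (p + q) ^ 2 = p ^ 2 + (2 : ℝ) • (p * q) + q ^ 2 := by
    simp only [MvPolynomial.smul_eq_C_mul]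
    rw [show (MvPolynomial.C 2 : Pol d) = 2 from map_ofNat _ 2]
    ring
  rw [this, I_add hD, I_add hD, I_smul, ← nrm_sq hD, ← nrm_sq hD]
  nlinarith [I_mul_le hD p q]

lemma nrm_smul (c : ℝ) (p : Pol d) : nrm D (c • p) = |c| * nrm D p := by
  rw [nrm, smul_pow, I_smul, Real.sqrt_mul (sq_nonneg c), Real.sqrt_sq_eq_abs, nrm]

lemma nrm_neg (p : Pol d) : nrm D (-p) = nrm D p := by rw [nrm, neg_sq, nrm]

lemma nrm_sub_le (hD : CDom D) (p q : Pol d) : nrm D (p - q) ≤ nrm D p + nrm D q := by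
  rw [sub_eq_add_neg, ← nrm_neg q]; exact nrm_add_le hD _ _

lemma nrm_zero : nrm D (0 : Pol d) = 0 := by simp [nrm, I_zero]

lemma nrm_sum_le (hD : CDom D) {ι : Type*} (s : Finset ι) (p : ι → Pol d) :
    nrm D (∑ i ∈ s, p i) ≤ ∑ i ∈ s, nrm D (p i) :=
  Finset.le_sum_of_subadditive (nrm D) nrm_zero.le (nrm_add_le hD) s p

lemma nrm_sum_le_card (hD : CDom D) (p : Fin d → Pol d) {M : ℝ} (h : ∀ i, nrm D (p i) ≤ M) :
    nrm D (∑ i, p i) ≤ d * M := by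
  refine (nrm_sum_le hD _ p).trans ((Finset.sum_le_sum fun i _ => h i).trans ?_)
  simp

lemma nrm_mono (hD : CDom D) {p q : Pol d} (h : ∀ x ∈ D, |ev x p| ≤ |ev x q|) :
    nrm D p ≤ nrm D q :=
  Real.sqrt_le_sqrt (I_mono hD fun x hx => by
    rw [map_pow, map_pow]; exact sq_le_sq.2 (h x hx))

lemma nrm_mono_set (hD : CDom D) {D' : Set (Euc d)} (hs : D' ⊆ D) (p : Pol d) :
    nrm D' p ≤ nrm D p :=
  Real.sqrt_le_sqrt (I_mono_set hD hs fun x _ => by rw [map_pow]; positivity)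

/-- Square root of the volume of the unit ball. -/
noncomputable def sqB (d : ℕ) : ℝ := √(volume.real (ball (0 : Euc d) 1))

lemma nrm_le_of_bound (hD : CDom D) (hs : D ⊆ ball 0 1) {p : Pol d} {ε : ℝ}
    (hε : 0 ≤ ε) (h : ∀ x ∈ D, |ev x p| ≤ ε) : nrm D p ≤ ε * sqB d := by
  refine (nrm_mono hD (q := MvPolynomial.C ε) fun x hx => ?_).trans
    ((nrm_mono_set (CDom.ball 0 1) hs _).trans (le_of_eq ?_))
  · simpa [abs_of_nonneg hε] using h x hx
  · rw [nrm, sqB, ← MvPolynomial.C_pow]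
    simp only [I, MvPolynomial.eval_C, setIntegral_const, smul_eq_mul]
    rw [mul_comm, Real.sqrt_mul (sq_nonneg _), Real.sqrt_sq hε]

lemma nrm_pd_le (hD : CDom D) (j : Fin d) (p : Pol d) : nrm D (pd j p) ≤ √(I D (gradSq p)) :=
  Real.sqrt_le_sqrt (I_mono hD fun x _ => by
    rw [map_pow, ev_gradSq]
    exact Finset.single_le_sum (f := fun i => ev x (pd i p) ^ 2) (fun i _ => sq_nonneg _)
      (Finset.mem_univ j))

end Seminorm

section Words

variable {d : ℕ}

/-- Iterated partial derivatives. -/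
noncomputable def Dw : List (Fin d) → Pol d →ₗ[ℝ] Pol d
  | [] => LinearMap.id
  | a :: γ => Dw γ ∘ₗ (pd a : Pol d →ₗ[ℝ] Pol d)

@[simp] lemma Dw_nil (p : Pol d) : Dw [] p = p := rfl

lemma Dw_cons (a : Fin d) (γ : List (Fin d)) (p : Pol d) : Dw (a :: γ) p = Dw γ (pd a p) := rfl

lemma pd_Dw (a : Fin d) (γ : List (Fin d)) (p : Pol d) : pd a (Dw γ p) = Dw γ (pd a p) := by
  induction γ generalizing p with
  | nil => rfl
  | cons b γ ih => rw [Dw_cons, Dw_cons, ih, pd_comm]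

lemma Dw_append (β γ : List (Fin d)) (p : Pol d) : Dw (β ++ γ) p = Dw γ (Dw β p) := by
  induction β generalizing p with
  | nil => rfl
  | cons b β ih => exact ih _

lemma LA_pd (A : Matrix (Fin d) (Fin d) ℝ) (a : Fin d) (p : Pol d) :
    LA A (pd a p) = pd a (LA A p) := by
  simp only [LA_apply, map_sum, Derivation.map_smul]
  refine Finset.sum_congr rfl fun i _ => Finset.sum_congr rfl fun j _ => ?_
  rw [pd_comm j a, pd_comm i a]

lemma LA_Dw (A : Matrix (Fin d) (Fin d) ℝ) (γ : List (Fin d)) (p : Pol d) :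
    LA A (Dw γ p) = Dw γ (LA A p) := by
  induction γ generalizing p with
  | nil => rfl
  | cons b γ ih => rw [Dw_cons, ih, LA_pd, Dw_cons]

/-- The rotation fields `xᵢ ∂ⱼ - xⱼ ∂ᵢ`. -/
noncomputable def Zr (z : Fin d × Fin d) : Derivation ℝ (Pol d) (Pol d) :=
  (MvPolynomial.X z.1 : Pol d) • pd z.2 - (MvPolynomial.X z.2 : Pol d) • pd z.1

lemma Zr_apply (z : Fin d × Fin d) (p : Pol d) :
    Zr z p = MvPolynomial.X z.1 * pd z.2 p - MvPolynomial.X z.2 * pd z.1 p := by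
  simp [Zr, Derivation.sub_apply, Derivation.smul_apply]

lemma Zr_om (z : Fin d × Fin d) : Zr z om = 0 := by
  have : ∀ i, pd i (om : Pol d) = -(2 * MvPolynomial.X i) := fun i => by
    simp [om, Derivation.leibniz_pow, MvPolynomial.pderiv_X, Pi.single_apply]
  rw [Zr_apply, this, this]; ring

lemma Zr_om_mul (z : Fin d × Fin d) (q : Pol d) : Zr z (om * q) = om * Zr z q := by
  rw [Derivation.leibniz, Zr_om, smul_zero, add_zero, smul_eq_mul]

/-- Commutator of a partial derivative and a rotation. -/
noncomputable def cz (k : Fin d) (z : Fin d × Fin d) : Pol d →ₗ[ℝ] Pol d :=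
  (if k = z.1 then (pd z.2 : Pol d →ₗ[ℝ] Pol d) else 0)
    - (if k = z.2 then (pd z.1 : Pol d →ₗ[ℝ] Pol d) else 0)

lemma pd_Zr (k : Fin d) (z : Fin d × Fin d) (p : Pol d) :
    pd k (Zr z p) = Zr z (pd k p) + cz k z p := by
  simp only [Zr_apply, map_sub, Derivation.leibniz, smul_eq_mul, MvPolynomial.pderiv_X, cz,
    Pi.single_apply, LinearMap.sub_apply]
  rw [pd_comm k z.2, pd_comm k z.1]
  have h : ∀ (i j : Fin d), (if k = i then (pd j : Pol d →ₗ[ℝ] Pol d) else 0) p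
      = pd j p * (if i = k then 1 else 0) := fun i j => by
    by_cases h : k = i
    · simp [h]
    · simp [h, Ne.symm h]
  rw [h, h]
  ring

/-- Iterated rotations. -/
noncomputable def Zw : List (Fin d × Fin d) → Pol d →ₗ[ℝ] Pol d
  | [] => LinearMap.id
  | z :: J => Zw J ∘ₗ (Zr z : Pol d →ₗ[ℝ] Pol d)

@[simp] lemma Zw_nil (p : Pol d) : Zw [] p = p := rfl

lemma Zw_cons (z : Fin d × Fin d) (J : List (Fin d × Fin d)) (p : Pol d) :
    Zw (z :: J) p = Zw J (Zr z p) := rfl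

lemma Zw_concat (z : Fin d × Fin d) (J : List (Fin d × Fin d)) (p : Pol d) :
    Zw (J ++ [z]) p = Zr z (Zw J p) := by
  induction J generalizing p with
  | nil => rfl
  | cons b J ih => exact ih _

lemma Zw_om_mul (J : List (Fin d × Fin d)) (q : Pol d) : Zw J (om * q) = om * Zw J q := by
  induction J generalizing q with
  | nil => rfl
  | cons z J ih => rw [Zw_cons, Zr_om_mul, ih, Zw_cons]

/-- The matrix of the commutator of a rotation with a constant coefficient operator. -/
def dA (A : Matrix (Fin d) (Fin d) ℝ) (z : Fin d × Fin d) : Matrix (Fin d) (Fin d) ℝ :=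
  fun a b => (if a = z.2 then A z.1 b else 0) - (if a = z.1 then A z.2 b else 0)
    + (if b = z.2 then A a z.1 else 0) - (if b = z.1 then A a z.2 else 0)

lemma abs_dA_le {A : Matrix (Fin d) (Fin d) ℝ} {c : ℝ} (hc : 0 ≤ c) (h : ∀ i j, |A i j| ≤ c)
    (z : Fin d × Fin d) (i j : Fin d) : |dA A z i j| ≤ 4 * c := by
  have h1 : ∀ (P : Prop) [Decidable P] (i j), |if P then A i j else 0| ≤ c := fun P _ i j => by
    split_ifs
    · exact h i j
    · simpa using hc
  unfold dA
  have a1 := abs_le.1 (h1 (i = z.1) z.2 j)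
  have a2 := abs_le.1 (h1 (i = z.2) z.1 j)
  have a3 := abs_le.1 (h1 (j = z.1) i z.2)
  have a4 := abs_le.1 (h1 (j = z.2) i z.1)
  rw [abs_le]
  constructor <;> linarith

lemma pd_pd_Zr (i j : Fin d) (z : Fin d × Fin d) (p : Pol d) :
    pd i (pd j (Zr z p)) = Zr z (pd i (pd j p)) + cz i z (pd j p) + pd i (cz j z p) := by
  rw [pd_Zr, map_add, pd_Zr]

lemma Zr_LA (A : Matrix (Fin d) (Fin d) ℝ) (z : Fin d × Fin d) (p : Pol d) :
    Zr z (LA A p) = LA A (Zr z p) - LA (dA A z) p := by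
  have h1 : ∀ i j, cz i z (pd j p) = (if i = z.1 then pd z.2 (pd j p) else 0)
      - (if i = z.2 then pd z.1 (pd j p) else 0) := fun i j => by
    rw [cz, LinearMap.sub_apply]; congr 1 <;> split_ifs <;> rfl
  have h2 : ∀ i j, pd i (cz j z p) = (if j = z.1 then pd i (pd z.2 p) else 0)
      - (if j = z.2 then pd i (pd z.1 p) else 0) := fun i j => by
    rw [cz, LinearMap.sub_apply, map_sub]
    congr 1 <;> split_ifs <;> simp
  have e : LA A (Zr z p) = Zr z (LA A p) + ∑ i, ∑ j, A i j • (cz i z (pd j p) + pd i (cz j z p)) := by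
    simp only [LA_apply, map_sum, Derivation.map_smul, ← Finset.sum_add_distrib, ← smul_add]
    refine Finset.sum_congr rfl fun i _ => Finset.sum_congr rfl fun j _ => ?_
    rw [pd_pd_Zr, add_assoc]
  have e2 : LA (dA A z) p = ∑ i, ∑ j, A i j • (cz i z (pd j p) + pd i (cz j z p)) := by
    simp only [LA_apply, dA, h1, h2, smul_add, smul_sub, add_smul, sub_smul,
      Finset.sum_add_distrib, Finset.sum_sub_distrib, ite_smul, zero_smul, smul_ite, smul_zero,
      Finset.sum_ite_eq', Finset.mem_univ, if_true]
    have s1 : ∀ (k : Fin d) (f : Fin d → Fin d → Pol d),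
        ∑ x, ∑ y, (if x = k then f x y else 0) = ∑ y, f k y := fun k f => by
      rw [Finset.sum_comm]; simp
    simp only [s1]
    ring
  rw [e, e2]; ring

end Words

end WeakType

namespace WeakType

section Pointwise

variable {d : ℕ}

lemma hess_entry_le {lam Lam : ℝ} (hlam : 0 < lam) {A : Matrix (Fin d) (Fin d) ℝ}
    (hA : Ell lam Lam A) (x : Fin d → ℝ) (hx : ∑ i, x i ^ 2 ≤ 1) (H : Fin d → Fin d → ℝ)
    (hH : ∀ i j, H i j = H j i) {τ : ℝ} (hτ : 0 ≤ τ)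
    (hR : ∀ i j k, |x i * H j k - x j * H i k| ≤ τ) (j k : Fin d) :
    (∑ i, x i ^ 2) ^ 3 * |H j k| ≤
      (|∑ i, ∑ j, A i j * H i j| + d ^ 2 * (Lam * ((d + d ^ 2) * τ))) / lam + (d + d ^ 2) * τ := by
  set s := ∑ i, x i ^ 2 with hs
  have hs0 : 0 ≤ s := by positivity
  have hxi : ∀ i, |x i| ≤ 1 := fun i => by
    have : x i ^ 2 ≤ s := Finset.single_le_sum (f := fun i => x i ^ 2) (fun i _ => sq_nonneg _)
      (Finset.mem_univ i)
    exact abs_le_of_sq_le_sq (by linarith) zero_le_one |> abs_le.1 |> abs_le.2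
  have hsum : ∀ (f : Fin d → ℝ) (c : ℝ), (∀ i, |f i| ≤ c) → |∑ i, f i| ≤ d * c := fun f c h => by
    refine (Finset.abs_sum_le_sum_abs _ _).trans ((Finset.sum_le_sum fun i _ => h i).trans ?_)
    simp
  have hmul : ∀ i (a c : ℝ), |a| ≤ c → |x i * a| ≤ c := fun i a c h => by
    rw [abs_mul]
    exact (mul_le_of_le_one_left (abs_nonneg a) (hxi i)).trans h
  set m : Fin d → ℝ := fun k => ∑ i, x i * H i k with hm
  set M := ∑ i, x i * m i with hM
  have h1 : ∀ j k, |s * H j k - x j * m k| ≤ d * τ := fun j k => by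
    have : s * H j k - x j * m k = ∑ i, x i * (x i * H j k - x j * H i k) := by
      rw [hs, hm, Finset.sum_mul, Finset.mul_sum, ← Finset.sum_sub_distrib]
      exact Finset.sum_congr rfl fun i _ => by ring
    rw [this]
    exact hsum _ _ fun i => hmul i _ _ (hR i j k)
  have h2 : ∀ k, |s * m k - x k * M| ≤ d * (d * τ) := fun k => by
    have : s * m k - x k * M = ∑ i, x i * (s * H k i - x k * m i) := by
      rw [hM, Finset.mul_sum, hm]
      simp only
      rw [Finset.mul_sum, ← Finset.sum_sub_distrib]
      exact Finset.sum_congr rfl fun i _ => by rw [hH k i]; ring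
    rw [this]
    exact hsum _ _ fun i => hmul i _ _ (h1 k i)
  have h3 : ∀ j k, |s ^ 2 * H j k - x j * x k * M| ≤ (d + d ^ 2) * τ := fun j k => by
    have e : s ^ 2 * H j k - x j * x k * M
        = s * (s * H j k - x j * m k) + x j * (s * m k - x k * M) := by ring
    have e1 : |s * (s * H j k - x j * m k)| ≤ d * τ := by
      rw [abs_mul, abs_of_nonneg hs0]
      exact (mul_le_of_le_one_left (abs_nonneg _) hx).trans (h1 j k)
    have e2 := hmul j _ _ (h2 k)
    rw [e]
    refine (abs_add_le _ _).trans ?_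
    linarith
  set q := ∑ i, ∑ j, A i j * (x i * x j) with hq
  have hq1 : lam * s ≤ q := hA.coer x
  have h4 : |s ^ 2 * (∑ i, ∑ j, A i j * H i j) - M * q| ≤ d ^ 2 * (Lam * ((d + d ^ 2) * τ)) := by
    have e : s ^ 2 * (∑ i, ∑ j, A i j * H i j) - M * q
        = ∑ i, ∑ j, A i j * (s ^ 2 * H i j - x i * x j * M) := by
      rw [hq]
      simp only [Finset.mul_sum, ← Finset.sum_sub_distrib]
      exact Finset.sum_congr rfl fun i _ => Finset.sum_congr rfl fun j _ => by ring
    rw [e, show ∀ t : ℝ, (d : ℝ) ^ 2 * t = d * (d * t) from fun t => by ring]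
    refine hsum _ _ fun i => hsum _ _ fun j => ?_
    rw [abs_mul]
    exact mul_le_mul (hA.bdd i j) (h3 i j) (abs_nonneg _) ((abs_nonneg _).trans (hA.bdd i j))
  set ℓ := ∑ i, ∑ j, A i j * H i j
  have h5 : lam * (s * |M|) ≤ |ℓ| + d ^ 2 * (Lam * ((d + d ^ 2) * τ)) := by
    have e1 : lam * (s * |M|) ≤ |M * q| := by
      rw [abs_mul, abs_of_nonneg (le_trans (by positivity) hq1)]
      nlinarith [mul_le_mul_of_nonneg_left hq1 (abs_nonneg M)]
    have e2 : |s ^ 2 * ℓ| ≤ |ℓ| := by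
      rw [abs_mul, abs_of_nonneg (sq_nonneg s)]
      exact mul_le_of_le_one_left (abs_nonneg _) (pow_le_one₀ hs0 hx)
    have e3 := abs_sub_abs_le_abs_sub (M * q) (s ^ 2 * ℓ)
    rw [abs_sub_comm] at e3
    linarith
  have h6 : s ^ 2 * |H j k| ≤ |M| + (d + d ^ 2) * τ := by
    have e1 := abs_sub_abs_le_abs_sub (s ^ 2 * H j k) (x j * x k * M)
    have e2 : |x j * x k * M| ≤ |M| := by
      rw [mul_assoc]; exact hmul j _ _ (hmul k _ _ le_rfl)
    rw [abs_mul, abs_of_nonneg (sq_nonneg s)] at e1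
    linarith [h3 j k]
  have h7 : s ^ 3 * |H j k| ≤ s * |M| + (d + d ^ 2) * τ := by
    have e1 := mul_le_mul_of_nonneg_left h6 hs0
    have e2 : s * ((d + d ^ 2) * τ) ≤ (d + d ^ 2) * τ :=
      mul_le_of_le_one_left (by positivity) hx
    nlinarith
  have h8 : s * |M| ≤ (|ℓ| + d ^ 2 * (Lam * ((d + d ^ 2) * τ))) / lam := by
    rw [le_div_iff₀ hlam]; linarith
  linarith

lemma cz_apply (k : Fin d) (z : Fin d × Fin d) (W : Pol d) :
    cz k z W = (if k = z.1 then pd z.2 W else 0) - (if k = z.2 then pd z.1 W else 0) := by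
  have h : ∀ (P : Prop) [Decidable P] (j : Fin d),
      (if P then (pd j : Pol d →ₗ[ℝ] Pol d) else 0) W = if P then pd j W else 0 := fun P _ j => by
    by_cases hP : P
    · rw [if_pos hP, if_pos hP]; rfl
    · rw [if_neg hP, if_neg hP]; rfl
  rw [cz, LinearMap.sub_apply, h, h]

lemma ev_cz_le (x : Euc d) (k : Fin d) (z : Fin d × Fin d) (W : Pol d) :
    |ev x (cz k z W)| ≤ |ev x (pd z.2 W)| + |ev x (pd z.1 W)| := by
  have h : ∀ (P : Prop) [Decidable P] (p : Pol d), |ev x (if P then p else 0)| ≤ |ev x p| :=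
    fun P _ p => by
    by_cases hP : P
    · rw [if_pos hP]
    · rw [if_neg hP, map_zero, abs_zero]; exact abs_nonneg _
  rw [cz_apply, map_sub]
  exact (abs_sub _ _).trans (add_le_add (h _ _) (h _ _))

lemma ev_rot_hess (x : Euc d) (W : Pol d) (i j k : Fin d) :
    x i * ev x (pd j (pd k W)) - x j * ev x (pd i (pd k W))
      = ev x (pd k (Zr (i, j) W)) - ev x (cz k (i, j) W) := by
  have h := congrArg (ev x) (pd_Zr k (i, j) W)
  have h2 := congrArg (ev x) (Zr_apply (i, j) (pd k W))
  simp only [map_add, map_sub, map_mul, MvPolynomial.eval_X] at h h2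
  linarith

/-- All second derivatives are controlled by the operator and rotational derivatives. -/
lemma hess_pointwise (d : ℕ) {lam Lam : ℝ} (hlam : 0 < lam) (hLam : 0 < Lam) :
    ∃ C : ℝ, 0 < C ∧ ∀ (A : Matrix (Fin d) (Fin d) ℝ), Ell lam Lam A → ∀ (W : Pol d) (x : Euc d),
      ‖x‖ ≤ 1 → ∀ j k, (‖x‖ ^ 2) ^ 6 * ev x (pd j (pd k W)) ^ 2 ≤
        C * (ev x (LA A W) ^ 2 + ∑ z, ev x (gradSq (Zr z W)) + ev x (gradSq W)) := by
  set a : ℝ := 1 / lam with ha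
  set b : ℝ := d ^ 2 * (Lam * (d + d ^ 2)) / lam + (d + d ^ 2) with hb
  refine ⟨a ^ 2 * 3 + b ^ 2 * 12, by positivity, fun A hA W x hx j k => ?_⟩
  have hsx : ∑ i, x i ^ 2 = ‖x‖ ^ 2 := (EuclideanSpace.real_norm_sq_eq x).symm
  set S1 := √(∑ z, ev x (gradSq (Zr z W))) with hS1
  set S2 := √(ev x (gradSq W)) with hS2
  have hz0 : 0 ≤ ∑ z, ev x (gradSq (Zr z W)) := Finset.sum_nonneg fun z _ => gradSq_nonneg _ _
  have hpd : ∀ i, |ev x (pd i W)| ≤ S2 := fun i => by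
    refine Real.abs_le_sqrt ?_
    rw [ev_gradSq]
    exact Finset.single_le_sum (f := fun i => ev x (pd i W) ^ 2) (fun i _ => sq_nonneg _)
      (Finset.mem_univ i)
  have hpz : ∀ z k, |ev x (pd k (Zr z W))| ≤ S1 := fun z k => by
    refine Real.abs_le_sqrt ?_
    refine le_trans ?_ (Finset.single_le_sum (f := fun z => ev x (gradSq (Zr z W)))
      (fun i _ => gradSq_nonneg _ _) (Finset.mem_univ z))
    rw [ev_gradSq]
    exact Finset.single_le_sum (f := fun i => ev x (pd i (Zr z W)) ^ 2) (fun i _ => sq_nonneg _)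
      (Finset.mem_univ k)
  have hcz : ∀ z k, |ev x (cz k z W)| ≤ 2 * S2 := fun z k => by
    have := ev_cz_le x k z W
    linarith [hpd z.1, hpd z.2]
  have hR : ∀ i j k, |x i * ev x (pd j (pd k W)) - x j * ev x (pd i (pd k W))| ≤ S1 + 2 * S2 :=
    fun i j k => by
    have e : x i * ev x (pd j (pd k W)) - x j * ev x (pd i (pd k W))
        = ev x (pd k (Zr (i, j) W)) - ev x (cz k (i, j) W) := ev_rot_hess x W i j k
    rw [e]
    refine (abs_sub _ _).trans ?_
    linarith [hcz (i, j) k, hpz (i, j) k]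
  have h := hess_entry_le hlam hA (fun i => x i) (by rw [hsx]; exact pow_le_one₀ (norm_nonneg x) hx)
    (fun j k => ev x (pd j (pd k W))) (fun i j => by rw [pd_comm]) (by positivity) hR j k
  rw [hsx] at h
  have hℓ : ∑ i, ∑ j, A i j * ev x (pd i (pd j W)) = ev x (LA A W) := by
    simp [LA_apply]
  rw [hℓ] at h
  have h1 : (‖x‖ ^ 2) ^ 3 * |ev x (pd j (pd k W))| ≤ a * |ev x (LA A W)| + b * (S1 + 2 * S2) := by
    refine h.trans (le_of_eq ?_)
    rw [ha, hb]; field_simp; ring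
  have h2 := pow_le_pow_left₀ (by positivity) h1 2
  have e1 : ((‖x‖ ^ 2) ^ 3 * |ev x (pd j (pd k W))|) ^ 2
      = (‖x‖ ^ 2) ^ 6 * ev x (pd j (pd k W)) ^ 2 := by rw [mul_pow, sq_abs]; ring
  rw [e1] at h2
  refine h2.trans ?_
  rw [← Real.sq_sqrt hz0, ← Real.sq_sqrt (gradSq_nonneg x W), ← hS1, ← hS2, ← sq_abs (ev x (LA A W))]
  set l := |ev x (LA A W)|
  have e3 : (a * l + b * (S1 + 2 * S2)) ^ 2
      ≤ 3 * a ^ 2 * l ^ 2 + 3 * b ^ 2 * S1 ^ 2 + 12 * b ^ 2 * S2 ^ 2 := by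
    nlinarith [sq_nonneg (a * l - b * S1), sq_nonneg (a * l - 2 * b * S2),
      sq_nonneg (b * S1 - 2 * b * S2)]
  have : 0 ≤ a ^ 2 * S1 ^ 2 := by positivity
  have : 0 ≤ a ^ 2 * S2 ^ 2 := by positivity
  have : 0 ≤ b ^ 2 * l ^ 2 := by positivity
  have : 0 ≤ b ^ 2 * S1 ^ 2 := by positivity
  linarith

end Pointwise

end WeakType

namespace WeakType

section GlobalRegularity

variable {d : ℕ}

lemma abs_coord_le {x : Euc d} (hx : x ∈ ball (0 : Euc d) 1) (i : Fin d) : |x i| ≤ 1 :=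
  (PiLp.norm_apply_le x i).trans (mem_ball_zero_iff.1 hx).le

lemma nrm_X_mul_le {D : Set (Euc d)} (hD : CDom D) (hs : D ⊆ ball 0 1) (i : Fin d) (p : Pol d) :
    nrm D (MvPolynomial.X i * p) ≤ nrm D p :=
  nrm_mono hD fun x hx => by
    rw [map_mul, abs_mul, MvPolynomial.eval_X]
    exact mul_le_of_le_one_left (abs_nonneg _) (abs_coord_le (hs hx) i)

lemma nrm_Zr_le {D : Set (Euc d)} (hD : CDom D) (hs : D ⊆ ball 0 1) (z : Fin d × Fin d)
    (p : Pol d) : nrm D (Zr z p) ≤ nrm D (pd z.2 p) + nrm D (pd z.1 p) := by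
  rw [Zr_apply]
  exact (nrm_sub_le hD _ _).trans
    (add_le_add (nrm_X_mul_le hD hs _ _) (nrm_X_mul_le hD hs _ _))

lemma LA_eq_div (A : Matrix (Fin d) (Fin d) ℝ) (p : Pol d) :
    LA A p = ∑ i, pd i (∑ j, A i j • pd j p) := by
  simp only [LA_apply, map_sum, Derivation.map_smul]

lemma nrm_flux_le {D : Set (Euc d)} (hD : CDom D) {A : Matrix (Fin d) (Fin d) ℝ} {c M : ℝ}
    (hc : ∀ i j, |A i j| ≤ c) (g : Fin d → Pol d) (hM : ∀ j, nrm D (g j) ≤ M) (i : Fin d) :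
    nrm D (∑ j, A i j • g j) ≤ d * (c * M) :=
  nrm_sum_le_card hD _ fun j => by
    rw [nrm_smul]
    exact mul_le_mul (hc i j) (hM j) (nrm_nonneg _) ((abs_nonneg _).trans (hc i j))

lemma I_sum_sq_le {D : Set (Euc d)} (hD : CDom D) (F : Fin d → Pol d) {M : ℝ}
    (hM : ∀ i, nrm D (F i) ≤ M) : I D (∑ i, F i ^ 2) ≤ d * M ^ 2 := by
  rw [I_sum hD]
  refine (Finset.sum_le_sum (g := fun _ => M ^ 2) fun i _ => ?_).trans (by simp)
  rw [← nrm_sq hD]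
  exact pow_le_pow_left₀ (nrm_nonneg _) (hM i) 2

lemma Zr_eq_div (z : Fin d × Fin d) (p : Pol d) : Zr z p =
    ∑ i, pd i ((if i = z.2 then MvPolynomial.X z.1 * p else 0)
      - (if i = z.1 then MvPolynomial.X z.2 * p else 0)) := by
  have h : ∀ (k : Fin d) (q : Pol d), ∑ i, pd i (if i = k then q else 0) = pd k q := fun k q => by
    rw [Finset.sum_eq_single k]
    · simp
    · intro b _ hb; simp [hb]
    · simp
  simp only [map_sub, Finset.sum_sub_distrib, h, Derivation.leibniz, smul_eq_mul,
    MvPolynomial.pderiv_X, Pi.single_apply, Zr_apply]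
  by_cases hz : z.1 = z.2
  · simp [hz]
  · simp [hz, Ne.symm hz]

lemma grad_nrm_le (hd : 1 ≤ d) {lam Lam : ℝ} (hlam : 0 < lam) {A : Matrix (Fin d) (Fin d) ℝ}
    (hA : Ell lam Lam A) (q : Pol d) (k : Fin d) :
    nrm (ball (0 : Euc d) 1) (pd k (om * q)) ≤ 2 / lam * nrm (ball 0 1) (LA A (om * q)) := by
  have hB := CDom.ball (0 : Euc d) 1
  refine (nrm_pd_le hB k _).trans ((Real.sqrt_le_sqrt (energy_le hd hlam hA _ fun x hx =>
    ev_om_mul_sphere q hx)).trans (le_of_eq ?_))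
  rw [Real.sqrt_mul (by positivity), nrm]
  congr 1
  rw [show 4 / lam ^ 2 = (2 / lam) ^ 2 by ring, Real.sqrt_sq (by positivity)]

lemma grad_rot_le (hd : 1 ≤ d) {lam Lam : ℝ} (hlam : 0 < lam) (hLam : 0 < Lam) :
    ∃ C : ℝ, 0 < C ∧ ∀ (A : Matrix (Fin d) (Fin d) ℝ), Ell lam Lam A → ∀ (q : Pol d) z,
      I (ball (0 : Euc d) 1) (gradSq (Zr z (om * q)))
        ≤ C * nrm (ball 0 1) (LA A (om * q)) ^ 2 := by
  obtain ⟨C, hC, hc⟩ := cacc d (Lam := Lam) hlam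
  set c1 := 2 / lam with hc1
  refine ⟨C * (d * (2 + d * (4 * Lam * c1)) ^ 2 + (2 * c1) ^ 2), by positivity,
    fun A hA q z => ?_⟩
  have hB := CDom.ball (0 : Euc d) 1
  set v := om * q with hv
  set p := LA A v with hp
  set F : Fin d → Pol d := fun i => ((if i = z.2 then MvPolynomial.X z.1 * p else 0)
      - (if i = z.1 then MvPolynomial.X z.2 * p else 0)) + ∑ j, dA A z i j • pd j v with hF
  have hgr : ∀ k, nrm (ball (0 : Euc d) 1) (pd k v) ≤ c1 * nrm (ball 0 1) p :=
    grad_nrm_le hd hlam hA q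
  have hL : LA A (Zr z v) = 0 + ∑ i, pd i (F i) := by
    have e1 := Zr_LA A z v
    have e2 : LA A (Zr z v) = Zr z p + LA (dA A z) v := by rw [hp, e1]; ring
    rw [e2, Zr_eq_div, LA_eq_div, ← Finset.sum_add_distrib, zero_add]
    exact Finset.sum_congr rfl fun i _ => by rw [hF]; simp only [map_add]
  have h1 := hc A hA (ball 0 1) hB (Zr z v) 1 0 F (fun x hx => by
    rw [hv, Zr_om_mul, one_mul]
    exact ev_om_mul_sphere _ (frontier_ball_zero hx)) hL
  have e1 : gradSq (1 : Pol d) = 0 := by simp [gradSq]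
  have e2 : Zr z v ^ 2 * gradSq (1 : Pol d) + 1 ^ 2 * ∑ i, F i ^ 2 + 1 ^ 2 * Zr z v ^ 2 + 1 ^ 2 * 0 ^ 2
      = ∑ i, F i ^ 2 + Zr z v ^ 2 := by rw [e1]; ring
  rw [e2, I_add hB, one_pow, one_mul, ← nrm_sq hB] at h1
  set N := nrm (ball (0 : Euc d) 1) p with hN
  have hN0 : 0 ≤ N := nrm_nonneg _
  have hite : ∀ (P : Prop) [Decidable P] (i : Fin d),
      nrm (ball (0 : Euc d) 1) (if P then MvPolynomial.X i * p else 0) ≤ N := fun P _ i => by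
    by_cases hP : P
    · rw [if_pos hP]; exact nrm_X_mul_le hB subset_rfl _ _
    · rw [if_neg hP, nrm_zero]; exact hN0
  have hFn : ∀ i, nrm (ball (0 : Euc d) 1) (F i) ≤ (2 + d * (4 * Lam * c1)) * N := fun i => by
    have h2 := nrm_flux_le hB (abs_dA_le hLam.le hA.bdd z) (fun j => pd j v) hgr i
    have h3 := nrm_add_le hB ((if i = z.2 then MvPolynomial.X z.1 * p else 0)
      - (if i = z.1 then MvPolynomial.X z.2 * p else 0)) (∑ j, dA A z i j • pd j v)
    have h4 := nrm_sub_le hB (if i = z.2 then MvPolynomial.X z.1 * p else 0)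
      (if i = z.1 then MvPolynomial.X z.2 * p else 0)
    have := hite (i = z.2) z.1
    have := hite (i = z.1) z.2
    calc nrm (ball (0 : Euc d) 1) (F i) ≤ N + N + d * (4 * Lam * (c1 * N)) := by
          refine h3.trans ?_; linarith
      _ = _ := by ring
  have hZ : nrm (ball (0 : Euc d) 1) (Zr z v) ≤ 2 * c1 * N := by
    have := nrm_Zr_le hB subset_rfl z v
    linarith [hgr z.1, hgr z.2]
  have h5 := I_sum_sq_le hB F hFn
  have h6 := pow_le_pow_left₀ (nrm_nonneg _) hZ 2
  refine h1.trans ?_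
  rw [mul_assoc]
  refine mul_le_mul_of_nonneg_left ?_ hC.le
  calc _ ≤ _ := add_le_add h5 h6
    _ = _ := by ring

lemma grad_weighted_le (hd : 1 ≤ d) {lam : ℝ} (Lam : ℝ) (hlam : 0 < lam) :
    ∃ C : ℝ, 0 < C ∧ ∀ (A : Matrix (Fin d) (Fin d) ℝ), Ell lam Lam A → ∀ (q : Pol d) k,
      I (ball (0 : Euc d) 1) (om ^ 2 * gradSq (pd k (om * q)))
        ≤ C * nrm (ball 0 1) (LA A (om * q)) ^ 2 := by
  obtain ⟨C, hC, hc⟩ := cacc d (Lam := Lam) hlam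
  set c1 := 2 / lam with hc1
  refine ⟨C * (5 * c1 ^ 2 + 1), by positivity, fun A hA q k => ?_⟩
  have hB := CDom.ball (0 : Euc d) 1
  set v := om * q with hv
  set p := LA A v with hp
  have hgr : nrm (ball (0 : Euc d) 1) (pd k v) ≤ c1 * nrm (ball 0 1) p :=
    grad_nrm_le hd hlam hA q k
  set F : Fin d → Pol d := fun i => if i = k then p else 0 with hF
  have hL : LA A (pd k v) = 0 + ∑ i, pd i (F i) := by
    rw [LA_pd, zero_add, hF, Finset.sum_eq_single k]
    · simp [hp]
    · intro b _ hb; simp [hb]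
    · simp
  have h1 := hc A hA (ball 0 1) hB (pd k v) om 0 F (fun x hx =>
    ev_om_mul_sphere _ (frontier_ball_zero hx)) hL
  have eF : ∑ i, F i ^ 2 = p ^ 2 := by
    rw [hF, Finset.sum_eq_single k]
    · simp
    · intro b _ hb; simp [hb]
    · simp
  have h2 : I (ball (0 : Euc d) 1) (pd k v ^ 2 * gradSq om + om ^ 2 * ∑ i, F i ^ 2
        + om ^ 2 * pd k v ^ 2 + om ^ 2 * 0 ^ 2)
      ≤ I (ball (0 : Euc d) 1) ((5 : ℝ) • pd k v ^ 2 + p ^ 2) := by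
    refine I_mono hB fun x hx => ?_
    have hx1 : ‖x‖ ^ 2 ≤ 1 := pow_le_one₀ (norm_nonneg x) (mem_ball_zero_iff.1 hx).le
    have e0 : ev x (gradSq (om : Pol d)) = 4 * ‖x‖ ^ 2 := by
      have : ∀ i, pd i (om : Pol d) = -(2 * MvPolynomial.X i) := fun i => by
        simp [om, Derivation.leibniz_pow, MvPolynomial.pderiv_X, Pi.single_apply]
      rw [ev_gradSq, EuclideanSpace.real_norm_sq_eq, Finset.mul_sum]
      refine Finset.sum_congr rfl fun i _ => ?_
      rw [this]; simp; ring
    rw [eF]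
    simp only [map_add, map_mul, map_pow, ev_smul, e0, ev_om, map_zero]
    have hx0 : 0 ≤ ‖x‖ ^ 2 := by positivity
    have h3 : (1 - ‖x‖ ^ 2) ^ 2 ≤ 1 := by nlinarith
    have h4 := mul_le_mul_of_nonneg_right h3 (sq_nonneg (ev x p))
    have h5 := mul_le_mul_of_nonneg_right h3 (sq_nonneg (ev x (pd k v)))
    have h6 := mul_le_mul_of_nonneg_left hx1 (sq_nonneg (ev x (pd k v)))
    linarith
  rw [I_add hB _ (p ^ 2), I_smul, ← nrm_sq hB, ← nrm_sq hB] at h2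
  have h3 := pow_le_pow_left₀ (nrm_nonneg _) hgr 2
  refine h1.trans ?_
  rw [mul_assoc]
  refine mul_le_mul_of_nonneg_left (h2.trans ?_) hC.le
  set N := nrm (ball (0 : Euc d) 1) p
  calc _ ≤ 5 * (c1 * N) ^ 2 + N ^ 2 := by linarith
    _ = _ := by ring

/-- Global `H²` regularity. -/
lemma global_H2 (hd : 1 ≤ d) {lam Lam : ℝ} (hlam : 0 < lam) (hLam : 0 < Lam) :
    ∃ C : ℝ, 0 < C ∧ ∀ (A : Matrix (Fin d) (Fin d) ℝ), Ell lam Lam A → ∀ (q : Pol d) j k,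
      nrm (ball (0 : Euc d) 1) (pd j (pd k (om * q))) ≤ C * nrm (ball 0 1) (LA A (om * q)) := by
  obtain ⟨C1, hC1, h1⟩ := grad_rot_le hd hlam hLam
  obtain ⟨C2, hC2, h2⟩ := grad_weighted_le hd Lam hlam
  obtain ⟨C3, hC3, h3⟩ := hess_pointwise d hlam hLam
  set K := 4 * C2 + 64 * C3 * (1 + (d * d : ℕ) * C1 + 4 / lam ^ 2) with hK
  refine ⟨√K, by positivity, fun A hA q j k => ?_⟩
  have hB := CDom.ball (0 : Euc d) 1
  have hvs := fun x hx => ev_om_mul_sphere q (x := x) hx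
  have h4 := energy_le hd hlam hA _ hvs
  set v := om * q with hv
  set p := LA A v with hp
  refine nrm_le (by positivity [nrm_nonneg (D := ball (0 : Euc d) 1) p]) ?_
  rw [mul_pow, Real.sq_sqrt (by positivity)]
  have h5 : I (ball (0 : Euc d) 1) (pd j (pd k v) ^ 2) ≤
      I (ball (0 : Euc d) 1) ((4 : ℝ) • (om ^ 2 * gradSq (pd k v))
        + (64 * C3) • (p ^ 2 + ∑ z, gradSq (Zr z v) + gradSq v)) := by
    refine I_mono hB fun x hx => ?_
    have hx1 : ‖x‖ ≤ 1 := (mem_ball_zero_iff.1 hx).le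
    have h6 := h3 A hA v x hx1 j k
    have h7 : ev x (pd j (pd k v)) ^ 2 ≤ ev x (gradSq (pd k v)) := by
      rw [ev_gradSq]
      exact Finset.single_le_sum (f := fun i => ev x (pd i (pd k v)) ^ 2) (fun i _ => sq_nonneg _)
        (Finset.mem_univ j)
    simp only [map_add, map_mul, map_pow, map_sum, ev_smul, ev_om]
    set s := ‖x‖ ^ 2 with hs
    set G := ev x (gradSq (pd k v))
    set h := ev x (pd j (pd k v))
    set Y := ev x p ^ 2 + ∑ z, ev x (gradSq (Zr z v)) + ev x (gradSq v)
    have hs0 : 0 ≤ s := by positivity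
    have hG : 0 ≤ G := gradSq_nonneg _ _
    have hY : 0 ≤ C3 * Y := le_trans (by positivity) h6
    rcases le_total s (1 / 2) with hsl | hsl
    · have : 1 / 4 ≤ (1 - s) ^ 2 := by nlinarith
      have := mul_le_mul_of_nonneg_right this hG
      linarith
    · have : (1 / 2 : ℝ) ^ 6 ≤ s ^ 6 := pow_le_pow_left₀ (by norm_num) hsl 6
      have := mul_le_mul_of_nonneg_right this (sq_nonneg h)
      have : 0 ≤ (1 - s) ^ 2 * G := by positivity
      norm_num at *
      linarith
  rw [I_add hB, I_smul, I_smul, I_add hB, I_add hB, I_sum hB] at h5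
  refine h5.trans ?_
  have h6 : ∑ z, I (ball (0 : Euc d) 1) (gradSq (Zr z v))
      ≤ (d * d : ℕ) * (C1 * nrm (ball (0 : Euc d) 1) p ^ 2) := by
    refine (Finset.sum_le_sum fun z _ => h1 A hA q z).trans ?_
    simp [hp, hv]
  have h7 := h2 A hA q k
  rw [← nrm_sq hB] at h4 ⊢
  set N := nrm (ball (0 : Euc d) 1) p ^ 2
  have h8 : N + ∑ z, I (ball (0 : Euc d) 1) (gradSq (Zr z v)) + I (ball (0 : Euc d) 1) (gradSq v)
    ≤ (1 + (d * d : ℕ) * C1 + 4 / lam ^ 2) * N := by linarith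
  have h9 := mul_le_mul_of_nonneg_left h8 (show 0 ≤ 64 * C3 by positivity)
  rw [hK]
  linarith

end GlobalRegularity

end WeakType

namespace WeakType

section Commutators

variable {d : ℕ}

lemma seminorm_Dw_cz_le (N : Pol d → ℝ) (h0 : N 0 = 0) (hsub : ∀ p q, N (p - q) ≤ N p + N q)
    (hN : ∀ p, 0 ≤ N p) (β : List (Fin d)) (k : Fin d) (z : Fin d × Fin d) (W : Pol d) {M : ℝ}
    (hM : ∀ a, N (Dw β (pd a W)) ≤ M) : N (Dw β (cz k z W)) ≤ 2 * M := by
  have h : ∀ (P : Prop) [Decidable P] (a : Fin d), N (Dw β (if P then pd a W else 0)) ≤ M :=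
    fun P _ a => by
    by_cases hP : P
    · rw [if_pos hP]; exact hM a
    · rw [if_neg hP, map_zero, h0]; exact (hN _).trans (hM a)
  rw [cz_apply, map_sub]
  refine (hsub _ _).trans ?_
  have h1 := h (k = z.1) z.2
  have h2 := h (k = z.2) z.1
  linarith

lemma nrm_Dw_Zr_Dw_le {D : Set (Euc d)} (hD : CDom D) (z : Fin d × Fin d) (q : Pol d) {M M' : ℝ}
    (γ β : List (Fin d))
    (hM' : ∀ δ : List (Fin d), δ.length = β.length + γ.length → nrm D (Dw δ (Zr z q)) ≤ M')
    (hM : ∀ δ : List (Fin d), δ.length = β.length + γ.length → nrm D (Dw δ q) ≤ M) :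
    nrm D (Dw β (Zr z (Dw γ q))) ≤ M' + 2 * γ.length * M := by
  induction γ generalizing β with
  | nil => simpa using hM' β (by simp)
  | cons a γ ih =>
    have e : Dw β (Zr z (Dw (a :: γ) q)) = Dw (a :: β) (Zr z (Dw γ q)) - Dw β (cz a z (Dw γ q)) := by
      rw [Dw_cons, Dw_cons, ← pd_Dw, pd_Zr, map_add, add_sub_cancel_right]
    have hl : (a :: β).length + γ.length = β.length + (a :: γ).length := by
      simp only [List.length_cons]; omega
    have h1 := ih (a :: β) (fun δ hδ => hM' δ (hδ.trans hl)) (fun δ hδ => hM δ (hδ.trans hl))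
    have h2 := seminorm_Dw_cz_le (nrm D) nrm_zero (nrm_sub_le hD) nrm_nonneg β a z (Dw γ q)
      (M := M) fun b => by
        rw [← Dw_cons, ← Dw_append]
        exact hM _ (by simp only [List.length_append, List.length_cons]; omega)
    rw [e]
    refine (nrm_sub_le hD _ _).trans ((add_le_add h1 h2).trans (le_of_eq ?_))
    push_cast [List.length_cons]
    ring

lemma ev_Dw_Zr_le {x : Euc d} (hx : x ∈ ball (0 : Euc d) 1) (z : Fin d × Fin d) {ε : ℝ}
    (β : List (Fin d)) (p : Pol d)
    (h : ∀ δ : List (Fin d), δ.length ≤ β.length + 1 → |ev x (Dw δ p)| ≤ ε) :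
    |ev x (Dw β (Zr z p))| ≤ (2 + 2 * β.length) * ε := by
  induction β generalizing p with
  | nil =>
    have h1 : ∀ a i, |ev x (MvPolynomial.X a * pd i p)| ≤ ε := fun a i => by
      rw [map_mul, abs_mul, MvPolynomial.eval_X]
      exact (mul_le_of_le_one_left (abs_nonneg _) (abs_coord_le hx a)).trans (h [i] (by simp))
    rw [Dw_nil, Zr_apply, map_sub]
    refine (abs_sub _ _).trans ?_
    have := h1 z.1 z.2
    have := h1 z.2 z.1
    simp only [List.length_nil, Nat.cast_zero]
    linarith
  | cons a β ih =>
    rw [Dw_cons, pd_Zr, map_add, map_add]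
    have h1 := ih (pd a p) fun δ hδ => by
      rw [← Dw_cons]; exact h _ (by simp only [List.length_cons]; omega)
    have h2 := seminorm_Dw_cz_le (fun q => |ev x q|) (by simp)
      (fun p q => by rw [map_sub]; exact abs_sub _ _) (fun _ => abs_nonneg _) β a z p
      (M := ε) fun b => by
        rw [← Dw_cons]
        exact h _ (by simp only [List.length_cons]; omega)
    refine (abs_add_le _ _).trans ((add_le_add h1 h2).trans (le_of_eq ?_))
    push_cast [List.length_cons]
    ring

lemma ev_Dw_Zw_le {x : Euc d} (hx : x ∈ ball (0 : Euc d) 1) {ε : ℝ} (K : ℕ)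
    (J : List (Fin d × Fin d)) (p : Pol d) (m : ℕ) (hm : m + J.length ≤ K)
    (h : ∀ δ : List (Fin d), δ.length ≤ m + J.length → |ev x (Dw δ p)| ≤ ε) :
    ∀ γ : List (Fin d), γ.length ≤ m →
      |ev x (Dw γ (Zw J p))| ≤ (2 + 2 * K) ^ J.length * ε := by
  have hε : 0 ≤ ε := (abs_nonneg _).trans (h [] (by simp))
  induction J generalizing p ε with
  | nil => intro γ hγ; simpa using h γ (by simpa using hγ)
  | cons z J ih =>
    intro γ hγ
    simp only [List.length_cons] at hm h
    have := ih (p := Zr z p) (ε := (2 + 2 * K) * ε) (by omega) (fun δ hδ => by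
      refine (ev_Dw_Zr_le hx z δ p (ε := ε) fun δ' hδ' => h δ' (by omega)).trans ?_
      have : (δ.length : ℝ) ≤ K := by exact_mod_cast (by omega : δ.length ≤ K)
      gcongr) (by positivity) γ hγ
    rw [Zw_cons, List.length_cons, pow_succ, mul_assoc]
    exact this

/-- Commuting a word of rotations through a constant coefficient operator produces a divergence
whose flux involves strictly fewer rotations. -/
lemma LA_Zw (d m : ℕ) : ∀ c : ℝ, 0 ≤ c → ∃ C : ℝ, 0 ≤ C ∧ ∀ A : Matrix (Fin d) (Fin d) ℝ,
    (∀ i j, |A i j| ≤ c) → ∀ J : List (Fin d × Fin d), J.length = m → ∀ v : Pol d,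
    ∃ F : Fin d → Pol d, LA A (Zw J v) = Zw J (LA A v) + ∑ i, pd i (F i) ∧
      ∀ D : Set (Euc d), CDom D → ∀ (β : List (Fin d)) (M : ℝ), 0 ≤ M →
        (∀ J' : List (Fin d × Fin d), J'.length < m → ∀ j, nrm D (Dw β (pd j (Zw J' v))) ≤ M) →
        ∀ i, nrm D (Dw β (F i)) ≤ C * M := by
  induction m with
  | zero =>
    refine fun c _ => ⟨0, le_rfl, fun A _ J hJ v => ⟨0, ?_, fun D _ β M _ _ i => ?_⟩⟩
    · rw [List.length_eq_zero_iff.1 hJ]; simp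
    · simp [nrm_zero]
  | succ m ih =>
    intro c hc
    obtain ⟨C1, hC1, h1⟩ := ih c hc
    obtain ⟨C2, hC2, h2⟩ := ih (4 * c) (by positivity)
    refine ⟨C1 + d * (4 * c) + C2, by positivity, fun A hA J hJ v => ?_⟩
    obtain _ | ⟨z, J⟩ := J
    · simp at hJ
    rw [List.length_cons, Nat.add_right_cancel_iff] at hJ
    obtain ⟨F1, e1, b1⟩ := h1 A hA J hJ (Zr z v)
    obtain ⟨F2, e2, b2⟩ := h2 (dA A z) (abs_dA_le hc hA z) J hJ v
    refine ⟨fun i => F1 i + (∑ j, dA A z i j • pd j (Zw J v)) - F2 i, ?_, ?_⟩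
    · simp only [map_sub, map_add (pd _), Finset.sum_sub_distrib, Finset.sum_add_distrib,
        ← LA_eq_div]
      rw [Zw_cons, Zw_cons, e1, e2, Zr_LA, map_sub]
      ring
    · intro D hD β M hM hb i
      have k1 := b1 D hD β M hM (fun J' hJ' j => hb (z :: J') (by simp; omega) j) i
      have k2 := b2 D hD β M hM (fun J' hJ' j => hb J' (by omega) j) i
      have k3 := nrm_flux_le hD (abs_dA_le hc hA z) (fun j => Dw β (pd j (Zw J v)))
        (fun j => hb J (by omega) j) i
      simp only [map_sub, map_add, map_sum, map_smul]
      refine (nrm_sub_le hD _ _).trans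
        ((add_le_add ((nrm_add_le hD _ _).trans (add_le_add k1 k3)) k2).trans (le_of_eq ?_))
      ring

end Commutators

end WeakType

namespace WeakType

section BoundaryRegularity

variable {d : ℕ}

/-- Energy bound when the right-hand side is almost supported in a boundary cap. -/
lemma energy_cap (hd : 1 ≤ d) {lam Lam : ℝ} (hlam : 0 < lam) {A : Matrix (Fin d) (Fin d) ℝ}
    (hA : Ell lam Lam A) {v : Pol d} (hv : ∀ x ∈ sphere (0 : Euc d) 1, ev x v = 0)
    {y : Euc d} {ρ Φ ε : ℝ} (hρ : 0 < ρ) (hy : y ≠ 0) (hy1 : 1 - ‖y‖ ≤ ρ)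
    (hΦ : I (ball (0 : Euc d) 1) (LA A v ^ 2) ≤ Φ ^ 2)
    (hε : I (ball (0 : Euc d) 1 \ cut y (16 * ρ)) (LA A v ^ 2) ≤ ε ^ 2) :
    I (ball (0 : Euc d) 1) (gradSq v) ≤ 2312 / lam ^ 2 * (ρ ^ 2 * Φ ^ 2 + ε ^ 2) := by
  have hB := CDom.ball (0 : Euc d) 1
  have hS := CDom.cut y (16 * ρ)
  have h1 := energy hA hB v fun x hx => hv x (frontier_ball_zero hx)
  have h2 := poincare_ball hd v hv
  have h3 := poincare_cap v hv hρ hy hy1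
  set p := LA A v
  set S := cut y (16 * ρ)
  set G := I (ball (0 : Euc d) 1) (gradSq v)
  have hsub : S ⊆ ball 0 1 := inter_subset_left
  have split : ∀ P : Pol d, I (ball 0 1) P = I S P + I (ball 0 1 \ S) P := fun P => by
    rw [I, I, I, ← integral_inter_add_sdiff (s := ball (0 : Euc d) 1) hS.measurableSet
      (hB.integrableOn (continuous_ev P)), inter_eq_right.2 hsub]
  have young : ∀ t : ℝ, 0 < t → ∀ a b : ℝ, -(a * b) ≤ t * a ^ 2 + 1 / (4 * t) * b ^ 2 :=
    fun t ht a b => by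
    have : 0 ≤ (2 * t * a + b) ^ 2 / (4 * t) := by positivity
    have e : (2 * t * a + b) ^ 2 / (4 * t) = t * a ^ 2 + 1 / (4 * t) * b ^ 2 + a * b := by
      field_simp; ring
    linarith
  have hyoung : ∀ t : ℝ, 0 < t → ∀ x, ev x (-(v * p)) ≤ ev x (t • v ^ 2 + (1 / (4 * t)) • p ^ 2) :=
    fun t ht x => by
    simp only [map_neg, map_mul, map_add, ev_smul, map_pow]
    exact young t ht _ _
  have hTint : ∀ P : Pol d, IntegrableOn (fun x => ev x P) (ball 0 1 \ S) := fun P =>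
    (hB.integrableOn (continuous_ev P)).mono_set sdiff_subset
  have hR : ∀ t : ℝ, 0 < t → I (ball 0 1 \ S) (-(v * p))
      ≤ t * I (ball 0 1 \ S) (v ^ 2) + 1 / (4 * t) * I (ball 0 1 \ S) (p ^ 2) := fun t ht => by
    rw [← I_smul, ← I_smul]
    have e : I (ball 0 1 \ S) (t • v ^ 2) + I (ball 0 1 \ S) ((1 / (4 * t)) • p ^ 2)
        = I (ball 0 1 \ S) (t • v ^ 2 + (1 / (4 * t)) • p ^ 2) := by
      simp only [I, map_add]
      rw [integral_add (hTint _) (hTint _)]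
    rw [e]
    exact setIntegral_mono (hTint _) (hTint _) (hyoung t ht)
  have hRv : I (ball 0 1 \ S) (v ^ 2) ≤ I (ball 0 1) (v ^ 2) :=
    I_mono_set hB sdiff_subset fun x _ => by rw [map_pow]; positivity
  have hSp : I S (p ^ 2) ≤ Φ ^ 2 :=
    (I_mono_set hB hsub fun x _ => by rw [map_pow]; positivity).trans hΦ
  have k1 : I S (-(v * p)) ≤ lam / (4624 * ρ ^ 2) * I S (v ^ 2) + 1156 * ρ ^ 2 / lam * I S (p ^ 2) := by
    refine (I_mono hS fun x _ => hyoung (lam / (4624 * ρ ^ 2)) (by positivity) x).trans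
      (le_of_eq ?_)
    rw [I_add hS, I_smul, I_smul]
    congr 2
    field_simp; norm_num
  have k2 := hR (lam / 16) (by positivity)
  rw [show 1 / (4 * (lam / 16)) = 4 / lam by field_simp; norm_num] at k2
  rw [← I_neg, split] at h1
  have m1 : lam / (4624 * ρ ^ 2) * I S (v ^ 2) ≤ lam / 4 * G := by
    refine (mul_le_mul_of_nonneg_left h3 (by positivity)).trans (le_of_eq ?_)
    field_simp; norm_num
  have m2 : 1156 * ρ ^ 2 / lam * I S (p ^ 2) ≤ 1156 * ρ ^ 2 / lam * Φ ^ 2 :=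
    mul_le_mul_of_nonneg_left hSp (by positivity)
  have m3 : lam / 16 * I (ball 0 1 \ S) (v ^ 2) ≤ lam / 4 * G := by
    refine (mul_le_mul_of_nonneg_left (hRv.trans h2) (by positivity)).trans (le_of_eq ?_)
    ring
  have m4 : 4 / lam * I (ball 0 1 \ S) (p ^ 2) ≤ 4 / lam * ε ^ 2 :=
    mul_le_mul_of_nonneg_left hε (by positivity)
  have m5 : 4 / lam * ε ^ 2 ≤ 1156 / lam * ε ^ 2 := by gcongr; norm_num
  have m6 : lam / 2 * G ≤ 1156 / lam * (ρ ^ 2 * Φ ^ 2 + ε ^ 2) := by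
    have : 1156 * ρ ^ 2 / lam * Φ ^ 2 = 1156 / lam * (ρ ^ 2 * Φ ^ 2) := by ring
    linarith
  calc G = 2 / lam * (lam / 2 * G) := by field_simp
    _ ≤ 2 / lam * (1156 / lam * (ρ ^ 2 * Φ ^ 2 + ε ^ 2)) :=
        mul_le_mul_of_nonneg_left m6 (by positivity)
    _ = _ := by ring

/-- Iterated Caccioppoli inequality for rotational derivatives up to the boundary. -/
lemma grad_Zw_le (d : ℕ) {lam Lam : ℝ} (hlam : 0 < lam) (hLam : 0 < Lam) (m : ℕ) :
    ∃ C : ℝ, 1 ≤ C ∧ ∀ A : Matrix (Fin d) (Fin d) ℝ, Ell lam Lam A → ∀ (y : Euc d) (r : ℝ),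
      0 < r → r ≤ 1 → ∀ (q : Pol d) (N : ℝ), (∀ i, nrm (cut y r) (pd i (om * q)) ≤ N) →
      (∀ J : List (Fin d × Fin d), J.length ≤ m → nrm (cut y r) (Zw J (LA A (om * q))) ≤ N) →
      ∀ J : List (Fin d × Fin d), J.length ≤ m → ∀ i,
        nrm (cut y (r / 2 ^ m)) (pd i (Zw J (om * q))) ≤ C * (r⁻¹ ^ m * N) := by
  induction m with
  | zero =>
    refine ⟨1, le_rfl, fun A hA y r hr hr1 q N hN _ J hJ i => ?_⟩
    rw [List.length_eq_zero_iff.1 (Nat.le_zero.1 hJ)]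
    simpa using hN i
  | succ m ih =>
    obtain ⟨C, hC, h⟩ := ih
    obtain ⟨C1, hC1, h1⟩ := cacc_local d (Lam := Lam) hlam
    obtain ⟨C2, hC2, h2⟩ := LA_Zw d (m + 1) Lam hLam.le
    set K := C1 * ((4 ^ m * 4 + d * C2 ^ 2 + 1) * C ^ 2) with hK
    have hK0 : 0 ≤ K := by positivity
    refine ⟨C + √K, by linarith [Real.sqrt_nonneg K], fun A hA y r hr hr1 q N hN hp J hJ i => ?_⟩
    have hri : 1 ≤ r⁻¹ := (one_le_inv₀ hr).2 hr1
    have hN0 : 0 ≤ N := (nrm_nonneg _).trans (hN i)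
    have h0 := h A hA y r hr hr1 q N hN (fun J hJ => hp J (by omega))
    set s := r / 2 ^ m with hs
    have hs0 : 0 < s := by positivity
    have hsr : s ≤ r := div_le_self hr.le (one_le_pow₀ (by norm_num))
    have hs2 : r / 2 ^ (m + 1) = s / 2 := by rw [hs, pow_succ]; field_simp
    rw [hs2]
    have hcs := CDom.cut y s
    set v := om * q with hv
    set R := r⁻¹ ^ m * N with hR
    have hR0 : 0 ≤ R := by positivity
    have hRR : R ≤ r⁻¹ ^ (m + 1) * N := by
      exact mul_le_mul_of_nonneg_right (pow_le_pow_right₀ hri (by omega)) hN0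
    rcases Nat.lt_or_ge J.length (m + 1) with hJm | hJm
    · refine (nrm_mono_set hcs (cut_mono y (by linarith)) _).trans ((h0 J (by omega) i).trans ?_)
      gcongr
      linarith [Real.sqrt_nonneg K]
    obtain ⟨F, eF, bF⟩ := h2 A hA.bdd J (le_antisymm hJ hJm) v
    have bF' := bF (cut y s) hcs [] (C * R) (by positivity) fun J' hJ' j => h0 J' (by omega) j
    have hW : nrm (cut y s) (Zw J v) ≤ 2 * (C * R) := by
      obtain ⟨J0, z, rfl⟩ := (List.eq_nil_or_concat J).resolve_left (by rintro rfl; simp at hJm)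
      rw [List.concat_eq_append, Zw_concat]
      simp only [List.concat_eq_append, List.length_append, List.length_singleton] at hJ
      refine (nrm_Zr_le hcs inter_subset_left z _).trans ?_
      have := h0 J0 (by omega) z.1
      have := h0 J0 (by omega) z.2
      linarith
    have hh : nrm (cut y s) (Zw J (LA A v)) ≤ C * R := by
      refine (nrm_mono_set (CDom.cut y r) (cut_mono y hsr) _).trans ((hp J hJ).trans ?_)
      rw [hR]
      nth_rw 1 [← one_mul N, ← one_mul N]
      gcongr
      exact one_le_pow₀ hri
    have key := h1 A hA y s hs0 (hsr.trans hr1) (Zw J v) (Zw J (LA A v)) F (fun x hx _ => by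
      rw [hv, Zw_om_mul]; exact ev_om_mul_sphere _ hx) eF
    have hF := I_sum_sq_le hcs F bF'
    rw [← nrm_sq hcs, ← nrm_sq hcs] at key
    have t1 := pow_le_pow_left₀ (nrm_nonneg _) hW 2
    have t2 := pow_le_pow_left₀ (nrm_nonneg _) hh 2
    have hsi : s⁻¹ ^ 2 = 4 ^ m * r⁻¹ ^ 2 := by
      rw [hs, inv_div, div_eq_mul_inv, mul_pow, ← pow_mul, mul_comm m 2, pow_mul]; norm_num
    have hri2 : 1 ≤ r⁻¹ ^ 2 := one_le_pow₀ hri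
    refine (nrm_pd_le (CDom.cut y (s / 2)) i _).trans ((Real.sqrt_le_sqrt (y := K * (r⁻¹ * R) ^ 2)
      ?_).trans ?_)
    · refine key.trans ?_
      rw [hK, mul_assoc C1]
      refine mul_le_mul_of_nonneg_left ?_ hC1.le
      calc _ ≤ 4 ^ m * r⁻¹ ^ 2 * (2 * (C * R)) ^ 2 + d * (C2 * (C * R)) ^ 2 + (C * R) ^ 2 := by
            rw [hsi]
            have := mul_le_mul_of_nonneg_left t1 (show 0 ≤ 4 ^ m * r⁻¹ ^ 2 by positivity)
            linarith
        _ ≤ 4 ^ m * r⁻¹ ^ 2 * (2 * (C * R)) ^ 2 + r⁻¹ ^ 2 * (d * (C2 * (C * R)) ^ 2)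
            + r⁻¹ ^ 2 * (C * R) ^ 2 := by
            exact add_le_add (add_le_add le_rfl (le_mul_of_one_le_left (by positivity) hri2))
              (le_mul_of_one_le_left (by positivity) hri2)
        _ = _ := by ring
    · rw [Real.sqrt_mul hK0, Real.sqrt_sq (by positivity), hR, pow_succ' r⁻¹, mul_assoc r⁻¹]
      gcongr
      linarith

lemma hess_nrm_le (d : ℕ) {lam Lam : ℝ} (hlam : 0 < lam) (hLam : 0 < Lam) :
    ∃ C : ℝ, 0 < C ∧ ∀ A : Matrix (Fin d) (Fin d) ℝ, Ell lam Lam A → ∀ D : Set (Euc d), CDom D →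
      D ⊆ ball 0 1 → (∀ x ∈ D, 1 / 2 ≤ ‖x‖) → ∀ (W : Pol d) (M : ℝ), nrm D (LA A W) ≤ M →
      (∀ i z, nrm D (pd i (Zr z W)) ≤ M) → (∀ i, nrm D (pd i W) ≤ M) →
      ∀ j k, nrm D (pd j (pd k W)) ≤ C * M := by
  obtain ⟨C1, hC1, h1⟩ := hess_pointwise d hlam hLam
  refine ⟨√(4 ^ 6 * C1 * (1 + (d * d : ℕ) * d + d)), by positivity,
    fun A hA D hD hs hx W M hL hZ hG j k => ?_⟩
  have hM : 0 ≤ M := (nrm_nonneg _).trans hL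
  refine nrm_le (by positivity) ?_
  rw [mul_pow, Real.sq_sqrt (by positivity)]
  have h2 : I D (pd j (pd k W) ^ 2) ≤
      I D ((4 ^ 6 * C1) • (LA A W ^ 2 + ∑ z, gradSq (Zr z W) + gradSq W)) := by
    refine I_mono hD fun x hxD => ?_
    have h3 := h1 A hA W x (mem_ball_zero_iff.1 (hs hxD)).le j k
    simp only [map_add, map_pow, map_sum, ev_smul]
    have h4 : (1 / 4 : ℝ) ^ 6 ≤ (‖x‖ ^ 2) ^ 6 := by
      refine pow_le_pow_left₀ (by norm_num) ?_ 6
      have := hx x hxD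
      nlinarith
    have := mul_le_mul_of_nonneg_right h4 (sq_nonneg (ev x (pd j (pd k W))))
    norm_num at *
    linarith
  have hg : ∀ p : Pol d, (∀ i, nrm D (pd i p) ≤ M) → I D (gradSq p) ≤ d * M ^ 2 := fun p hp =>
    I_sum_sq_le hD _ hp
  rw [I_smul, I_add hD, I_add hD, I_sum hD, ← nrm_sq hD (LA A W)] at h2
  have t1 := pow_le_pow_left₀ (nrm_nonneg _) hL 2
  have t2 : ∑ z, I D (gradSq (Zr z W)) ≤ (d * d : ℕ) * (d * M ^ 2) := by
    refine (Finset.sum_le_sum fun z _ => hg _ fun i => hZ i z).trans ?_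
    simp
  have t3 := hg W hG
  refine h2.trans ?_
  rw [mul_assoc (4 ^ 6 * C1)]
  refine mul_le_mul_of_nonneg_left ?_ (by positivity)
  linarith

/-- Trading rotations for arbitrary derivatives away from the origin. -/
lemma Dw_Zw_le (d : ℕ) {lam Lam : ℝ} (hlam : 0 < lam) (hLam : 0 < Lam) (n k : ℕ) :
    ∃ C : ℝ, 1 ≤ C ∧ ∀ A : Matrix (Fin d) (Fin d) ℝ, Ell lam Lam A → ∀ D : Set (Euc d), CDom D →
      D ⊆ ball 0 1 → (∀ x ∈ D, 1 / 2 ≤ ‖x‖) → ∀ (v : Pol d) (N : ℝ), 0 ≤ N →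
      (∀ J : List (Fin d × Fin d), J.length ≤ n → ∀ i, nrm D (pd i (Zw J v)) ≤ N) →
      (∀ (γ : List (Fin d)) (J : List (Fin d × Fin d)), γ.length + J.length ≤ n →
        nrm D (Dw γ (Zw J (LA A v))) ≤ N) →
      ∀ (α : List (Fin d)) (J : List (Fin d × Fin d)), α.length = k + 1 →
        α.length + J.length ≤ n + 1 → nrm D (Dw α (Zw J v)) ≤ C * N := by
  induction k with
  | zero =>
    refine ⟨1, le_rfl, fun A hA D hD hs hx v N hN h1 h2 α J hα hJ => ?_⟩
    obtain ⟨a, rfl⟩ := List.length_eq_one_iff.1 hα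
    rw [one_mul]
    exact h1 J (by simp only [List.length_singleton] at hJ; omega) a
  | succ k ih =>
    obtain ⟨C, hC, h⟩ := ih
    obtain ⟨C1, hC1, h1⟩ := hess_nrm_le d hlam hLam
    suffices H : ∀ m : ℕ, ∃ C : ℝ, 1 ≤ C ∧ ∀ A : Matrix (Fin d) (Fin d) ℝ, Ell lam Lam A →
      ∀ D : Set (Euc d), CDom D →
      D ⊆ ball 0 1 → (∀ x ∈ D, 1 / 2 ≤ ‖x‖) → ∀ (v : Pol d) (N : ℝ), 0 ≤ N →
      (∀ J : List (Fin d × Fin d), J.length ≤ n → ∀ i, nrm D (pd i (Zw J v)) ≤ N) →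
      (∀ (γ : List (Fin d)) (J : List (Fin d × Fin d)), γ.length + J.length ≤ n →
        nrm D (Dw γ (Zw J (LA A v))) ≤ N) →
      ∀ (α : List (Fin d)) (J : List (Fin d × Fin d)), J.length < m → α.length = k + 1 + 1 →
        α.length + J.length ≤ n + 1 → nrm D (Dw α (Zw J v)) ≤ C * N by
      obtain ⟨C, hC, h⟩ := H (n + 1)
      exact ⟨C, hC, fun A hA D hD hs hx v N hN h1 h2 α J hα hJ =>
        h A hA D hD hs hx v N hN h1 h2 α J (by omega) hα hJ⟩
    intro m
    induction m with
    | zero => exact ⟨1, le_rfl, fun A hA D hD hs hx v N hN h1 h2 α J hm => by omega⟩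
    | succ m ihm =>
      obtain ⟨C', hC', h'⟩ := ihm
      obtain ⟨C2, hC2, h2⟩ := LA_Zw d m Lam hLam.le
      set M := 1 + d * (C2 * C') + (C + 2 * (k : ℝ) * C) with hM
      have hM0 : 0 ≤ M := by positivity
      refine ⟨C' + C1 * M, by linarith [mul_nonneg hC1.le hM0],
        fun A hA D hD hs hx v N hN g1 g2 α J hJm hα hJ => ?_⟩
      rcases Nat.lt_or_ge J.length m with hlt | hge
      · refine (h' A hA D hD hs hx v N hN g1 g2 α J hlt hα hJ).trans ?_
        gcongr
        linarith [mul_nonneg hC1.le hM0]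
      obtain _ | ⟨a, _ | ⟨b, γ⟩⟩ := α
      · simp at hα
      · simp at hα
      simp only [List.length_cons] at hα hJ
      have hγ : γ.length = k := by omega
      obtain ⟨F, eF, bF⟩ := h2 A hA.bdd J (by omega) v
      have e : Dw (a :: b :: γ) (Zw J v) = pd b (pd a (Dw γ (Zw J v))) := by
        rw [Dw_cons, Dw_cons, pd_Dw, pd_Dw]
      have low := h A hA D hD hs hx v N hN g1 g2
      rw [e]
      have key := h1 A hA D hD hs hx (Dw γ (Zw J v)) (M * N) ?_ ?_ ?_ b a
      · refine key.trans ?_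
        rw [← mul_assoc]
        gcongr
        linarith
      · rw [LA_Dw, eF, map_add, map_sum]
        refine (nrm_add_le hD _ _).trans ((add_le_add (g2 γ J (by omega))
          (nrm_sum_le_card hD _ fun i => ?_)).trans (b := N + d * (C2 * (C' * N))) ?_)
        · rw [← Dw_cons]
          refine bF D hD (i :: γ) (C' * N) (by positivity) (fun J' hJ' j => ?_) i
          rw [← Dw_cons]
          exact h' A hA D hD hs hx v N hN g1 g2 _ J' (by omega) (by simp [hγ])
            (by simp only [List.length_cons]; omega)
        · rw [hM]
          have : 0 ≤ (C + 2 * (k : ℝ) * C) * N := by positivity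
          linarith
      · intro i z
        have := nrm_Dw_Zr_Dw_le hD z (Zw J v) (M := C * N) (M' := C * N) γ [i] ?_ ?_
        · rw [Dw_cons, Dw_nil, hγ] at this
          refine this.trans ?_
          rw [hM]
          have : 0 ≤ (1 + d * (C2 * C')) * N := by positivity
          linarith
        · intro δ hδ
          rw [← Zw_concat]
          exact low δ _ (by simpa [hγ, add_comm] using hδ) (by
            simp only [List.length_append, List.length_singleton] at hδ ⊢; omega)
        · intro δ hδ
          exact low δ _ (by simpa [hγ, add_comm] using hδ) (by
            simp only [List.length_singleton] at hδ ⊢; omega)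
      · intro i
        rw [pd_Dw, ← Dw_cons]
        refine (low (i :: γ) J (by simp [hγ]) (by simp only [List.length_cons]; omega)).trans ?_
        rw [hM]
        have : 0 ≤ (1 + d * (C2 * C') + 2 * (k : ℝ) * C) * N := by positivity
        linarith

end BoundaryRegularity

end WeakType

namespace WeakType

section LocalRegularity

variable {d : ℕ}

lemma interior_Dw_le (d : ℕ) {lam : ℝ} (Lam : ℝ) (hlam : 0 < lam) (m : ℕ) :
    ∃ C : ℝ, 1 ≤ C ∧ ∀ A : Matrix (Fin d) (Fin d) ℝ, Ell lam Lam A → ∀ (y : Euc d) (r : ℝ),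
      0 < r → r ≤ 1 → r ≤ 1 - ‖y‖ → ∀ (v : Pol d) (N : ℝ),
      (∀ α : List (Fin d), α.length = 2 → nrm (cut y r) (Dw α v) ≤ N) →
      (∀ β : List (Fin d), β.length ≤ m + 1 → nrm (cut y r) (Dw β (LA A v)) ≤ N) →
      ∀ α : List (Fin d), α.length = m + 2 →
        nrm (cut y (r / 2 ^ m)) (Dw α v) ≤ C * (r⁻¹ ^ m * N) := by
  induction m with
  | zero => exact ⟨1, le_rfl, fun A hA y r hr hr1 hy v N hN _ α hα => by simpa using hN α hα⟩
  | succ m ih =>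
    obtain ⟨C, hC, h⟩ := ih
    obtain ⟨C1, hC1, h1⟩ := cacc_local d (Lam := Lam) hlam
    set K := C1 * ((4 ^ m + 1) * C ^ 2) with hK
    have hK0 : 0 ≤ K := by positivity
    refine ⟨1 + √K, by linarith [Real.sqrt_nonneg K], fun A hA y r hr hr1 hy v N hN hp α hα => ?_⟩
    have hri : 1 ≤ r⁻¹ := (one_le_inv₀ hr).2 hr1
    obtain _ | ⟨a, γ⟩ := α
    · simp at hα
    have hγ : γ.length = m + 2 := by simp only [List.length_cons] at hα; omega
    have hN0 : 0 ≤ N := (nrm_nonneg _).trans (hp [] (by simp))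
    have h0 := h A hA y r hr hr1 hy v N hN (fun β hβ => hp β (by omega)) γ hγ
    set s := r / 2 ^ m with hs
    have hs0 : 0 < s := by positivity
    have hsr : s ≤ r := div_le_self hr.le (one_le_pow₀ (by norm_num))
    have hs2 : r / 2 ^ (m + 1) = s / 2 := by rw [hs, pow_succ]; field_simp
    rw [hs2]
    have hcs := CDom.cut y s
    set R := r⁻¹ ^ m * N with hR
    have hR0 : 0 ≤ R := by positivity
    have hh : nrm (cut y s) (Dw γ (LA A v)) ≤ C * R := by
      refine (nrm_mono_set (CDom.cut y r) (cut_mono y hsr) _).trans ((hp γ (by omega)).trans ?_)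
      rw [hR]
      nth_rw 1 [← one_mul N, ← one_mul N]
      gcongr
      exact one_le_pow₀ hri
    have key := h1 A hA y s hs0 (hsr.trans hr1) (Dw γ v) (Dw γ (LA A v)) 0 (fun x hx hx' => by
      have t1 := norm_le_norm_add_norm_sub' x y
      rw [mem_ball, dist_eq_norm] at hx'
      rw [mem_sphere_zero_iff_norm] at hx
      linarith) (by simp [LA_Dw])
    rw [← nrm_sq hcs, ← nrm_sq hcs] at key
    have hz : I (cut y s) (∑ i, (0 : Fin d → Pol d) i ^ 2) = 0 := by simp [I_zero]
    rw [hz, add_zero] at key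
    have t1 := pow_le_pow_left₀ (nrm_nonneg _) h0 2
    have t2 := pow_le_pow_left₀ (nrm_nonneg _) hh 2
    have hsi : s⁻¹ ^ 2 = 4 ^ m * r⁻¹ ^ 2 := by
      rw [hs, inv_div, div_eq_mul_inv, mul_pow, ← pow_mul, mul_comm m 2, pow_mul]; norm_num
    have hri2 : 1 ≤ r⁻¹ ^ 2 := one_le_pow₀ hri
    rw [Dw_cons, ← pd_Dw]
    refine (nrm_pd_le (CDom.cut y (s / 2)) a _).trans ((Real.sqrt_le_sqrt (y := K * (r⁻¹ * R) ^ 2)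
      ?_).trans ?_)
    · refine key.trans ?_
      rw [hK, mul_assoc C1]
      refine mul_le_mul_of_nonneg_left ?_ hC1.le
      calc _ ≤ 4 ^ m * r⁻¹ ^ 2 * (C * R) ^ 2 + (C * R) ^ 2 := by
            rw [hsi]
            have := mul_le_mul_of_nonneg_left t1 (show 0 ≤ 4 ^ m * r⁻¹ ^ 2 by positivity)
            linarith
        _ ≤ 4 ^ m * r⁻¹ ^ 2 * (C * R) ^ 2 + r⁻¹ ^ 2 * (C * R) ^ 2 :=
            add_le_add le_rfl (le_mul_of_one_le_left (by positivity) hri2)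
        _ = _ := by ring
    · rw [Real.sqrt_mul hK0, Real.sqrt_sq (by positivity), hR, pow_succ' r⁻¹, mul_assoc r⁻¹]
      gcongr
      linarith

/-- The right-hand side `p` has size `Φ` and is, up to an error `ε`, concentrated in
`B(y, 16ρ) ∖ B(y, ρ / 4)`. -/
structure Annular (p : Pol d) (K : ℕ) (y : Euc d) (ρ Φ ε : ℝ) : Prop where
  ynorm : ‖y‖ ≤ 1
  rpos : 0 < ρ
  rle : ρ ≤ 1 / 8
  epos : 0 ≤ ε
  bound : nrm (ball (0 : Euc d) 1) p ≤ Φ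
  small : ∀ x ∈ cut y (ρ / 4), ∀ β : List (Fin d), β.length ≤ K → |ev x (Dw β p)| ≤ ε
  tail : I (ball (0 : Euc d) 1 \ cut y (16 * ρ)) (p ^ 2) ≤ ε ^ 2

lemma Annular.interior (hd : 1 ≤ d) {lam Lam : ℝ} (hlam : 0 < lam) (hLam : 0 < Lam) (n : ℕ) :
    ∃ C : ℝ, 0 ≤ C ∧ ∀ A : Matrix (Fin d) (Fin d) ℝ, Ell lam Lam A → ∀ (q : Pol d) (y : Euc d)
      (ρ Φ ε : ℝ), Annular (LA A (om * q)) (n + 1) y ρ Φ ε → ρ / 8 ≤ 1 - ‖y‖ →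
      ∀ α : List (Fin d), α.length = n + 2 →
        nrm (cut y (ρ / (8 * 2 ^ (n + 1)))) (Dw α (om * q)) ≤ C * (ρ⁻¹ ^ (n + 1) * (ρ * Φ + ε)) := by
  obtain ⟨C1, hC1, h1⟩ := global_H2 hd hlam hLam
  obtain ⟨C2, hC2, h2⟩ := interior_Dw_le d Lam hlam n
  have hsq : 0 ≤ sqB d := Real.sqrt_nonneg _
  refine ⟨C2 * (8 ^ n * (C1 + sqB d)), by positivity, fun A hA q y ρ Φ ε H hy α hα => ?_⟩
  have hρ := H.rpos
  have hρ1 := H.rle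
  have hε := H.epos
  have hΦ : 0 ≤ Φ := (nrm_nonneg _).trans H.bound
  have hr : 0 < ρ / 8 := by positivity
  have hcut := CDom.cut y (ρ / 8)
  have k1 : ρ⁻¹ * (ρ * Φ + ε) = Φ + ρ⁻¹ * ε := by field_simp
  have k2 : ε ≤ ρ⁻¹ * ε :=
    le_mul_of_one_le_left hε ((one_le_inv₀ hρ).2 (by linarith))
  have hN1 : C1 * Φ ≤ (C1 + sqB d) * (ρ⁻¹ * (ρ * Φ + ε)) := by
    rw [k1]; gcongr <;> linarith
  have hN2 : ε * sqB d ≤ (C1 + sqB d) * (ρ⁻¹ * (ρ * Φ + ε)) := by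
    rw [k1, mul_comm]; gcongr <;> linarith
  have key := h2 A hA y (ρ / 8) hr (by linarith) hy (om * q)
    ((C1 + sqB d) * (ρ⁻¹ * (ρ * Φ + ε))) (fun β hβ => ?_) (fun β hβ => ?_) α hα
  · refine (nrm_mono_set (CDom.cut _ _) (cut_mono y ?_) _).trans (key.trans (le_of_eq ?_))
    · rw [div_div]
      have : (2 : ℝ) ^ n ≤ 2 ^ (n + 1) := pow_le_pow_right₀ (by norm_num) (by omega)
      gcongr
    · rw [inv_div, div_eq_mul_inv, mul_pow, pow_succ]; ring
  · obtain ⟨a, b, rfl⟩ := List.length_eq_two.1 hβ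
    rw [Dw_cons, Dw_cons, Dw_nil]
    refine (nrm_mono_set (CDom.ball 0 1) inter_subset_left _).trans ((h1 A hA q b a).trans ?_)
    refine le_trans ?_ hN1
    gcongr
    exact H.bound
  · exact (nrm_le_of_bound hcut inter_subset_left hε fun x hx =>
      H.small x (cut_mono y (by linarith) hx) β hβ).trans hN2

lemma Annular.boundary (hd : 1 ≤ d) {lam Lam : ℝ} (hlam : 0 < lam) (hLam : 0 < Lam) (n : ℕ) :
    ∃ C : ℝ, 0 ≤ C ∧ ∀ A : Matrix (Fin d) (Fin d) ℝ, Ell lam Lam A → ∀ (q : Pol d) (y : Euc d)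
      (ρ Φ ε : ℝ), Annular (LA A (om * q)) n y ρ Φ ε → 1 - ‖y‖ ≤ ρ / 8 →
      ∀ α : List (Fin d), α.length = n + 1 →
        nrm (cut y (ρ / (8 * 2 ^ n))) (Dw α (om * q)) ≤ C * (ρ⁻¹ ^ n * (ρ * Φ + ε)) := by
  obtain ⟨C1, hC1, h1⟩ := grad_Zw_le d hlam hLam n
  obtain ⟨C2, hC2, h2⟩ := Dw_Zw_le d hlam hLam n n
  set K0 := (2 + 2 * (n : ℝ)) ^ n with hK0
  have hK : 0 ≤ K0 := by positivity
  have hsq : 0 ≤ sqB d := Real.sqrt_nonneg _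
  set C0 := √(2312 / lam ^ 2) + K0 * sqB d with hC0
  have hC00 : 0 ≤ C0 := by positivity
  refine ⟨C2 * (C1 * (4 ^ n * C0)), by positivity, fun A hA q y ρ Φ ε H hy α hα => ?_⟩
  have hρ := H.rpos
  have hρ1 := H.rle
  have hε := H.epos
  have hΦ : 0 ≤ Φ := (nrm_nonneg _).trans H.bound
  set N := C0 * (ρ * Φ + ε) with hN
  have hN0 : 0 ≤ N := by positivity
  have hcut := CDom.cut y (ρ / 4)
  have hs : cut y (ρ / 4) ⊆ ball 0 1 := inter_subset_left
  have hgrad : ∀ i, nrm (cut y (ρ / 4)) (pd i (om * q)) ≤ N := fun i => by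
    refine (nrm_mono_set (CDom.ball 0 1) hs _).trans ((nrm_pd_le (CDom.ball 0 1) i _).trans ?_)
    have hy0 : y ≠ 0 := by rintro rfl; rw [norm_zero] at hy; linarith
    have hE := energy_cap hd hlam hA (fun x hx => ev_om_mul_sphere q hx) hρ hy0
      (by linarith) (Φ := Φ) (by
        rw [← nrm_sq (CDom.ball 0 1)]; exact pow_le_pow_left₀ (nrm_nonneg _) H.bound 2) H.tail
    refine (Real.sqrt_le_sqrt (hE.trans (b := _) (c := 2312 / lam ^ 2 * (ρ * Φ + ε) ^ 2)
      ?_)).trans ?_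
    · refine mul_le_mul_of_nonneg_left ?_ (by positivity)
      have : 0 ≤ 2 * (ρ * Φ) * ε := by positivity
      linarith [show (ρ * Φ + ε) ^ 2 = ρ ^ 2 * Φ ^ 2 + ε ^ 2 + 2 * (ρ * Φ) * ε by ring]
    · rw [Real.sqrt_mul (by positivity), Real.sqrt_sq (by positivity)]
      refine mul_le_mul_of_nonneg_right ?_ (by positivity)
      linarith [mul_nonneg hK hsq]
  have hsmall : ∀ (γ : List (Fin d)) (J : List (Fin d × Fin d)), γ.length + J.length ≤ n →
      nrm (cut y (ρ / 4)) (Dw γ (Zw J (LA A (om * q)))) ≤ N := fun γ J hJ => by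
    refine (nrm_le_of_bound hcut hs (ε := K0 * ε) (by positivity) fun x hx => ?_).trans ?_
    · refine (ev_Dw_Zw_le (hs hx) n J _ γ.length hJ
        (fun δ hδ => H.small x hx δ (by omega)) γ le_rfl).trans ?_
      refine mul_le_mul_of_nonneg_right (pow_le_pow_right₀ ?_ (by omega)) hε
      have : (0 : ℝ) ≤ n := Nat.cast_nonneg n
      linarith
    · have e1 : K0 * sqB d ≤ C0 := by linarith [Real.sqrt_nonneg (2312 / lam ^ 2)]
      have e2 : ε ≤ ρ * Φ + ε := by linarith [mul_nonneg hρ.le hΦ]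
      calc K0 * ε * sqB d = K0 * sqB d * ε := by ring
        _ ≤ N := mul_le_mul e1 e2 hε hC00
  have hri : 1 ≤ (ρ / 4)⁻¹ := (one_le_inv₀ (by positivity)).2 (by linarith)
  have k1 := h1 A hA y (ρ / 4) (by positivity) (by linarith) q N hgrad
    (fun J hJ => by simpa using hsmall [] J (by simpa using hJ))
  set D := cut y (ρ / 4 / 2 ^ n) with hD
  have hr2 : ρ / 4 / 2 ^ n ≤ ρ / 4 := div_le_self (by positivity) (one_le_pow₀ (by norm_num))
  have hN' : N ≤ C1 * ((ρ / 4)⁻¹ ^ n * N) := by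
    rw [← mul_assoc]
    exact le_mul_of_one_le_left hN0 (one_le_mul_of_one_le_of_one_le hC1 (one_le_pow₀ hri))
  have k2 := h2 A hA D (CDom.cut _ _) inter_subset_left (fun x hx => by
      have t1 := norm_sub_norm_le y x
      have t2 : dist x y < ρ / 4 / 2 ^ n := hx.2
      rw [dist_comm, dist_eq_norm] at t2
      linarith) (om * q) (C1 * ((ρ / 4)⁻¹ ^ n * N)) (by positivity) k1
    (fun γ J hJ => (nrm_mono_set hcut (cut_mono y hr2) _).trans ((hsmall γ J hJ).trans hN'))
    α [] hα (by simp [hα])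
  refine (nrm_mono_set (CDom.cut _ _) (cut_mono y ?_) _).trans (k2.trans (le_of_eq ?_))
  · rw [div_div]
    gcongr
    norm_num
  · rw [hN, inv_div, div_eq_mul_inv, mul_pow]; ring

/-- Local `L²` bounds for high derivatives at the centre of the annulus. -/
lemma Annular.nrm_Dw_le (hd : 1 ≤ d) {lam Lam : ℝ} (hlam : 0 < lam) (hLam : 0 < Lam) (K : ℕ) :
    ∃ C : ℝ, 0 ≤ C ∧ ∀ A : Matrix (Fin d) (Fin d) ℝ, Ell lam Lam A → ∀ (q : Pol d) (y : Euc d)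
      (ρ Φ ε : ℝ), Annular (LA A (om * q)) K y ρ Φ ε → ∀ n, n + 1 ≤ K →
      ∀ α : List (Fin d), α.length = n + 2 →
        nrm (cut y (ρ / (8 * 2 ^ K))) (Dw α (om * q)) ≤ C * (ρ⁻¹ ^ (n + 1) * (ρ * Φ + ε)) := by
  choose C1 hC1 h1 using Annular.interior hd hlam hLam
  choose C2 hC2 h2 using Annular.boundary hd hlam hLam
  refine ⟨∑ n ∈ Finset.range K, (C1 n + C2 (n + 1)),
    Finset.sum_nonneg fun n _ => add_nonneg (hC1 n) (hC2 _), fun A hA q y ρ Φ ε H n hn α hα => ?_⟩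
  have hρ := H.rpos
  have hε := H.epos
  have hΦ : 0 ≤ Φ := (nrm_nonneg _).trans H.bound
  have H' : Annular (LA A (om * q)) (n + 1) y ρ Φ ε :=
    { H with small := fun x hx β hβ => H.small x hx β (by omega) }
  have hle : C1 n + C2 (n + 1) ≤ ∑ n ∈ Finset.range K, (C1 n + C2 (n + 1)) :=
    Finset.single_le_sum (f := fun n => C1 n + C2 (n + 1))
      (fun n _ => add_nonneg (hC1 n) (hC2 _)) (Finset.mem_range.2 (by omega))
  have hsub : cut y (ρ / (8 * 2 ^ K)) ⊆ cut y (ρ / (8 * 2 ^ (n + 1))) := by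
    refine cut_mono y ?_
    gcongr
    norm_num
  refine (nrm_mono_set (CDom.cut _ _) hsub _).trans ?_
  rcases le_total (ρ / 8) (1 - ‖y‖) with hy | hy
  · refine (h1 n A hA q y ρ Φ ε H' hy α hα).trans ?_
    gcongr
    linarith [hC2 (n + 1)]
  · refine (h2 (n + 1) A hA q y ρ Φ ε H' hy α hα).trans ?_
    gcongr
    linarith [hC1 n]

end LocalRegularity

end WeakType

namespace WeakType

section Sobolev

open Topology

variable {d : ℕ}

/-- The `j`-th directional derivative of a polynomial. -/
noncomputable def dirD (e : Euc d) : ℕ → Pol d → Euc d → ℝ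
  | 0, w, x => ev x w
  | j + 1, w, x => ∑ i, e i * dirD e j (pd i w) x

/-- The sum of the absolute values of all derivatives of order `j`. -/
noncomputable def absD : ℕ → Pol d → Euc d → ℝ
  | 0, w, x => |ev x w|
  | j + 1, w, x => ∑ i, absD j (pd i w) x

lemma absD_nonneg (j : ℕ) (w : Pol d) (x : Euc d) : 0 ≤ absD j w x := by
  induction j generalizing w with
  | zero => exact abs_nonneg _
  | succ j ih => exact Finset.sum_nonneg fun i _ => ih _

lemma continuous_absD (j : ℕ) (w : Pol d) : Continuous (absD j w) := by
  induction j generalizing w with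
  | zero => exact (continuous_ev w).abs
  | succ j ih => exact continuous_finsetSum _ fun i _ => ih _

lemma abs_dirD_le {e : Euc d} {R : ℝ} (he : ‖e‖ ≤ R) (j : ℕ) (w : Pol d) (x : Euc d) :
    |dirD e j w x| ≤ R ^ j * absD j w x := by
  have hR : 0 ≤ R := (norm_nonneg _).trans he
  induction j generalizing w with
  | zero => simp [dirD, absD]
  | succ j ih =>
    rw [dirD, absD, Finset.mul_sum]
    refine (Finset.abs_sum_le_sum_abs _ _).trans (Finset.sum_le_sum fun i _ => ?_)
    rw [abs_mul, pow_succ', mul_assoc]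
    exact mul_le_mul ((PiLp.norm_apply_le e i).trans he) (ih _) (abs_nonneg _) hR

lemma hasDerivAt_dirD (e x : Euc d) (j : ℕ) (w : Pol d) (s : ℝ) :
    HasDerivAt (fun s : ℝ => dirD e j w (x + s • e)) (dirD e (j + 1) w (x + s • e)) s := by
  induction j generalizing w with
  | zero =>
    have h1 : HasDerivAt (fun s : ℝ => x + s • e) e s := by
      simpa using ((hasDerivAt_id s).smul_const e).const_add x
    have h2 := (hasFDerivAt_ev w (x + s • e)).comp_hasDerivAt s h1
    refine h2.congr_deriv ?_
    rw [gradL_apply]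
    exact Finset.sum_congr rfl fun i _ => mul_comm _ _
  | succ j ih => exact HasDerivAt.fun_sum fun i _ => (ih (pd i w)).const_mul (e i)

lemma continuous_dirD (x : Euc d) (j : ℕ) (w : Pol d) :
    Continuous fun p : ℝ × Euc d => dirD (p.2 - x) j w (x + p.1 • (p.2 - x)) := by
  induction j generalizing w with
  | zero => exact (continuous_ev w).comp (by fun_prop)
  | succ j ih =>
    exact continuous_finsetSum _ fun i _ => Continuous.mul (by fun_prop) (ih _)

/-- Truncated Taylor sums evaluated along a ray. -/
noncomputable def tay (x : Euc d) (w : Pol d) (n : ℕ) (s : ℝ) (z : Euc d) : ℝ :=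
  ∑ j ∈ Finset.range n, (-s) ^ j / j.factorial * dirD (z - x) j w (x + s • (z - x))

lemma hasDerivAt_tay (x : Euc d) (w : Pol d) (n : ℕ) (s : ℝ) (z : Euc d) :
    HasDerivAt (fun s => tay x w (n + 1) s z)
      ((-s) ^ n / n.factorial * dirD (z - x) (n + 1) w (x + s • (z - x))) s := by
  induction n with
  | zero =>
    simp only [tay, zero_add, Finset.sum_range_one, pow_zero, Nat.factorial_zero, Nat.cast_one,
      div_one, one_mul]
    exact hasDerivAt_dirD _ _ 0 w s
  | succ n ih =>
    have h1 : HasDerivAt (fun s : ℝ => (-s) ^ (n + 1) / ((n + 1).factorial : ℝ))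
        (-((-s) ^ n / n.factorial)) s := by
      have := ((hasDerivAt_id s).neg.pow (n + 1)).div_const ((n + 1).factorial : ℝ)
      refine this.congr_deriv ?_
      simp only [Pi.neg_apply, id]
      have : (n.factorial : ℝ) ≠ 0 := by positivity
      rw [Nat.factorial_succ]
      push_cast
      field_simp
    have h2 := ih.add (h1.mul (hasDerivAt_dirD (z - x) x (n + 1) w s))
    have e : (fun s => tay x w (n + 1 + 1) s z) = (fun s => tay x w (n + 1) s z) +
        (fun s : ℝ => (-s) ^ (n + 1) / ((n + 1).factorial : ℝ)) *
          fun s : ℝ => dirD (z - x) (n + 1) w (x + s • (z - x)) := by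
      funext s
      simp only [tay, Finset.sum_range_succ _ (n + 1), Pi.add_apply, Pi.mul_apply]
    rw [e]
    refine h2.congr_deriv ?_
    ring

lemma setIntegral_abs_le {D : Set (Euc d)} (hD : CDom D) (p : Pol d) :
    ∫ x in D, |ev x p| ≤ √(volume.real D) * nrm D p := by
  have hi := hD.integrableOn (continuous_ev p).abs
  have h : ∀ t : ℝ, 0 ≤ volume.real D * (t * t) + (-2 * ∫ x in D, |ev x p|) * t + I D (p ^ 2) :=
    fun t => by
    have h0 : 0 ≤ ∫ x in D, (|ev x p| - t) ^ 2 := integral_nonneg fun x => sq_nonneg _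
    have e : ∫ x in D, (|ev x p| - t) ^ 2
        = ∫ x in D, (ev x (p ^ 2) + (-2 * t) * |ev x p|) + t * t := by
      congr 1; funext x; rw [map_pow, ← sq_abs (ev x p)]; ring
    rw [e, integral_add, integral_add, integral_const_mul, setIntegral_const, smul_eq_mul] at h0
    · rw [I]; linarith
    · exact hD.integrableOn (continuous_ev _)
    · exact hi.const_mul _
    · exact (hD.integrableOn (continuous_ev _)).add (hi.const_mul _)
    · exact hD.integrableOn continuous_const
  have h2 := discrim_le_zero h
  rw [discrim] at h2
  rw [nrm, ← Real.sqrt_mul measureReal_nonneg]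
  exact Real.le_sqrt_of_sq_le (by linarith)

lemma setIntegral_absD_le {D : Set (Euc d)} (hD : CDom D) (j : ℕ) (w : Pol d) {M : ℝ}
    (h : ∀ γ : List (Fin d), γ.length = j → nrm D (Dw γ w) ≤ M) :
    ∫ x in D, absD j w x ≤ d ^ j * (√(volume.real D) * M) := by
  induction j generalizing w with
  | zero =>
    refine (setIntegral_abs_le hD w).trans ?_
    rw [pow_zero, one_mul]
    exact mul_le_mul_of_nonneg_left (h [] rfl) (Real.sqrt_nonneg _)
  | succ j ih =>
    simp only [absD]
    rw [integral_finsetSum _ fun i _ => hD.integrableOn (continuous_absD j _)]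
    refine (Finset.sum_le_sum fun i _ => ih (pd i w) fun γ hγ => ?_).trans (le_of_eq ?_)
    · rw [← Dw_cons]; exact h _ (by simp [hγ])
    · rw [Finset.sum_const, Finset.card_univ, Fintype.card_fin, nsmul_eq_mul, pow_succ]; ring

lemma setIntegral_comp_segment_le {D : Set (Euc d)} (hD : CDom D) {g : Euc d → ℝ}
    (hg : Continuous g) (hg0 : ∀ x, 0 ≤ g x) {x : Euc d} (hx : x ∈ D) {s : ℝ} (hs : 0 < s)
    (hs1 : s ≤ 1) : s ^ d * ∫ z in D, g (x + s • (z - x)) ≤ ∫ z in D, g z := by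
  have hm := hD.measurableSet
  have hG : Integrable (D.indicator g) := (hD.integrableOn hg).integrable_indicator hm
  have hG' : Integrable fun z => D.indicator g (s • z + (x - s • x)) :=
    (hG.comp_add_right (x - s • x)).comp_smul hs.ne'
  have e : ∫ z, D.indicator g (s • z + (x - s • x)) = (s ^ d)⁻¹ * ∫ z in D, g z := by
    rw [Measure.integral_comp_smul volume (fun z => D.indicator g (z + (x - s • x))) s,
      integral_add_right_eq_self (D.indicator g) (x - s • x), integral_indicator hm, smul_eq_mul,
      finrank_euclideanSpace_fin, abs_of_nonneg (by positivity)]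
  have h : ∫ z in D, g (x + s • (z - x)) ≤ (s ^ d)⁻¹ * ∫ z in D, g z := by
    rw [← e, ← integral_indicator hm]
    refine integral_mono ((hD.integrableOn (by fun_prop)).integrable_indicator hm) hG' fun z => ?_
    have ez : s • z + (x - s • x) = x + s • (z - x) := by rw [smul_sub]; abel
    by_cases hz : z ∈ D
    · have : x + s • (z - x) ∈ D := hD.convex.add_smul_sub_mem hx hz ⟨hs.le, hs1⟩
      simp only [indicator_of_mem hz, ez, indicator_of_mem this, le_refl]
    · rw [indicator_of_notMem hz]
      exact indicator_nonneg (fun y _ => hg0 y) _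
  calc _ ≤ s ^ d * ((s ^ d)⁻¹ * ∫ z in D, g z) := mul_le_mul_of_nonneg_left h (by positivity)
    _ = _ := by rw [← mul_assoc, mul_inv_cancel₀ (by positivity), one_mul]

lemma hasDerivAt_integral_tay {D : Set (Euc d)} (hD : CDom D) (x : Euc d) (w : Pol d) (n : ℕ)
    (s : ℝ) : HasDerivAt (fun s => ∫ z in D, tay x w (n + 1) s z)
      (∫ z in D, (-s) ^ n / n.factorial * dirD (z - x) (n + 1) w (x + s • (z - x))) s := by
  have hc : ∀ n, Continuous fun p : ℝ × Euc d => tay x w n p.1 p.2 := fun n =>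
    continuous_finsetSum _ fun j _ => Continuous.mul (by fun_prop) (continuous_dirD x j w)
  have hc' : Continuous fun p : ℝ × Euc d =>
      (-p.1) ^ n / n.factorial * dirD (p.2 - x) (n + 1) w (x + p.1 • (p.2 - x)) :=
    Continuous.mul (by fun_prop) (continuous_dirD x _ w)
  obtain ⟨B, hB⟩ := IsCompact.exists_bound_of_continuousOn
    ((isCompact_closedBall s 1).prod hD.bdd.isCompact_closure) hc'.continuousOn
  refine (hasDerivAt_integral_of_dominated_loc_of_deriv_le (𝕜 := ℝ) (bound := fun _ => B)
    (μ := volume.restrict D) (F := fun s z => tay x w (n + 1) s z)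
    (F' := fun s z => (-s) ^ n / n.factorial * dirD (z - x) (n + 1) w (x + s • (z - x)))
    (closedBall_mem_nhds s one_pos) (Filter.Eventually.of_forall fun t => ?_) ?_ ?_ ?_ ?_ ?_).2
  · exact ((hc _).comp (Continuous.prodMk_right t)).aestronglyMeasurable
  · exact hD.integrableOn ((hc _).comp (Continuous.prodMk_right s))
  · exact (hc'.comp (Continuous.prodMk_right s)).aestronglyMeasurable
  · refine (ae_restrict_iff' hD.measurableSet).2 (Filter.Eventually.of_forall fun z hz t ht => ?_)
    exact hB (t, z) ⟨ht, subset_closure hz⟩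
  · exact hD.integrableOn continuous_const
  · exact Filter.Eventually.of_forall fun z t _ => hasDerivAt_tay x w n t z

/-- A Sobolev inequality on bounded convex domains. -/
lemma sobolev (hd : 1 ≤ d) {D : Set (Euc d)} (hD : CDom D) {r : ℝ} (hr : 0 < r)
    (hdiam : ∀ x ∈ D, ∀ z ∈ D, ‖z - x‖ ≤ 2 * r) (w : Pol d) {M : ℝ}
    (hM : ∀ n ≤ d + 1, ∀ γ : List (Fin d), γ.length = n → nrm D (Dw γ w) ≤ r⁻¹ ^ n * M)
    {x : Euc d} (hx : x ∈ D) :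
    √(volume.real D) * |ev x w| ≤ (∑ j ∈ Finset.range (d + 2), (2 * d : ℝ) ^ j) * M := by
  set V := volume.real D with hV
  have hV0 : 0 ≤ V := measureReal_nonneg
  have hM0 : 0 ≤ M := by simpa using (nrm_nonneg _).trans (hM 0 (by omega) [] rfl)
  have hterm : ∀ j ≤ d + 1, (2 * r) ^ j * ∫ z in D, absD j w z ≤ (2 * d) ^ j * (√V * M) := by
    intro j hj
    refine (mul_le_mul_of_nonneg_left (setIntegral_absD_le hD j w (hM j hj))
      (by positivity)).trans (le_of_eq ?_)
    rw [mul_pow, mul_pow, inv_pow]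
    field_simp
    rw [mul_comm]
  have h1 : |∫ z in D, tay x w (d + 1) 1 z| ≤ ∑ j ∈ Finset.range (d + 1), (2 * d) ^ j * (√V * M) := by
    refine abs_integral_le_integral_abs.trans (le_trans (setIntegral_mono_on (g := fun z =>
      ∑ j ∈ Finset.range (d + 1), (2 * r) ^ j * absD j w z) ?_ ?_ hD.measurableSet ?_) ?_)
    · refine hD.integrableOn (Continuous.abs (continuous_finsetSum _ fun j _ => Continuous.mul
        (by fun_prop) ((continuous_dirD x j w).comp (Continuous.prodMk_right 1))))
    · exact hD.integrableOn (continuous_finsetSum _ fun j _ =>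
        continuous_const.mul (continuous_absD j w))
    · intro z hz
      refine (Finset.abs_sum_le_sum_abs _ _).trans (Finset.sum_le_sum fun j _ => ?_)
      rw [abs_mul]
      have hc : |(-1 : ℝ) ^ j / j.factorial| ≤ 1 := by
        rw [abs_div, abs_pow, abs_neg, abs_one, one_pow, Nat.abs_cast]
        exact div_le_one_of_le₀ (by exact_mod_cast j.factorial_pos) (by positivity)
      refine (mul_le_of_le_one_left (abs_nonneg _) hc).trans ?_
      have := abs_dirD_le (hdiam x hx z hz) j w (x + (1 : ℝ) • (z - x))
      rwa [one_smul, add_sub_cancel] at this ⊢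
    · have hi : ∀ j ∈ Finset.range (d + 1), IntegrableOn
          (fun z => (2 * r) ^ j * absD j w z) D := fun j _ =>
        hD.integrableOn (continuous_const.mul (continuous_absD j w))
      rw [integral_finsetSum _ hi]
      refine Finset.sum_le_sum fun j hj => ?_
      rw [integral_const_mul]
      exact hterm j (by have := Finset.mem_range.1 hj; omega)
  have h2 : ∀ s ∈ Ico (0 : ℝ) 1, ‖∫ z in D, (-s) ^ d / d.factorial *
      dirD (z - x) (d + 1) w (x + s • (z - x))‖ ≤ (2 * d) ^ (d + 1) * (√V * M) := by
    rintro s ⟨hs0, hs1⟩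
    rcases hs0.eq_or_lt with rfl | hs
    · rw [neg_zero, zero_pow (by omega)]
      simp only [zero_div, zero_mul, integral_zero, norm_zero]
      positivity
    refine (norm_integral_le_integral_norm _).trans (le_trans (setIntegral_mono_on (g := fun z =>
      s ^ d * ((2 * r) ^ (d + 1) * absD (d + 1) w (x + s • (z - x)))) ?_ ?_ hD.measurableSet ?_) ?_)
    · exact hD.integrableOn (Continuous.norm (continuous_const.mul
        ((continuous_dirD x (d + 1) w).comp (Continuous.prodMk_right s))))
    · exact hD.integrableOn (continuous_const.mul (continuous_const.mul
        ((continuous_absD (d + 1) w).comp (by fun_prop))))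
    · intro z hz
      rw [Real.norm_eq_abs, abs_mul]
      refine mul_le_mul ?_ (abs_dirD_le (hdiam x hx z hz) _ _ _) (abs_nonneg _) (by positivity)
      rw [abs_div, abs_pow, abs_neg, abs_of_pos hs, Nat.abs_cast]
      exact div_le_self (by positivity) (by exact_mod_cast d.factorial_pos)
    · rw [integral_const_mul, integral_const_mul]
      have k1 := setIntegral_comp_segment_le hD (continuous_absD (d + 1) w)
        (absD_nonneg (d + 1) w) hx hs hs1.le
      have k2 := mul_le_mul_of_nonneg_left k1 (show 0 ≤ (2 * r) ^ (d + 1) by positivity)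
      have k3 := hterm (d + 1) le_rfl
      linarith
  have h3 := norm_image_sub_le_of_norm_deriv_le_segment_01' (fun s _ =>
    (hasDerivAt_integral_tay hD x w d s).hasDerivWithinAt) h2
  have h4 : ∫ z in D, tay x w (d + 1) 0 z = V * ev x w := by
    have : ∀ z, tay x w (d + 1) 0 z = ev x w := fun z => by
      rw [tay, Finset.sum_eq_single 0]
      · simp [dirD]
      · intro j _ hj; rw [neg_zero, zero_pow hj]; simp
      · simp
    simp only [this]
    rw [setIntegral_const, smul_eq_mul]
  rw [h4, Real.norm_eq_abs] at h3
  have h5 : V * |ev x w| ≤ √V * ((∑ j ∈ Finset.range (d + 2), (2 * d : ℝ) ^ j) * M) := by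
    rw [← abs_of_nonneg hV0, ← abs_mul, abs_of_nonneg hV0]
    have t := abs_sub_abs_le_abs_sub (V * ev x w) (∫ z in D, tay x w (d + 1) 1 z)
    rw [abs_sub_comm] at t
    rw [← Finset.sum_mul] at h1
    rw [Finset.sum_range_succ _ (d + 1)]
    linarith
  rcases (Real.sqrt_nonneg V).eq_or_lt with h0 | h0
  · rw [← h0, zero_mul]; positivity
  · refine le_of_mul_le_mul_left ?_ h0
    rw [← mul_assoc, Real.mul_self_sqrt hV0]
    exact h5

end Sobolev

end WeakType

namespace WeakType

section Oscillation

variable {d : ℕ}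

/-- The volume of the unit ball. -/
noncomputable def vol1 (d : ℕ) : ℝ := volume.real (ball (0 : Euc d) 1)

lemma vol1_pos (d : ℕ) : 0 < vol1 d :=
  ENNReal.toReal_pos (measure_ball_pos volume _ one_pos).ne' measure_ball_lt_top.ne

lemma volume_real_ball (x : Euc d) {r : ℝ} (hr : 0 < r) :
    volume.real (ball x r) = r ^ d * vol1 d := by
  rw [vol1, Measure.real, Measure.addHaar_ball_of_pos volume x hr, finrank_euclideanSpace_fin,
    ENNReal.toReal_mul, ENNReal.toReal_ofReal (by positivity), Measure.real]

lemma volume_real_cut_le {y : Euc d} (hy : ‖y‖ ≤ 1) {r : ℝ} (hr : 0 < r) (hr2 : r ≤ 2) :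
    (r / 2) ^ d * vol1 d ≤ volume.real (cut y r) := by
  rw [← volume_real_ball ((1 - r / 2) • y) (half_pos hr)]
  refine measureReal_mono (subset_inter (ball_subset_ball' ?_) (ball_subset_ball' ?_))
    ((measure_mono inter_subset_left).trans_lt measure_ball_lt_top).ne
  · rw [dist_zero_right, norm_smul, Real.norm_eq_abs, abs_of_nonneg (by linarith)]
    nlinarith [norm_nonneg y]
  · have : (1 - r / 2) • y - y = (-(r / 2)) • y := by rw [sub_smul, one_smul, neg_smul]; abel
    rw [dist_eq_norm, this, norm_smul, norm_neg, Real.norm_eq_abs, abs_of_pos (half_pos hr)]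
    nlinarith [norm_nonneg y]

lemma norm_gradL_le (p : Pol d) (x : Euc d) : ‖gradL p x‖ ≤ ∑ i, |ev x (pd i p)| := by
  refine (norm_sum_le _ _).trans (Finset.sum_le_sum fun i _ => ?_)
  rw [norm_smul, Real.norm_eq_abs]
  refine mul_le_of_le_one_right (abs_nonneg _) (ContinuousLinearMap.opNorm_le_bound _ zero_le_one
    fun z => ?_)
  rw [one_mul]
  exact PiLp.norm_apply_le z i

lemma abs_ev_sub_le {D : Set (Euc d)} (hD : Convex ℝ D) (p : Pol d) {M : ℝ}
    (h : ∀ x ∈ D, ∀ i, |ev x (pd i p)| ≤ M) {x z : Euc d} (hx : x ∈ D) (hz : z ∈ D) :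
    |ev x p - ev z p| ≤ d * M * ‖x - z‖ := by
  refine Convex.norm_image_sub_le_of_norm_hasFDerivWithin_le (f := fun y : Euc d => ev y p)
    (f' := gradL p) (fun y _ => (hasFDerivAt_ev p y).hasFDerivWithinAt) (fun y hy => ?_) hD hz hx
  refine (norm_gradL_le p y).trans ((Finset.sum_le_sum fun i _ => h y hy i).trans (le_of_eq ?_))
  simp

lemma Annular.hess_sub_le (hd : 1 ≤ d) {lam Lam : ℝ} (hlam : 0 < lam) (hLam : 0 < Lam) :
    ∃ C : ℝ, 0 ≤ C ∧ ∀ A : Matrix (Fin d) (Fin d) ℝ, Ell lam Lam A → ∀ (q : Pol d) (y : Euc d)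
      (ρ Φ ε : ℝ), Annular (LA A (om * q)) (d + 3) y ρ Φ ε → ∀ k l : Fin d,
      ∀ x ∈ cut y (ρ / (8 * 2 ^ (d + 3))), ∀ z ∈ cut y (ρ / (8 * 2 ^ (d + 3))),
        √(ρ ^ d) * |ev x (pd k (pd l (om * q))) - ev z (pd k (pd l (om * q)))|
          ≤ C * (ρ⁻¹ ^ 2 * (ρ * Φ + ε)) * ‖x - z‖ := by
  obtain ⟨C, hC, h⟩ := Annular.nrm_Dw_le hd hlam hLam (d + 3)
  set κ : ℝ := 8 * 2 ^ (d + 3) with hκ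
  have hκ1 : 1 ≤ κ := by
    have : (1 : ℝ) ≤ 2 ^ (d + 3) := one_le_pow₀ (by norm_num)
    linarith
  have hv := vol1_pos d
  set S : ℝ := ∑ j ∈ Finset.range (d + 2), (2 * d : ℝ) ^ j with hS
  have hS0 : 0 ≤ S := by positivity
  set c : ℝ := √((1 / (2 * κ)) ^ d * vol1 d) with hc
  have hc0 : 0 < c := Real.sqrt_pos.2 (by positivity)
  refine ⟨d * (S * C / c), by positivity, fun A hA q y ρ Φ ε H k l => ?_⟩
  have hρ := H.rpos
  have hr : 0 < ρ / κ := by positivity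
  have hrρ : ρ / κ ≤ ρ := div_le_self hρ.le hκ1
  set M := C * (ρ⁻¹ ^ 2 * (ρ * Φ + ε)) with hM
  have hΦ : 0 ≤ Φ := (nrm_nonneg _).trans H.bound
  have hε := H.epos
  have hM0 : 0 ≤ M := by positivity
  have hvol : c * √(ρ ^ d) ≤ √(volume.real (cut y (ρ / κ))) := by
    rw [hc, ← Real.sqrt_mul (by positivity)]
    refine Real.sqrt_le_sqrt (le_trans (le_of_eq ?_)
      (volume_real_cut_le H.ynorm hr (by linarith [H.rle])))
    rw [div_pow, div_pow, div_pow, one_pow, mul_pow]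
    field_simp
  have key : ∀ x ∈ cut y (ρ / κ), ∀ i,
      |ev x (pd i (pd k (pd l (om * q))))| ≤ S * M / c / √(ρ ^ d) := by
    intro x hx i
    have := sobolev hd (CDom.cut y (ρ / κ)) hr (fun x hx z hz => ?_) (pd i (pd k (pd l (om * q))))
      (M := M) (fun n hn γ hγ => ?_) hx
    · rw [div_div, le_div_iff₀ (by positivity), mul_comm]
      exact (mul_le_mul_of_nonneg_right hvol (abs_nonneg _)).trans this
    · have h1 := mem_ball.1 hx.2
      have h2 := mem_ball.1 hz.2
      rw [← dist_eq_norm]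
      linarith [dist_triangle_right z x y]
    · have e : Dw γ (pd i (pd k (pd l (om * q)))) = Dw (l :: k :: i :: γ) (om * q) := rfl
      rw [e]
      refine (h A hA q y ρ Φ ε H (n + 1) (by omega) _ (by simp [hγ])).trans ?_
      have : C * (ρ⁻¹ ^ (n + 1 + 1) * (ρ * Φ + ε)) = ρ⁻¹ ^ n * M := by rw [hM]; ring
      rw [this]
      have h3 : ρ⁻¹ ≤ (ρ / κ)⁻¹ := inv_anti₀ hr hrρ
      exact mul_le_mul_of_nonneg_right (pow_le_pow_left₀ (by positivity) h3 n) hM0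
  intro x hx z hz
  have := abs_ev_sub_le (CDom.cut y (ρ / κ)).convex _ key hx hz
  have hsq : 0 < √(ρ ^ d) := Real.sqrt_pos.2 (by positivity)
  refine (mul_le_mul_of_nonneg_left this hsq.le).trans (le_of_eq ?_)
  rw [hM]
  field_simp

end Oscillation

end WeakType

namespace WeakType

section Landau

open Filter Topology

variable {d : ℕ}

/-- `p` is the convolution of `ψ` with the polynomial `L`. -/
def IsConv (ψ : Euc d → ℝ) (L p : Pol d) : Prop := ∀ x, ev x p = ∫ z, ψ z * ev (x - z) L

lemma continuous_ev_sub (x : Euc d) (L : Pol d) : Continuous fun z : Euc d => ev (x - z) L :=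
  (continuous_ev L).comp (continuous_const.sub continuous_id)

lemma integrable_mul_ev {ψ : Euc d → ℝ} (hψ : Continuous ψ) (hs : HasCompactSupport ψ) (x : Euc d)
    (L : Pol d) : Integrable fun z => ψ z * ev (x - z) L :=
  (hψ.mul (continuous_ev_sub x L)).integrable_of_hasCompactSupport hs.mul_right

lemma IsConv.mul_X {ψ : Euc d → ℝ} (hψ : Continuous ψ) (hs : HasCompactSupport ψ) {L p p' : Pol d}
    (n : Fin d) (h : IsConv ψ L p) (h' : IsConv (fun z => ψ z * z n) L p') :
    IsConv ψ (L * MvPolynomial.X n) (p * MvPolynomial.X n - p') := by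
  intro x
  have hc : Continuous fun z : Euc d => ψ z * z n := by fun_prop
  rw [map_sub, map_mul, h x, h' x, MvPolynomial.eval_X, ← integral_mul_const,
    ← integral_sub ((integrable_mul_ev hψ hs x L).mul_const _)
      (integrable_mul_ev hc hs.mul_right x L)]
  refine integral_congr_ae (Eventually.of_forall fun z => ?_)
  simp only [map_mul, MvPolynomial.eval_X, PiLp.sub_apply]
  ring

lemma IsConv.add {ψ : Euc d → ℝ} (hψ : Continuous ψ) (hs : HasCompactSupport ψ)
    {L L' p p' : Pol d} (h : IsConv ψ L p) (h' : IsConv ψ L' p') :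
    IsConv ψ (L + L') (p + p') := by
  intro x
  rw [map_add, h x, h' x, ← integral_add (integrable_mul_ev hψ hs x L)
      (integrable_mul_ev hψ hs x L')]
  exact integral_congr_ae (Eventually.of_forall fun z => by simp only [map_add]; ring)

lemma IsConv.zero (ψ : Euc d → ℝ) : IsConv ψ 0 0 := fun x => by simp

lemma exists_isConv_pd (L : Pol d) : ∀ {ψ : Euc d → ℝ}, Continuous ψ → HasCompactSupport ψ →
    ∃ p : Pol d, IsConv ψ L p ∧ ∀ i, IsConv ψ (pd i L) (pd i p) := by
  induction L using MvPolynomial.induction_on with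
  | C a =>
    intro ψ hψ hs
    refine ⟨MvPolynomial.C (∫ z, ψ z * a), fun x => by simp, fun i => ?_⟩
    rw [MvPolynomial.pderiv_C, MvPolynomial.pderiv_C]
    exact IsConv.zero ψ
  | add L L' h h' =>
    intro ψ hψ hs
    obtain ⟨p, hp, hp'⟩ := h hψ hs
    obtain ⟨q, hq, hq'⟩ := h' hψ hs
    refine ⟨p + q, hp.add hψ hs hq, fun i => ?_⟩
    rw [map_add, map_add]
    exact (hp' i).add hψ hs (hq' i)
  | mul_X L n h =>
    intro ψ hψ hs
    have hc : Continuous fun z : Euc d => ψ z * z n := by fun_prop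
    obtain ⟨p, hp, hp'⟩ := h hψ hs
    obtain ⟨q, hq, hq'⟩ := h hc hs.mul_right
    refine ⟨p * MvPolynomial.X n - q, hp.mul_X hψ hs n hq, fun i => ?_⟩
    have e : ∀ r : Pol d, pd i (r * MvPolynomial.X n)
        = pd i r * MvPolynomial.X n + r * MvPolynomial.C (if n = i then 1 else 0) := by
      intro r
      rw [Derivation.leibniz, MvPolynomial.pderiv_X, smul_eq_mul, smul_eq_mul, add_comm,
        mul_comm (MvPolynomial.X n)]
      congr 2
      rw [Pi.single_apply]
      by_cases h : n = i
      · simp [h]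
      · rw [if_neg h, if_neg h, map_zero]
    rw [map_sub, e, e, add_sub_right_comm]
    refine ((hp' i).mul_X hψ hs n (hq' i)).add hψ hs fun x => ?_
    simp only [map_mul, MvPolynomial.eval_C, hp x, ← integral_mul_const, mul_assoc]

lemma IsConv.Dw {ψ : Euc d → ℝ} (hψ : Continuous ψ) (hs : HasCompactSupport ψ) {L p : Pol d}
    (h : IsConv ψ L p) (β : List (Fin d)) : IsConv ψ (Dw β L) (Dw β p) := by
  induction β generalizing L p with
  | nil => exact h
  | cons a β ih =>
    obtain ⟨p', hp', hpd⟩ := exists_isConv_pd L hψ hs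
    have e : p = p' := sub_eq_zero.1 (eq_zero_of_ev_ball (y := 0) one_pos fun x _ => by
      rw [map_sub, h x, hp' x, sub_self])
    rw [Dw_cons, Dw_cons, e]
    exact ih (hpd a)

/-- The base of the Landau kernel. -/
noncomputable def lan (d : ℕ) (R : ℝ) : Pol d :=
  1 - MvPolynomial.C (R⁻¹ ^ 2) * ∑ i, MvPolynomial.X i ^ 2

lemma ev_lan (R : ℝ) (x : Euc d) : ev x (lan d R) = 1 - R⁻¹ ^ 2 * ‖x‖ ^ 2 := by
  simp [lan, EuclideanSpace.real_norm_sq_eq]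

lemma ev_lan_nonneg {R : ℝ} (hR : 0 < R) {x : Euc d} (hx : ‖x‖ ≤ R) : 0 ≤ ev x (lan d R) := by
  rw [ev_lan, ← mul_pow, sub_nonneg]
  refine pow_le_one₀ (by positivity) ?_
  rw [inv_mul_le_iff₀ hR, mul_one]
  exact hx

lemma abs_Dw_pow_le (P : Pol d) (R : ℝ) (β : List (Fin d)) : ∀ g : Pol d, ∃ C : ℝ, 0 ≤ C ∧
    ∀ n : ℕ, ∀ w : Euc d, ‖w‖ ≤ R → |ev w (Dw β (g * P ^ (n + β.length)))|
      ≤ C * ((n + β.length : ℕ) : ℝ) ^ β.length * |ev w P| ^ n := by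
  induction β with
  | nil =>
    intro g
    obtain ⟨C, hC⟩ := (isCompact_closedBall (0 : Euc d) R).exists_bound_of_continuousOn
      (continuous_ev g).continuousOn
    refine ⟨max C 0, le_max_right _ _, fun n w hw => ?_⟩
    simp only [Dw_nil, List.length_nil, add_zero, map_mul, map_pow, abs_mul, abs_pow, pow_zero,
      mul_one]
    exact mul_le_mul_of_nonneg_right
      ((hC w (mem_closedBall_zero_iff.2 hw)).trans (le_max_left _ _)) (by positivity)
  | cons a β ih =>
    intro g
    obtain ⟨C1, hC1, h1⟩ := ih (pd a g * P)
    obtain ⟨C2, hC2, h2⟩ := ih (g * pd a P)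
    refine ⟨C1 + C2, by positivity, fun n w hw => ?_⟩
    set m := β.length with hm
    have e : pd a (g * P ^ (n + (a :: β).length)) = (pd a g * P) * P ^ (n + m)
        + ((n + m + 1 : ℕ) : ℝ) • ((g * pd a P) * P ^ (n + m)) := by
      rw [List.length_cons, ← hm, ← add_assoc, Derivation.leibniz, Derivation.leibniz_pow,
        Nat.add_sub_cancel, Nat.cast_smul_eq_nsmul]
      simp only [smul_eq_mul, nsmul_eq_mul, pow_succ]
      ring
    have hN : ((n + m : ℕ) : ℝ) ≤ ((n + m + 1 : ℕ) : ℝ) := by exact_mod_cast Nat.le_succ _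
    have hN1 : (1 : ℝ) ≤ ((n + m + 1 : ℕ) : ℝ) := by exact_mod_cast Nat.le_add_left 1 _
    rw [Dw_cons, e, map_add, map_smul, map_add, ev_smul, List.length_cons, ← hm, ← add_assoc]
    set N : ℝ := ((n + m + 1 : ℕ) : ℝ) with hNdef
    have hp : ((n + m : ℕ) : ℝ) ^ m ≤ N ^ m := pow_le_pow_left₀ (by positivity) hN m
    have hp' : N ^ m ≤ N ^ (m + 1) := pow_le_pow_right₀ hN1 (Nat.le_succ m)
    refine (abs_add_le _ _).trans ?_
    rw [abs_mul, abs_of_nonneg (by positivity : 0 ≤ N)]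
    calc _ ≤ C1 * N ^ (m + 1) * |ev w P| ^ n + N * (C2 * N ^ m * |ev w P| ^ n) := by
          refine add_le_add ((h1 n w hw).trans ?_) (mul_le_mul_of_nonneg_left
            ((h2 n w hw).trans ?_) (by positivity))
          · exact mul_le_mul_of_nonneg_right (mul_le_mul_of_nonneg_left (hp.trans hp') hC1)
              (by positivity)
          · exact mul_le_mul_of_nonneg_right (mul_le_mul_of_nonneg_left hp hC2) (by positivity)
      _ = _ := by rw [pow_succ]; ring

end Landau

end WeakType

namespace WeakType

section Approximation

open Filter Topology

variable {d : ℕ}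

lemma abs_integral_le_of_abs_le {μ : Measure (Euc d)} {f g : Euc d → ℝ} (hg : Integrable g μ)
    (h : ∀ᵐ x ∂μ, |f x| ≤ g x) : |∫ x, f x ∂μ| ≤ ∫ x, g x ∂μ :=
  norm_integral_le_of_norm_le (f := f) hg h

/-- The normalising factor of the Landau kernel. -/
noncomputable def lanC (d : ℕ) (R : ℝ) (n : ℕ) : ℝ :=
  (∫ w in closedBall (0 : Euc d) R, ev w (lan d R) ^ n)⁻¹

lemma lanC_nonneg {R : ℝ} (hR : 0 < R) (n : ℕ) : 0 ≤ lanC d R n :=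
  inv_nonneg.2 (setIntegral_nonneg measurableSet_closedBall fun _ hw =>
    pow_nonneg (ev_lan_nonneg hR (mem_closedBall_zero_iff.1 hw)) n)

lemma integrableOn_lan (R : ℝ) (n : ℕ) :
    IntegrableOn (fun w : Euc d => ev w (lan d R) ^ n) (closedBall 0 R) :=
  ((continuous_ev _).pow n).continuousOn.integrableOn_compact (isCompact_closedBall 0 R)

lemma lan_integral_ge {R s : ℝ} (hs : 0 < s) (hsR : s ≤ R) (n : ℕ) :
    s ^ d * vol1 d * (1 - R⁻¹ ^ 2 * s ^ 2) ^ n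
      ≤ ∫ w in closedBall (0 : Euc d) R, ev w (lan d R) ^ n := by
  have hR := hs.trans_le hsR
  have hsub : ball (0 : Euc d) s ⊆ closedBall 0 R :=
    ball_subset_closedBall.trans (closedBall_subset_closedBall hsR)
  calc _ = ∫ _ in ball (0 : Euc d) s, (1 - R⁻¹ ^ 2 * s ^ 2) ^ n := by
        rw [setIntegral_const, volume_real_ball _ hs, smul_eq_mul]
    _ ≤ ∫ w in ball (0 : Euc d) s, ev w (lan d R) ^ n := by
        refine setIntegral_mono_on (integrableOn_const measure_ball_lt_top.ne)
          ((integrableOn_lan R n).mono_set hsub) measurableSet_ball fun w hw => ?_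
        have h1 : R⁻¹ ^ 2 * s ^ 2 ≤ 1 := by
          rw [← mul_pow]
          refine pow_le_one₀ (by positivity) ?_
          rw [inv_mul_le_iff₀ hR, mul_one]
          exact hsR
        refine pow_le_pow_left₀ (by linarith) ?_ n
        rw [ev_lan]
        have := (mem_ball_zero_iff.1 hw).le
        gcongr
    _ ≤ _ := setIntegral_mono_set (integrableOn_lan R n)
        ((ae_restrict_iff' measurableSet_closedBall).2 (Eventually.of_forall fun w hw =>
          pow_nonneg (ev_lan_nonneg hR (mem_closedBall_zero_iff.1 hw)) n))
        hsub.eventuallyLE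

lemma lanC_mul {R : ℝ} (hR : 0 < R) (n : ℕ) :
    lanC d R n * ∫ w in closedBall (0 : Euc d) R, ev w (lan d R) ^ n = 1 := by
  refine inv_mul_cancel₀ (ne_of_gt ?_)
  refine lt_of_lt_of_le ?_ (lan_integral_ge (half_pos hR) (half_le_self hR.le) n)
  have h : 1 - R⁻¹ ^ 2 * (R / 2) ^ 2 = 3 / 4 := by field_simp; norm_num
  rw [h]
  have := vol1_pos d
  positivity

lemma isConv_lan_eq {ψ : Euc d → ℝ} {R : ℝ} (h0 : ∀ z, R - 1 < ‖z‖ → ψ z = 0) {n : ℕ} {p : Pol d}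
    (hp : IsConv ψ (lanC d R n • lan d R ^ n) p) {x : Euc d} (hx : ‖x‖ ≤ 1) :
    ev x p = lanC d R n * ∫ w in closedBall (0 : Euc d) R, ev w (lan d R) ^ n * ψ (x - w) := by
  rw [hp x, ← integral_sub_left_eq_self _ volume x, setIntegral_eq_integral_of_forall_compl_eq_zero,
    ← integral_const_mul]
  · refine integral_congr_ae (Eventually.of_forall fun w => ?_)
    simp only [sub_sub_cancel, ev_smul, map_pow]
    ring
  · intro w hw
    rw [h0, mul_zero]
    rw [mem_closedBall_zero_iff, not_le] at hw
    have := norm_sub_norm_le w x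
    rw [norm_sub_rev] at this
    linarith

lemma tendsto_isConv_lan {ψ : Euc d → ℝ} (hψ : Continuous ψ) {R : ℝ} (hR : 0 < R)
    (h0 : ∀ z, R - 1 < ‖z‖ → ψ z = 0) {p : ℕ → Pol d}
    (hp : ∀ n, IsConv ψ (lanC d R n • lan d R ^ n) (p n)) {x : Euc d} (hx : ‖x‖ ≤ 1) :
    Tendsto (fun n => ev x (p n)) atTop (𝓝 (ψ x)) := by
  have := tendsto_setIntegral_pow_smul_of_unique_maximum_of_isCompact_of_continuousOn
    (μ := (volume : Measure (Euc d))) (x₀ := 0) (g := fun w => ψ (x - w))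
    (isCompact_closedBall (0 : Euc d) R)
    (c := fun w => ev w (lan d R)) (continuous_ev _).continuousOn ?_ ?_ ?_ ?_
    (by fun_prop : Continuous fun w => ψ (x - w)).continuousOn
  · simp only [sub_zero, smul_eq_mul] at this
    exact this.congr fun n => (isConv_lan_eq h0 (hp n) hx).symm
  · intro y _ hy
    rw [ev_lan, ev_lan, norm_zero]
    have := norm_pos_iff.2 hy
    have : 0 < R⁻¹ ^ 2 * ‖y‖ ^ 2 := by positivity
    linarith
  · exact fun y hy => ev_lan_nonneg hR (mem_closedBall_zero_iff.1 hy)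
  · rw [ev_lan, norm_zero]; norm_num
  · refine subset_closure (ball_subset_interior_closedBall (mem_ball_self hR))

lemma abs_isConv_lan_le {ψ : Euc d → ℝ} {R : ℝ} (hR : 0 < R)
    (h0 : ∀ z, R - 1 < ‖z‖ → ψ z = 0) {M : ℝ} (hM : ∀ z, |ψ z| ≤ M) {n : ℕ} {p : Pol d}
    (hp : IsConv ψ (lanC d R n • lan d R ^ n) p) {x : Euc d} (hx : ‖x‖ ≤ 1) :
    |ev x p| ≤ M := by
  rw [isConv_lan_eq h0 hp hx, abs_mul, abs_of_nonneg (lanC_nonneg hR n)]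
  calc _ ≤ lanC d R n * ∫ w in closedBall (0 : Euc d) R, ev w (lan d R) ^ n * M := by
        refine mul_le_mul_of_nonneg_left ?_ (lanC_nonneg hR n)
        refine abs_integral_le_of_abs_le ((integrableOn_lan R n).mul_const M)
          ((ae_restrict_iff' measurableSet_closedBall).2 (Eventually.of_forall fun w hw => ?_))
        have h := pow_nonneg (ev_lan_nonneg hR (mem_closedBall_zero_iff.1 hw)) n
        rw [abs_mul, abs_of_nonneg h]
        exact mul_le_mul_of_nonneg_left (hM _) h
    _ = M := by rw [integral_mul_const, ← mul_assoc, lanC_mul hR, one_mul]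

lemma abs_Dw_isConv_lan_le {ψ : Euc d → ℝ} (hψ : Continuous ψ) (hs : HasCompactSupport ψ)
    {R : ℝ} {s : ℝ} (hs0 : 0 < s) (hsR : 2 * s ≤ R)
    (h0 : ∀ z, R - 1 < ‖z‖ → ψ z = 0) {y : Euc d} (hy : ∀ z ∈ ball y (2 * s), ψ z = 0)
    {p : ℕ → Pol d} (hp : ∀ n, IsConv ψ (lanC d R n • lan d R ^ n) (p n))
    (β : List (Fin d)) {ε : ℝ} (hε : 0 < ε) :
    ∀ᶠ n in atTop, ∀ x ∈ cut y s, |ev x (Dw β (p n))| ≤ ε := by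
  have hR : 0 < R := by linarith
  obtain ⟨C, hC, hb⟩ := abs_Dw_pow_le (lan d R) R β 1
  set m := β.length with hm
  set θ : ℝ := 1 - R⁻¹ ^ 2 * s ^ 2 with hθ
  set θ' : ℝ := 1 - R⁻¹ ^ 2 * (s / 2) ^ 2 with hθ'
  have hRs : R⁻¹ ^ 2 * s ^ 2 ≤ 1 / 4 := by
    rw [← mul_pow]
    have : R⁻¹ * s ≤ 1 / 2 := by rw [inv_mul_le_iff₀ hR]; linarith
    nlinarith [show 0 ≤ R⁻¹ * s by positivity]
  have hRs0 : 0 < R⁻¹ ^ 2 * s ^ 2 := by positivity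
  have hθ0 : 0 < θ := by linarith
  have hθθ : θ < θ' := by
    have : R⁻¹ ^ 2 * (s / 2) ^ 2 = R⁻¹ ^ 2 * s ^ 2 / 4 := by ring
    linarith
  have hθ'0 := hθ0.trans hθθ
  set v := (s / 2) ^ d * vol1 d with hv
  have hv0 : 0 < v := mul_pos (by positivity) (vol1_pos d)
  set N1 := ∫ z, |ψ z| with hN1
  have hlim : Tendsto (fun n : ℕ => N1 * (v⁻¹ * C * θ⁻¹ ^ m) * ((n : ℝ) ^ m * (θ / θ') ^ n)) atTop
      (𝓝 0) := by
    have := tendsto_pow_const_mul_const_pow_of_abs_lt_one m (r := θ / θ')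
      (by rw [abs_of_pos (by positivity), div_lt_one hθ'0]; exact hθθ)
    simpa using this.const_mul (N1 * (v⁻¹ * C * θ⁻¹ ^ m))
  filter_upwards [hlim.eventually (gt_mem_nhds hε), eventually_ge_atTop m] with n hn hnm x hx
  refine le_trans ?_ hn.le
  obtain ⟨k, rfl⟩ := Nat.exists_eq_add_of_le' hnm
  rw [(hp (k + m)).Dw hψ hs β x]
  have hc : lanC d R (k + m) ≤ v⁻¹ * θ'⁻¹ ^ (k + m) := by
    rw [inv_pow, ← mul_inv]
    exact inv_anti₀ (by positivity) (lan_integral_ge (half_pos hs0) (by linarith) _)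
  have hpt : ∀ z, |ψ z * ev (x - z) (Dw β (lanC d R (k + m) • lan d R ^ (k + m)))|
      ≤ |ψ z| * ((v⁻¹ * C * θ⁻¹ ^ m) * (((k + m : ℕ) : ℝ) ^ m * (θ / θ') ^ (k + m))) := by
    intro z
    rw [abs_mul]
    by_cases hz : ψ z = 0
    · simp [hz]
    refine mul_le_mul_of_nonneg_left ?_ (abs_nonneg _)
    have hz1 : ‖z‖ ≤ R - 1 := by by_contra h; exact hz (h0 z (not_le.1 h))
    have hz2 : 2 * s ≤ ‖z - y‖ := by
      by_contra h; exact hz (hy z (by rw [mem_ball, dist_eq_norm]; exact not_le.1 h))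
    have hx1 : ‖x‖ < 1 := mem_ball_zero_iff.1 hx.1
    have hx2 : ‖x - y‖ < s := by rw [← dist_eq_norm]; exact hx.2
    have hw1 : ‖x - z‖ ≤ R := (norm_sub_le _ _).trans (by linarith)
    have hw2 : s ≤ ‖x - z‖ := by
      have : ‖z - y‖ ≤ ‖x - z‖ + ‖x - y‖ := by
        rw [norm_sub_rev x z]
        simpa using norm_add_le (z - x) (x - y)
      linarith
    have hP : |ev (x - z) (lan d R)| ≤ θ := by
      rw [abs_of_nonneg (ev_lan_nonneg hR hw1), ev_lan, hθ]
      gcongr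
    have := hb k (x - z) hw1
    rw [one_mul] at this
    rw [map_smul, ev_smul, abs_mul, abs_of_nonneg (lanC_nonneg hR _)]
    calc _ ≤ (v⁻¹ * θ'⁻¹ ^ (k + m)) * (C * ((k + m : ℕ) : ℝ) ^ m * θ ^ k) := by
          refine mul_le_mul hc (this.trans ?_) (abs_nonneg _) (by positivity)
          exact mul_le_mul_of_nonneg_left (pow_le_pow_left₀ (abs_nonneg _) hP k) (by positivity)
      _ = _ := by
          rw [div_pow, pow_add θ, inv_pow, inv_pow]
          field_simp
  refine (abs_integral_le_of_abs_le ((hψ.abs.integrable_of_hasCompactSupport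
    hs.abs).mul_const _) (Eventually.of_forall hpt)).trans (le_of_eq ?_)
  rw [integral_mul_const, mul_assoc N1]

/-- Approximation of a continuous function by polynomials which are small, together with their
derivatives, away from its support. -/
lemma exists_seq_approx {ψ : Euc d → ℝ} (hψ : Continuous ψ) (hs : HasCompactSupport ψ)
    {y : Euc d} {s : ℝ} (hs0 : 0 < s) (hy : ∀ z ∈ ball y (2 * s), ψ z = 0) (K : ℕ) :
    ∃ p : ℕ → Pol d, (∀ x, ‖x‖ ≤ 1 → Tendsto (fun n => ev x (p n)) atTop (𝓝 (ψ x))) ∧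
      (∃ M, ∀ n x, ‖x‖ ≤ 1 → |ev x (p n)| ≤ M) ∧
      ∀ ε > 0, ∀ᶠ n in atTop, ∀ x ∈ cut y s, ∀ β : List (Fin d), β.length ≤ K →
        |ev x (Dw β (p n))| ≤ ε := by
  obtain ⟨R1, hR1⟩ := hs.isCompact.isBounded.subset_closedBall (0 : Euc d)
  obtain ⟨M, hM⟩ := hψ.bounded_above_of_compact_support hs
  set R := |R1| + 1 + 2 * s with hRdef
  have hR : 0 < R := by positivity
  have h0 : ∀ z, R - 1 < ‖z‖ → ψ z = 0 := by
    intro z hz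
    refine image_eq_zero_of_notMem_tsupport fun h => ?_
    have := mem_closedBall_zero_iff.1 (hR1 h)
    linarith [le_abs_self R1]
  choose p hp _ using fun n => exists_isConv_pd (lanC d R n • lan d R ^ n) hψ hs
  refine ⟨p, fun x hx => tendsto_isConv_lan hψ hR h0 hp hx,
    ⟨M, fun n x hx => abs_isConv_lan_le hR h0 hM (hp n) hx⟩, fun ε hε => ?_⟩
  have := (eventually_all_finite (List.finite_length_le (Fin d) K)).2 fun β _ =>
    abs_Dw_isConv_lan_le hψ hs hs0 (by linarith [abs_nonneg R1]) h0 hy hp β hε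
  filter_upwards [this] with n hn x hx β hβ
  exact hn β hβ x hx

end Approximation

end WeakType

namespace WeakType

section LTwo

open Filter Topology

variable {d : ℕ}

/-- Lebesgue measure on the unit ball. -/
noncomputable abbrev muB (d : ℕ) : Measure (Euc d) := volume.restrict (ball (0 : Euc d) 1)

/-- Square integrable functions on the unit ball. -/
noncomputable abbrev H2 (d : ℕ) := Lp ℝ 2 (muB d)

instance isFiniteMeasure_muB (d : ℕ) : IsFiniteMeasure (muB d) :=
  ⟨by rw [Measure.restrict_apply_univ]; exact measure_ball_lt_top⟩

lemma ae_muB {P : Euc d → Prop} (h : ∀ x ∈ ball (0 : Euc d) 1, P x) : ∀ᵐ x ∂muB d, P x :=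
  (ae_restrict_iff' measurableSet_ball).2 (Eventually.of_forall h)

lemma memLp_of_continuous {g : Euc d → ℝ} (hg : Continuous g) (p : ENNReal) :
    MemLp g p (muB d) := by
  obtain ⟨C, hC⟩ := (isCompact_closedBall (0 : Euc d) 1).exists_bound_of_continuousOn
    hg.continuousOn
  exact MemLp.of_bound hg.aestronglyMeasurable C (ae_muB fun x hx => hC x (ball_subset_closedBall hx))

/-- Polynomials as square integrable functions on the unit ball. -/
noncomputable def toL2 : Pol d →ₗ[ℝ] H2 d where
  toFun p := (memLp_of_continuous (continuous_ev p) 2).toLp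
  map_add' p q := by
    rw [← MemLp.toLp_add]
    congr 1
    funext x
    simp
  map_smul' c p := by
    rw [RingHom.id_apply, ← MemLp.toLp_const_smul]
    congr 1
    funext x
    simp

lemma coeFn_toL2 (p : Pol d) : (toL2 p : Euc d → ℝ) =ᵐ[muB d] fun x => ev x p :=
  (memLp_of_continuous (continuous_ev p) 2).coeFn_toLp

lemma inner_H2 (f g : H2 d) : inner ℝ f g = ∫ x, f x * g x ∂muB d := by
  rw [L2.inner_def]
  simp [mul_comm]

lemma integrable_mul_H2 (f g : H2 d) : Integrable (fun x => f x * g x) (muB d) := by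
  have := L2.integrable_inner (𝕜 := ℝ) f g
  simpa [mul_comm] using this

lemma norm_sq_H2 (f : H2 d) : ‖f‖ ^ 2 = ∫ x, f x ^ 2 ∂muB d := by
  rw [← real_inner_self_eq_norm_sq, inner_H2]
  simp only [pow_two]

lemma norm_toL2 (p : Pol d) : ‖toL2 p‖ = nrm (ball (0 : Euc d) 1) p := by
  rw [nrm, ← Real.sqrt_sq (norm_nonneg (toL2 p)), norm_sq_H2]
  congr 1
  refine integral_congr_ae ?_
  filter_upwards [coeFn_toL2 p] with x hx
  rw [hx, map_pow]

lemma integrable_sq_H2 (f : H2 d) : Integrable (fun x => f x ^ 2) (muB d) := by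
  simpa only [pow_two] using integrable_mul_H2 f f

lemma exists_approx_continuous (φ : H2 d) {y : Euc d} {s : ℝ} (hs : 0 < s)
    (hφ : ∀ᵐ x ∂muB d, x ∈ ball y (4 * s) → φ x = 0) {ε : ℝ} (hε : 0 < ε) :
    ∃ (ψ : Euc d → ℝ) (hψ : Continuous ψ), HasCompactSupport ψ ∧ (∀ z ∈ ball y (2 * s), ψ z = 0) ∧
      ‖φ - (memLp_of_continuous hψ 2).toLp‖ ≤ ε := by
  obtain ⟨g, hgs, hg, hgc, _⟩ := (Lp.memLp φ).exists_hasCompactSupport_eLpNorm_sub_le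
    ENNReal.ofNat_ne_top (ε := ENNReal.ofReal ε) (by simpa using hε)
  set χ : Euc d → ℝ := fun x => min 1 (max 0 ((dist x y - 2 * s) / (2 * s))) with hχ
  have hχc : Continuous χ := by fun_prop
  have hχg : Continuous fun x => χ x * g x := hχc.mul hgc
  refine ⟨fun x => χ x * g x, hχg, hgs.mul_left, fun z hz => ?_, ?_⟩
  · have : (dist z y - 2 * s) / (2 * s) ≤ 0 :=
      div_nonpos_of_nonpos_of_nonneg (by linarith [mem_ball.1 hz]) (by positivity)
    simp [hχ, max_eq_left this]
  · have h1 : φ - (memLp_of_continuous hχg 2).toLp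
        = ((Lp.memLp φ).sub (memLp_of_continuous hχg 2)).toLp := by
      rw [MemLp.toLp_sub (Lp.memLp φ), Lp.toLp_coeFn]
    rw [h1, Lp.norm_toLp]
    refine ENNReal.toReal_le_of_le_ofReal hε.le (le_trans (eLpNorm_mono_ae ?_) hg)
    filter_upwards [hφ] with x hx
    rw [Pi.sub_apply, Pi.sub_apply, Real.norm_eq_abs, Real.norm_eq_abs]
    by_cases hxy : x ∈ ball y (4 * s)
    · rw [hx hxy, zero_sub, zero_sub, abs_neg, abs_neg, abs_mul]
      refine mul_le_of_le_one_left (abs_nonneg _) ?_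
      rw [abs_of_nonneg (le_min zero_le_one (le_max_left _ _))]
      exact min_le_left _ _
    · have h2 : 1 ≤ (dist x y - 2 * s) / (2 * s) := by
        rw [mem_ball, not_lt] at hxy
        rw [le_div_iff₀ (by positivity)]
        linarith
      have : χ x = 1 := by
        simp only [hχ]
        rw [max_eq_right (zero_le_one.trans h2), min_eq_left h2]
      rw [this, one_mul]

lemma exists_approx_pol (φ : H2 d) {y : Euc d} {s : ℝ} (hs : 0 < s)
    (hφ : ∀ᵐ x ∂muB d, x ∈ ball y (4 * s) → φ x = 0) (K : ℕ) {ε : ℝ} (hε : 0 < ε) :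
    ∃ p : Pol d, ‖φ - toL2 p‖ ≤ ε ∧
      ∀ x ∈ cut y s, ∀ β : List (Fin d), β.length ≤ K → |ev x (Dw β p)| ≤ ε := by
  obtain ⟨ψ, hψ, hψs, hψ0, hψφ⟩ := exists_approx_continuous φ hs hφ (half_pos hε)
  obtain ⟨p, hp1, ⟨M, hM⟩, hp3⟩ := exists_seq_approx hψ hψs hs hψ0 K
  set Ψ := (memLp_of_continuous hψ 2).toLp with hΨ
  have hlim : Tendsto (fun n => ‖Ψ - toL2 (p n)‖ ^ 2) atTop (𝓝 0) := by
    have e : ∀ n, ‖Ψ - toL2 (p n)‖ ^ 2 = ∫ x, (ψ x - ev x (p n)) ^ 2 ∂muB d := by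
      intro n
      rw [norm_sq_H2]
      refine integral_congr_ae ?_
      filter_upwards [Lp.coeFn_sub Ψ (toL2 (p n)), coeFn_toL2 (p n),
        (memLp_of_continuous hψ 2).coeFn_toLp] with x h1 h2 h3
      rw [h1, Pi.sub_apply, h2, h3]
    simp only [e]
    have := tendsto_integral_of_dominated_convergence (μ := muB d) (f := fun _ => (0 : ℝ))
      (F := fun n x => (ψ x - ev x (p n)) ^ 2) (fun _ => (M + M) ^ 2)
      (fun n => ((hψ.sub (continuous_ev _)).pow 2).aestronglyMeasurable) (integrable_const _)
      (fun n => ae_muB fun x hx => ?_) (ae_muB fun x hx => ?_)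
    · simpa using this
    · have hx1 : ‖x‖ ≤ 1 := (mem_ball_zero_iff.1 hx).le
      have hψM : |ψ x| ≤ M :=
        le_of_tendsto (hp1 x hx1).abs (Eventually.of_forall fun n => hM n x hx1)
      rw [Real.norm_eq_abs, abs_pow]
      exact pow_le_pow_left₀ (abs_nonneg _)
        ((abs_sub _ _).trans (add_le_add hψM (hM n x hx1))) 2
    · have := (tendsto_const_nhds (x := ψ x)).sub (hp1 x (mem_ball_zero_iff.1 hx).le)
      simpa using this.pow 2
  obtain ⟨n, hn1, hn2⟩ := ((hlim.eventually (gt_mem_nhds (show 0 < (ε / 2) ^ 2 by positivity))).and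
    (hp3 ε hε)).exists
  refine ⟨p n, ?_, hn2⟩
  have h1 : ‖Ψ - toL2 (p n)‖ ≤ ε / 2 := 
    (le_abs_self _).trans (abs_le_of_sq_le_sq hn1.le (by positivity))
  calc ‖φ - toL2 (p n)‖ = ‖(φ - Ψ) + (Ψ - toL2 (p n))‖ := by rw [sub_add_sub_cancel]
    _ ≤ ε / 2 + ε / 2 := (norm_add_le _ _).trans (add_le_add hψφ h1)
    _ = ε := add_halves ε

lemma denseRange_toL2 (hd : 1 ≤ d) : DenseRange (toL2 : Pol d → H2 d) := by
  intro φ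
  rw [Metric.mem_closure_iff]
  intro ε hε
  set y : Euc d := EuclideanSpace.single ⟨0, hd⟩ 5 with hy
  obtain ⟨p, hp, _⟩ := exists_approx_pol φ (y := y) (s := 1) one_pos (ae_muB fun x hx hxy => by
    exfalso
    have h1 : ‖y‖ = 5 := by rw [hy]; simp
    have h2 := mem_ball.1 hxy
    rw [dist_eq_norm, norm_sub_rev] at h2
    linarith [norm_sub_norm_le y x, mem_ball_zero_iff.1 hx]) 0 (half_pos hε)
  exact ⟨toL2 p, ⟨p, rfl⟩, by rw [dist_eq_norm]; linarith⟩

end LTwo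

end WeakType

namespace WeakType

section Operators

open Filter Topology

variable {d : ℕ}

lemma exists_hessian_operators (hd : 1 ≤ d) {lam Lam : ℝ} (hlam : 0 < lam) (hLam : 0 < Lam) :
    ∃ C : ℝ, 0 < C ∧ ∀ A : Matrix (Fin d) (Fin d) ℝ, Ell lam Lam A → ∃ V : Pol d →ₗ[ℝ] Pol d,
      (∀ p, LA A (V p) = p) ∧ (∀ p, ∃ q, V p = om * q) ∧
      ∃ S : Fin d → Fin d → H2 d →L[ℝ] H2 d, ∀ k l,
        (∀ p, S k l (toL2 p) = toL2 (pd k (pd l (V p)))) ∧ ‖S k l‖ ≤ C := by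
  obtain ⟨C, hC, h⟩ := global_H2 hd hlam hLam
  refine ⟨C, hC, fun A hA => ?_⟩
  obtain ⟨V, hV, hVq⟩ := exists_solution hd hlam hA
  refine ⟨V, hV, hVq, ?_⟩
  set f : Fin d → Fin d → Pol d →ₗ[ℝ] H2 d := fun k l =>
    toL2 ∘ₗ (pd k : Pol d →ₗ[ℝ] Pol d) ∘ₗ (pd l : Pol d →ₗ[ℝ] Pol d) ∘ₗ V with hf
  have hb : ∀ k l p, ‖f k l p‖ ≤ C * ‖toL2 p‖ := by
    intro k l p
    obtain ⟨q, hq⟩ := hVq p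
    have : f k l p = toL2 (pd k (pd l (V p))) := rfl
    rw [this, norm_toL2, norm_toL2]
    have e := hV p
    rw [hq] at e ⊢
    have h1 := h A hA q k l
    rwa [e] at h1
  have hdense := denseRange_toL2 hd
  refine ⟨fun k l => (f k l).extendOfNorm toL2, fun k l => ⟨fun p => ?_, ?_⟩⟩
  · exact LinearMap.extendOfNorm_eq hdense ⟨C, hb k l⟩ p
  · exact LinearMap.opNorm_extendOfNorm_le hdense hC.le (hb k l)

/-- Bounded operators on the unit ball satisfying a dual form of Hörmander's condition. -/
structure Hormander (C κ : ℝ) (T : H2 d →L[ℝ] H2 d) : Prop where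
  norm_le : ‖T‖ ≤ C
  cancel : ∀ (y : Euc d) (r ρ : ℝ) (b φ : H2 d), ‖y‖ ≤ 1 → 0 < r → κ * r < ρ → ρ ≤ 1 / 8 →
    (∀ᵐ x ∂muB d, x ∉ closedBall y r → b x = 0) → ∫ x, b x ∂muB d = 0 →
    (∀ᵐ x ∂muB d, x ∉ ball y (16 * ρ) \ ball y ρ → φ x = 0) →
    √(ρ ^ d) * |inner ℝ (T b) φ| ≤ C * (r / ρ) * (∫ x, |b x| ∂muB d) * ‖φ‖

lemma integrable_H2 (f : H2 d) : Integrable f (muB d) :=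
  (Lp.memLp f).integrable (by norm_num)

lemma abs_inner_toL2_le {y : Euc d} {r r' M : ℝ} (hy : ‖y‖ ≤ 1) (hr : 0 < r) (hr2 : r ≤ 2)
    (hrr : r < r') {b : H2 d} (hb : ∀ᵐ x ∂muB d, x ∉ closedBall y r → b x = 0)
    (hb0 : ∫ x, b x ∂muB d = 0) {w : Pol d} (hM : 0 ≤ M)
    (hw : ∀ x ∈ cut y r', ∀ z ∈ cut y r', |ev x w - ev z w| ≤ M * ‖x - z‖) :
    |inner ℝ b (toL2 w)| ≤ 2 * r * M * ∫ x, |b x| ∂muB d := by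
  obtain ⟨z, hz⟩ : (cut y r).Nonempty := by
    by_contra h
    have h1 := volume_real_cut_le hy hr hr2
    rw [not_nonempty_iff_eq_empty.1 h, measureReal_empty] at h1
    have := mul_pos (show 0 < (r / 2) ^ d by positivity) (vol1_pos d)
    linarith
  have e : inner ℝ b (toL2 w) = ∫ x, b x * (ev x w - ev z w) ∂muB d := by
    have h1 : Integrable (fun x => b x * ev x w) (muB d) := by
      refine (integrable_mul_H2 b (toL2 w)).congr ?_
      filter_upwards [coeFn_toL2 w] with x hx
      rw [hx]
    simp only [mul_sub]
    rw [integral_sub h1 ((integrable_H2 b).mul_const _), integral_mul_const, hb0, zero_mul,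
      sub_zero, inner_H2]
    refine integral_congr_ae ?_
    filter_upwards [coeFn_toL2 w] with x hx
    rw [hx]
  rw [e, ← integral_const_mul]
  refine abs_integral_le_of_abs_le ((integrable_H2 b).abs.const_mul _) ?_
  filter_upwards [hb, ae_muB fun x hx => hx] with x hx hxB
  rw [abs_mul, mul_comm]
  by_cases h : x ∈ closedBall y r
  · refine mul_le_mul_of_nonneg_right ((hw x ⟨hxB, closedBall_subset_ball hrr h⟩ z
      (cut_mono y hrr.le hz)).trans ?_) (abs_nonneg _)
    rw [mul_comm]
    refine mul_le_mul_of_nonneg_right ?_ hM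
    rw [← dist_eq_norm]
    linarith [dist_triangle_right x z y, mem_closedBall.1 h, mem_ball.1 hz.2]
  · rw [hx h, abs_zero, mul_zero, mul_zero]

lemma annular_of_approx {φ : H2 d} {y : Euc d} {ρ ε : ℝ} (hy : ‖y‖ ≤ 1) (hρ : 0 < ρ)
    (hρ8 : ρ ≤ 1 / 8) (hφ : ∀ᵐ x ∂muB d, x ∉ ball y (16 * ρ) \ ball y ρ → φ x = 0) {K : ℕ}
    (hε : 0 ≤ ε) {p : Pol d} (hp : ‖φ - toL2 p‖ ≤ ε)
    (hs : ∀ x ∈ cut y (ρ / 4), ∀ β : List (Fin d), β.length ≤ K → |ev x (Dw β p)| ≤ ε) :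
    Annular p K y ρ (‖φ‖ + ε) ε where
  ynorm := hy
  rpos := hρ
  rle := hρ8
  epos := hε
  bound := by
    rw [← norm_toL2]
    have := norm_sub_norm_le (toL2 p) φ
    rw [norm_sub_rev] at this
    linarith
  small := hs
  tail := by
    have hm : MeasurableSet (ball (0 : Euc d) 1 \ cut y (16 * ρ)) :=
      measurableSet_ball.diff (CDom.cut _ _).measurableSet
    have hsub : ball (0 : Euc d) 1 \ cut y (16 * ρ) ⊆ ball 0 1 := sdiff_subset
    calc I (ball (0 : Euc d) 1 \ cut y (16 * ρ)) (p ^ 2)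
        = ∫ x in ball (0 : Euc d) 1 \ cut y (16 * ρ), (φ - toL2 p : H2 d) x ^ 2 := by
          refine setIntegral_congr_ae hm ?_
          have h1 := (ae_restrict_iff' measurableSet_ball).1 (hφ.and
            ((Lp.coeFn_sub φ (toL2 p)).and (coeFn_toL2 p)))
          filter_upwards [h1] with x hx hxm
          obtain ⟨h1, h2, h3⟩ := hx (hsub hxm)
          rw [h2, Pi.sub_apply, h3, h1 fun h => hxm.2 ⟨hxm.1, h.1⟩, zero_sub, neg_sq, map_pow]
      _ ≤ ‖φ - toL2 p‖ ^ 2 := by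
          rw [norm_sq_H2]
          exact setIntegral_mono_set (integrable_sq_H2 _)
            (Eventually.of_forall fun x => sq_nonneg _) hsub.eventuallyLE
      _ ≤ ε ^ 2 := pow_le_pow_left₀ (norm_nonneg _) hp 2

lemma exists_hormander (hd : 1 ≤ d) {lam Lam : ℝ} (hlam : 0 < lam) (hLam : 0 < Lam) :
    ∃ C : ℝ, 0 < C ∧ ∀ A : Matrix (Fin d) (Fin d) ℝ, Ell lam Lam A → ∃ V : Pol d →ₗ[ℝ] Pol d,
      (∀ p, LA A (V p) = p) ∧ (∀ p, ∃ q, V p = om * q) ∧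
      ∃ T : Fin d → Fin d → H2 d →L[ℝ] H2 d, ∀ k l, Hormander C (8 * 2 ^ (d + 3)) (T k l) ∧
        ∀ g p, inner ℝ (T k l g) (toL2 p) = inner ℝ g (toL2 (pd k (pd l (V p)))) := by
  obtain ⟨C0, hC0, h0⟩ := exists_hessian_operators hd hlam hLam
  obtain ⟨C1, hC1, h1⟩ := Annular.hess_sub_le hd hlam hLam
  set κ : ℝ := 8 * 2 ^ (d + 3) with hκ
  have hκ1 : 1 ≤ κ := by
    have : (1 : ℝ) ≤ 2 ^ (d + 3) := one_le_pow₀ (by norm_num)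
    linarith
  refine ⟨C0 + 2 * C1, by positivity, fun A hA => ?_⟩
  obtain ⟨V, hV, hVq, S, hS⟩ := h0 A hA
  refine ⟨V, hV, hVq, fun k l => (S k l).adjoint, fun k l => ⟨⟨?_, ?_⟩, fun g p => ?_⟩⟩
  · rw [LinearIsometryEquiv.norm_map]
    linarith [(hS k l).2]
  · intro y r ρ b φ hy hr hrρ hρ8 hb hb0 hφ
    rw [ContinuousLinearMap.adjoint_inner_left]
    have hρ : 0 < ρ := lt_of_lt_of_le (by positivity) hrρ.le
    have hr2 : r ≤ 2 := by nlinarith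
    have hrκ : r < ρ / κ := by rw [lt_div_iff₀ (by positivity), mul_comm]; exact hrρ
    set N := ∫ x, |b x| ∂muB d with hN
    have hN0 : 0 ≤ N := integral_nonneg fun x => abs_nonneg _
    set F : ℝ → ℝ := fun ε => √(ρ ^ d) * (‖b‖ * (C0 * ε))
      + 2 * r * (C1 * (ρ⁻¹ ^ 2 * (ρ * (‖φ‖ + ε) + ε))) * N with hF
    have hsq : 0 < √(ρ ^ d) := Real.sqrt_pos.2 (by positivity)
    have key : ∀ ε > 0, √(ρ ^ d) * |inner ℝ b (S k l φ)| ≤ F ε := by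
      intro ε hε
      obtain ⟨p, hp, hps⟩ := exists_approx_pol φ (y := y) (s := ρ / 4) (by positivity) (by
        filter_upwards [hφ] with x hx hxb
        exact hx fun h => h.2 (by rwa [mul_div_cancel₀ _ (by norm_num : (4 : ℝ) ≠ 0)] at hxb))
        (d + 3) hε
      have hann := annular_of_approx hy hρ hρ8 hφ hε.le hp hps
      obtain ⟨q, hq⟩ := hVq p
      have hLq : LA A (om * q) = p := by rw [← hq, hV]
      have hosc := h1 A hA q y ρ (‖φ‖ + ε) ε (by rwa [hLq]) k l
      rw [← hq] at hosc
      have e : inner ℝ b (S k l φ) = inner ℝ b (S k l (φ - toL2 p))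
          + inner ℝ b (toL2 (pd k (pd l (V p)))) := by
        rw [← (hS k l).1 p, ← inner_add_right, ← map_add, sub_add_cancel]
      have i1 : |inner ℝ b (S k l (φ - toL2 p))| ≤ ‖b‖ * (C0 * ε) := by
        refine (abs_real_inner_le_norm _ _).trans (mul_le_mul_of_nonneg_left ?_ (norm_nonneg _))
        exact ((S k l).le_opNorm _).trans (mul_le_mul (hS k l).2 hp (norm_nonneg _) hC0.le)
      have i2 := abs_inner_toL2_le hy hr hr2 hrκ hb hb0 (w := pd k (pd l (V p)))
        (M := C1 * (ρ⁻¹ ^ 2 * (ρ * (‖φ‖ + ε) + ε)) / √(ρ ^ d)) (by positivity)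
        (fun x hx z hz => by
          rw [div_mul_eq_mul_div, le_div_iff₀ hsq, mul_comm]
          exact hosc x hx z hz)
      rw [e]
      calc _ ≤ √(ρ ^ d) * (‖b‖ * (C0 * ε)
            + 2 * r * (C1 * (ρ⁻¹ ^ 2 * (ρ * (‖φ‖ + ε) + ε)) / √(ρ ^ d)) * N) :=
            mul_le_mul_of_nonneg_left ((abs_add_le _ _).trans (add_le_add i1 i2)) hsq.le
        _ = F ε := by rw [hF]; field_simp
    have hlim : Tendsto F (𝓝[>] 0) (𝓝 (F 0)) :=
      (Continuous.tendsto (by fun_prop) 0).mono_left nhdsWithin_le_nhds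
    have hle := ge_of_tendsto hlim (by filter_upwards [self_mem_nhdsWithin] with ε hε using key ε hε)
    refine hle.trans ?_
    have e : F 0 = 2 * C1 * (r / ρ) * N * ‖φ‖ := by
      simp only [hF, mul_zero, add_zero, zero_add]
      field_simp
    rw [e]
    have : 0 ≤ C0 * (r / ρ) * N * ‖φ‖ := by positivity
    nlinarith
  · rw [ContinuousLinearMap.adjoint_inner_left, (hS k l).1]

end Operators

end WeakType

namespace WeakType

section Tail

open Filter Topology

variable {d : ℕ} {C κ : ℝ} {T : H2 d →L[ℝ] H2 d}

lemma muB_real_ball_le (y : Euc d) {r : ℝ} (hr : 0 < r) :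
    (muB d).real (ball y r) ≤ r ^ d * vol1 d := by
  rw [← volume_real_ball y hr]
  exact ENNReal.toReal_mono measure_ball_lt_top.ne (Measure.restrict_le_self _)

lemma exists_sign_test (g : H2 d) {A : Set (Euc d)} (hA : MeasurableSet A) :
    ∃ φ : H2 d, (∀ᵐ x ∂muB d, x ∉ A → φ x = 0) ∧ ‖φ‖ ≤ √((muB d).real A) ∧
      inner ℝ g φ = ∫ x in A, |g x| ∂muB d := by
  classical
  set σ : Euc d → ℝ := fun x => if 0 ≤ g x then 1 else -1 with hσ
  have hσm : Measurable σ := Measurable.ite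
    (measurableSet_le measurable_const (Lp.stronglyMeasurable g).measurable)
    measurable_const measurable_const
  have hσ1 : ∀ x, |σ x| = 1 := by
    intro x
    by_cases h : 0 ≤ g x <;> simp [hσ, h]
  have hm : MemLp (A.indicator σ) 2 (muB d) := by
    refine MemLp.of_bound (hσm.indicator hA).aestronglyMeasurable 1 (Eventually.of_forall fun x => ?_)
    refine (norm_indicator_le_norm_self _ _).trans ?_
    rw [Real.norm_eq_abs, hσ1]
  refine ⟨hm.toLp, ?_, ?_, ?_⟩
  · filter_upwards [hm.coeFn_toLp] with x hx hxA
    rw [hx, indicator_of_notMem hxA]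
  · rw [← Real.sqrt_sq (norm_nonneg hm.toLp), norm_sq_H2]
    refine Real.sqrt_le_sqrt (le_of_eq ?_)
    rw [← integral_indicator_one hA]
    refine integral_congr_ae ?_
    filter_upwards [hm.coeFn_toLp] with x hx
    rw [hx]
    by_cases hxA : x ∈ A
    · rw [indicator_of_mem hxA, indicator_of_mem hxA, ← sq_abs, hσ1, one_pow, Pi.one_apply]
    · rw [indicator_of_notMem hxA, indicator_of_notMem hxA, zero_pow two_ne_zero]
  · rw [inner_H2, ← integral_indicator hA]
    refine integral_congr_ae ?_
    filter_upwards [hm.coeFn_toLp] with x hx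
    rw [hx]
    by_cases hxA : x ∈ A
    · rw [indicator_of_mem hxA, indicator_of_mem hxA]
      by_cases h : 0 ≤ g x
      · simp [hσ, h, abs_of_nonneg h]
      · simp [hσ, h, abs_of_neg (not_le.1 h)]
    · rw [indicator_of_notMem hxA, indicator_of_notMem hxA, mul_zero]

/-- The hypotheses on a single bad function. -/
structure Atom (b : H2 d) (y : Euc d) (r : ℝ) : Prop where
  norm_le : ‖y‖ ≤ 1
  pos : 0 < r
  supp : ∀ᵐ x ∂muB d, x ∉ closedBall y r → b x = 0
  mean : ∫ x, b x ∂muB d = 0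

lemma Hormander.integral_annulus_le (hT : Hormander C κ T) (hC : 0 ≤ C) (hκ : 0 ≤ κ) {b : H2 d}
    {y : Euc d} {r : ℝ} (hb : Atom b y r) {ρ : ℝ} (hρ : κ * r < ρ) (hρ8 : ρ ≤ 1 / 8) :
    ∫ x in ball y (16 * ρ) \ ball y ρ, |T b x| ∂muB d
      ≤ C * √(16 ^ d * vol1 d) * (∫ x, |b x| ∂muB d) * (r / ρ) := by
  have hr := hb.pos
  have hρ0 : 0 < ρ := lt_of_le_of_lt (by positivity) hρ
  have hm : MeasurableSet (ball y (16 * ρ) \ ball y ρ) := measurableSet_ball.diff measurableSet_ball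
  obtain ⟨φ, hφ, hφn, hφi⟩ := exists_sign_test (T b) hm
  have h := hT.cancel y r ρ b φ hb.norm_le hr hρ hρ8 hb.supp hb.mean hφ
  have hN : 0 ≤ ∫ x, |b x| ∂muB d := integral_nonneg fun x => abs_nonneg _
  have hsq : 0 < √(ρ ^ d) := Real.sqrt_pos.2 (by positivity)
  have hn : ‖φ‖ ≤ √(16 ^ d * vol1 d) * √(ρ ^ d) := by
    rw [← Real.sqrt_mul (by have := vol1_pos d; positivity)]
    refine hφn.trans (Real.sqrt_le_sqrt ?_)
    refine (measureReal_mono sdiff_subset (measure_ne_top _ _)).trans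
      ((muB_real_ball_le y (by positivity)).trans (le_of_eq ?_))
    rw [mul_pow]; ring
  rw [hφi] at h
  have h2 := h.trans (mul_le_mul_of_nonneg_left hn (by positivity))
  refine (le_abs_self _).trans (le_of_mul_le_mul_left (h2.trans (le_of_eq ?_)) hsq)
  ring

lemma Hormander.integral_compl_ball_le (hT : Hormander C κ T) (hC : 0 ≤ C) (hκ : 0 ≤ κ) {b : H2 d}
    {y : Euc d} {r : ℝ} (hb : Atom b y r) (k : ℕ) (hk : κ * r < 2 * 16⁻¹ ^ k) :
    ∫ x in (ball y (2 * 16⁻¹ ^ k))ᶜ, |T b x| ∂muB d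
      ≤ 2 * (C * √(16 ^ d * vol1 d) * (∫ x, |b x| ∂muB d) * (r / (2 * 16⁻¹ ^ k))) := by
  have hr := hb.pos
  set D := C * √(16 ^ d * vol1 d) * ∫ x, |b x| ∂muB d with hD
  have hD0 : 0 ≤ D := mul_nonneg (by positivity) (integral_nonneg fun x => abs_nonneg _)
  induction k with
  | zero =>
    rw [pow_zero, mul_one]
    refine le_trans (le_of_eq ?_) (show (0 : ℝ) ≤ 2 * (D * (r / 2)) by positivity)
    refine setIntegral_measure_zero _ (measure_mono_null (t := (ball (0 : Euc d) 1)ᶜ) ?_ ?_)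
    · refine compl_subset_compl.2 (ball_subset_ball' ?_)
      rw [dist_zero_left]
      linarith [hb.norm_le]
    · rw [Measure.restrict_apply measurableSet_ball.compl, compl_inter_self, measure_empty]
  | succ k ih =>
    set s : ℝ := 2 * 16⁻¹ ^ (k + 1) with hs
    have es : 2 * (16 : ℝ)⁻¹ ^ k = 16 * s := by rw [hs, pow_succ]; ring
    have hs0 : 0 < s := by positivity
    rw [es] at ih
    have h1 := ih (by linarith)
    have hs8 : s ≤ 1 / 8 := by
      have : (16 : ℝ)⁻¹ ^ k ≤ 1 := pow_le_one₀ (by norm_num) (by norm_num)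
      rw [hs, pow_succ]; linarith
    have h2 := hT.integral_annulus_le hC hκ hb hk hs8
    have hTint : Integrable (fun x => |T b x|) (muB d) := (integrable_H2 _).abs
    have e : (ball y s)ᶜ = (ball y (16 * s) \ ball y s) ∪ (ball y (16 * s))ᶜ := by
      ext x
      have : x ∈ ball y s → x ∈ ball y (16 * s) := fun h => ball_subset_ball (by linarith) h
      simp only [mem_compl_iff, mem_union, Set.mem_sdiff]
      tauto
    rw [e, setIntegral_union (disjoint_compl_right.mono_left sdiff_subset) measurableSet_ball.compl
      hTint.integrableOn hTint.integrableOn]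
    have h3 : r / (16 * s) = (r / s) / 16 := by field_simp
    rw [h3] at h1
    have : 0 ≤ D * (r / s) := by positivity
    rw [← hD] at h2
    linarith

lemma Hormander.integral_tail_le (hT : Hormander C κ T) (hC : 0 ≤ C) (hκ : 1 ≤ κ) {b : H2 d}
    {y : Euc d} {r : ℝ} (hb : Atom b y r) :
    ∫ x in (ball y (32 * κ * r))ᶜ, |T b x| ∂muB d
      ≤ C * √(16 ^ d * vol1 d) * ∫ x, |b x| ∂muB d := by
  have hr := hb.pos
  have hκ0 : 0 < κ := by linarith
  set D := C * √(16 ^ d * vol1 d) * ∫ x, |b x| ∂muB d with hD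
  have hD0 : 0 ≤ D := mul_nonneg (by positivity) (integral_nonneg fun x => abs_nonneg _)
  have hTint : Integrable (fun x => |T b x|) (muB d) := (integrable_H2 _).abs
  have key : ∀ s, s ≤ 32 * κ * r → ∫ x in (ball y (32 * κ * r))ᶜ, |T b x| ∂muB d
      ≤ ∫ x in (ball y s)ᶜ, |T b x| ∂muB d := fun s hs =>
    setIntegral_mono_set hTint.integrableOn (Eventually.of_forall fun x => abs_nonneg _)
      (compl_subset_compl.2 (ball_subset_ball hs)).eventuallyLE
  rcases lt_or_ge 1 (κ * r) with h | h
  · have hz : ∫ x in (ball y 2)ᶜ, |T b x| ∂muB d = 0 := by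
      refine setIntegral_measure_zero _ (measure_mono_null (t := (ball (0 : Euc d) 1)ᶜ) ?_ ?_)
      · refine compl_subset_compl.2 (ball_subset_ball' ?_)
        rw [dist_zero_left]
        linarith [hb.norm_le]
      · rw [Measure.restrict_apply measurableSet_ball.compl, compl_inter_self, measure_empty]
    exact (key 2 (by nlinarith)).trans (hz.le.trans hD0)
  · obtain ⟨n, hn1, hn2⟩ := exists_nat_pow_near_of_lt_one (x := κ * r) (y := (16 : ℝ)⁻¹)
      (by positivity) h (by norm_num) (by norm_num)
    rw [pow_succ] at hn1
    have hκr : 0 < κ * r := by positivity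
    refine (key (2 * 16⁻¹ ^ n) (by linarith)).trans
      ((hT.integral_compl_ball_le hC hκ0.le hb n (by linarith)).trans ?_)
    rw [← hD]
    have : r / (2 * 16⁻¹ ^ n) ≤ 1 / 2 := by
      rw [div_le_div_iff₀ (by positivity) (by norm_num)]
      nlinarith
    nlinarith

end Tail

end WeakType

namespace WeakType

section Decomposition

open Filter Topology

variable {d : ℕ}

lemma muB_real_closedBall_le (y : Euc d) {r : ℝ} (hr : 0 < r) :
    (muB d).real (closedBall y r) ≤ r ^ d * vol1 d := by
  have e : volume (closedBall y r) = volume (ball y r) := by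
    rw [Measure.addHaar_closedBall volume y hr.le, Measure.addHaar_ball_of_pos volume y hr]
  rw [← volume_real_ball y hr, Measure.real, Measure.real, ← e]
  exact ENNReal.toReal_mono measure_closedBall_lt_top.ne (Measure.restrict_le_self _)

lemma le_muB_real_closedBall {y : Euc d} (hy : ‖y‖ ≤ 1) {r : ℝ} (hr : 0 < r) (hr2 : r ≤ 2) :
    (r / 2) ^ d * vol1 d ≤ (muB d).real (closedBall y r) := by
  refine (volume_real_cut_le hy hr hr2).trans ?_
  rw [Measure.real, Measure.real, Measure.restrict_apply measurableSet_closedBall]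
  refine ENNReal.toReal_mono
    ((measure_mono inter_subset_right).trans_lt measure_ball_lt_top).ne (measure_mono ?_)
  exact fun x hx => ⟨ball_subset_closedBall hx.2, hx.1⟩

lemma muB_real_closedBall_pos {y : Euc d} (hy : ‖y‖ ≤ 1) {r : ℝ} (hr : 0 < r) :
    0 < (muB d).real (closedBall y r) := by
  have h : 0 < (min r 2 / 2) ^ d * vol1 d := by
    have := vol1_pos d
    have : 0 < min r 2 := lt_min hr two_pos
    positivity
  exact h.trans_le ((le_muB_real_closedBall hy (lt_min hr two_pos) (min_le_right _ _)).trans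
    (measureReal_mono (closedBall_subset_closedBall (min_le_left _ _))))

variable {g : Euc d → ℝ} {α : ℝ}

lemma integrable_muB (hg : Continuous g) : Integrable g (muB d) :=
  memLp_one_iff_integrable.1 (memLp_of_continuous hg 1)

/-- The stopping condition for a ball in the decomposition of `g` at height `α`. -/
structure Stopping (g : Euc d → ℝ) (α : ℝ) (x : Euc d) (r : ℝ) : Prop where
  norm_le : ‖x‖ ≤ 1
  pos : 0 < r
  le_two : r ≤ 2
  lt : α * (muB d).real (closedBall x r) < ∫ z in closedBall x r, |g z| ∂muB d
  le : ∀ ρ, 2 * r ≤ ρ →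
    ∫ z in closedBall x ρ, |g z| ∂muB d ≤ α * (muB d).real (closedBall x ρ)

lemma exists_stopping (hg : Continuous g) (hα : 0 < α)
    (hN : ∫ z, |g z| ∂muB d ≤ α * vol1 d) {x : Euc d} (hx : ‖x‖ ≤ 1) (hgx : 2 * α ≤ |g x|) :
    ∃ r, Stopping g α x r := by
  set S : Set ℝ := {r | 0 < r ∧
    α * (muB d).real (closedBall x r) < ∫ z in closedBall x r, |g z| ∂muB d} with hS
  have hne : S.Nonempty := by
    have h1 : ∀ᶠ z in 𝓝 x, 3 / 2 * α < |g z| :=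
      (hg.abs.tendsto x).eventually (lt_mem_nhds (by linarith))
    obtain ⟨δ, hδ, h⟩ := Metric.eventually_nhds_iff.1 h1
    have hm := muB_real_closedBall_pos hx (half_pos hδ)
    refine ⟨δ / 2, half_pos hδ, ?_⟩
    have h2 : ∫ z in closedBall x (δ / 2), 3 / 2 * α ∂muB d
        ≤ ∫ z in closedBall x (δ / 2), |g z| ∂muB d :=
      setIntegral_mono_on (integrable_const _) (integrable_muB hg).abs.integrableOn
        measurableSet_closedBall fun z hz => (h ((mem_closedBall.1 hz).trans_lt (by linarith))).le
    rw [setIntegral_const, smul_eq_mul] at h2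
    nlinarith
  have hle : ∀ r ∈ S, r ≤ 2 := by
    intro r hr
    by_contra! h
    have hsub : ball (0 : Euc d) 1 ⊆ closedBall x r := by
      intro z hz
      rw [mem_closedBall]
      have h1 := dist_triangle z 0 x
      rw [dist_zero_left] at h1
      linarith [mem_ball.1 hz]
    have h1 : (muB d).real (closedBall x r) = vol1 d := by
      rw [Measure.real, Measure.restrict_apply measurableSet_closedBall,
        inter_eq_self_of_subset_right hsub, vol1, Measure.real]
    have h2 : ∫ z in closedBall x r, |g z| ∂muB d ≤ ∫ z, |g z| ∂muB d :=
      setIntegral_le_integral (integrable_muB hg).abs (Eventually.of_forall fun z => abs_nonneg _)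
    have h3 := hr.2
    rw [h1] at h3
    linarith
  have hbdd : BddAbove S := ⟨2, hle⟩
  have hs : 0 < sSup S := by
    obtain ⟨r, hr⟩ := hne
    exact hr.1.trans_le (le_csSup hbdd hr)
  obtain ⟨r, hr, hlt⟩ := exists_lt_of_lt_csSup hne (half_lt_self hs)
  refine ⟨r, hx, hr.1, hle r hr, hr.2, fun ρ hρ => ?_⟩
  by_contra! h
  have := le_csSup hbdd (show ρ ∈ S from ⟨by linarith [hr.1], h⟩)
  linarith

lemma exists_stopping_cover (hg : Continuous g) (hα : 0 < α)
    (hN : ∫ z, |g z| ∂muB d ≤ α * vol1 d) :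
    ∃ (s : Finset (Euc d)) (r : Euc d → ℝ), (∀ x ∈ s, Stopping g α x (r x)) ∧
      (s : Set (Euc d)).PairwiseDisjoint (fun x => closedBall x (r x)) ∧
      ∀ z ∈ ball (0 : Euc d) 1, 2 * α ≤ |g z| → ∃ x ∈ s, z ∈ closedBall x (5 * r x) := by
  classical
  set K : Set (Euc d) := closedBall 0 1 ∩ {z | 2 * α ≤ |g z|} with hK
  have hKc : IsCompact K :=
    (isCompact_closedBall _ _).inter_right (isClosed_le continuous_const hg.abs)
  have hex : ∀ x ∈ K, ∃ r, Stopping g α x r := fun x hx =>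
    exists_stopping hg hα hN (mem_closedBall_zero_iff.1 hx.1) hx.2
  choose! r hr using hex
  obtain ⟨t, ht, htK⟩ := hKc.elim_nhds_subcover (fun x => closedBall x (r x))
    fun x hx => closedBall_mem_nhds x (hr x hx).pos
  obtain ⟨u, hut, hu, hcov⟩ := Vitali.exists_disjoint_subfamily_covering_enlargement_closedBall
    (t : Set (Euc d)) id r 2 (fun x hx => (hr x (ht x hx)).le_two) 5 (by norm_num)
  have huf : u.Finite := t.finite_toSet.subset hut
  refine ⟨huf.toFinset, r, fun x hx => hr x (ht x (hut (huf.mem_toFinset.1 hx))), ?_,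
    fun z hz hgz => ?_⟩
  · rw [huf.coe_toFinset]
    exact hu
  · obtain ⟨x, hx, hzx⟩ := mem_iUnion₂.1 (htK ⟨ball_subset_closedBall hz, hgz⟩)
    obtain ⟨y, hy, hxy⟩ := hcov x hx
    exact ⟨y, huf.mem_toFinset.2 hy, hxy hzx⟩

end Decomposition

end WeakType

namespace WeakType

section CalderonZygmund

open Filter Topology

variable {d : ℕ}

lemma exists_measurable_partition (s : Finset (Euc d)) {E : Euc d → Set (Euc d)}
    (hE : ∀ x, MeasurableSet (E x)) :
    ∃ w : Euc d → Euc d → ℝ, (∀ x, Measurable (w x)) ∧ (∀ x z, 0 ≤ w x z) ∧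
      (∀ x z, z ∉ E x → w x z = 0) ∧ (∀ z, ∑ x ∈ s, w x z ≤ 1) ∧
      ∀ x ∈ s, ∀ z ∈ E x, ∑ y ∈ s, w y z = 1 := by
  set e : Euc d → Euc d → ℝ := fun x => (E x).indicator fun _ => 1 with he
  have he0 : ∀ x z, 0 ≤ e x z := fun x z => indicator_nonneg (fun _ _ => zero_le_one) z
  have hem : ∀ x, Measurable (e x) := fun x => measurable_const.indicator (hE x)
  refine ⟨fun x z => e x z / ∑ y ∈ s, e y z, fun x => ?_, fun x z => ?_, fun x z hz => ?_,
    fun z => ?_, fun x hx z hz => ?_⟩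
  · exact (hem x).div (Finset.measurable_fun_sum s fun y _ => hem y)
  · exact div_nonneg (he0 x z) (Finset.sum_nonneg fun y _ => he0 y z)
  · simp [he, indicator_of_notMem hz]
  · rw [← Finset.sum_div]
    exact div_self_le_one _
  · rw [← Finset.sum_div]
    refine div_self (ne_of_gt (lt_of_lt_of_le zero_lt_one ?_))
    refine le_trans (le_of_eq ?_) (Finset.single_le_sum (fun y _ => he0 y z) hx)
    simp [he, indicator_of_mem hz]

lemma sum_indicator_le_of_pairwiseDisjoint {s : Finset (Euc d)} {B : Euc d → Set (Euc d)}
    (hB : (s : Set (Euc d)).PairwiseDisjoint B) {c : Euc d → ℝ} {M : ℝ} (hM : 0 ≤ M)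
    (hc : ∀ x ∈ s, |c x| ≤ M) (z : Euc d) :
    |∑ x ∈ s, (B x).indicator (fun _ => c x) z| ≤ M := by
  by_cases h : ∃ x ∈ s, z ∈ B x
  · obtain ⟨x, hx, hzx⟩ := h
    rw [Finset.sum_eq_single_of_mem x hx, indicator_of_mem hzx]
    · exact hc x hx
    · intro y hy hyx
      exact indicator_of_notMem (fun hzy => Set.disjoint_left.1 (hB hy hx hyx) hzy hzx) _
  · push Not at h
    rw [Finset.sum_eq_zero fun x hx => indicator_of_notMem (h x hx) _, abs_zero]
    exact hM

lemma integral_abs_eq_integral_toLp {p : Euc d → ℝ} (hp : MemLp p 2 (muB d)) :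
    ∫ z, |MemLp.toLp p hp z| ∂muB d = ∫ z, |p z| ∂muB d := by
  refine integral_congr_ae ?_
  filter_upwards [hp.coeFn_toLp] with z hz
  rw [hz]

lemma exists_calderon_zygmund {g : Euc d → ℝ} (hg : Continuous g) {α : ℝ} (hα : 0 < α)
    (hN : ∫ z, |g z| ∂muB d ≤ α * vol1 d) :
    ∃ (s : Finset (Euc d)) (r : Euc d → ℝ) (b : Euc d → H2 d) (h : H2 d),
      (memLp_of_continuous hg 2).toLp = h + ∑ x ∈ s, b x ∧
      (∀ x ∈ s, Atom (b x) x (r x)) ∧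
      ∑ x ∈ s, ∫ z, |b x z| ∂muB d ≤ 2 * ∫ z, |g z| ∂muB d ∧
      ‖h‖ ^ 2 ≤ (2 + 10 ^ d) * α * ∫ z, |g z| ∂muB d ∧
      α * ∑ x ∈ s, r x ^ d * vol1 d ≤ 10 ^ d * ∫ z, |g z| ∂muB d := by
  obtain ⟨s, r, hs, hdisj, hcov⟩ := exists_stopping_cover hg hα hN
  set N : ℝ := ∫ z, |g z| ∂muB d with hNdef
  have hv := vol1_pos d
  have hgi : Integrable g (muB d) := integrable_muB hg
  set B : Euc d → Set (Euc d) := fun x => closedBall x (r x) with hB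
  set E : Euc d → Set (Euc d) := fun x => closedBall x (5 * r x) with hE
  have hBm : ∀ x, MeasurableSet (B x) := fun x => measurableSet_closedBall
  have hEm : ∀ x, MeasurableSet (E x) := fun x => measurableSet_closedBall
  obtain ⟨w, hwm, hw0, hwE, hw1, hwsum⟩ := exists_measurable_partition s hEm
  have hwle : ∀ x ∈ s, ∀ z, w x z ≤ 1 := fun x hx z =>
    (Finset.single_le_sum (fun y _ => hw0 y z) hx).trans (hw1 z)
  have hgw : ∀ x ∈ s, MemLp (fun z => g z * w x z) 2 (muB d) := by
    intro x hx
    refine (memLp_of_continuous hg 2).mono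
      (hg.measurable.mul (hwm x)).aestronglyMeasurable (Eventually.of_forall fun z => ?_)
    rw [norm_mul, Real.norm_of_nonneg (hw0 x z)]
    exact mul_le_of_le_one_right (norm_nonneg _) (hwle x hx z)
  have hgwi : ∀ x ∈ s, Integrable (fun z => g z * w x z) (muB d) := fun x hx =>
    (hgw x hx).integrable (by norm_num)
  have hagw : ∀ x z, |g z * w x z| = |g z| * w x z := fun x z => by
    rw [abs_mul, abs_of_nonneg (hw0 x z)]
  have hagwi : ∀ x ∈ s, Integrable (fun z => |g z| * w x z) (muB d) := fun x hx => by
    simpa only [hagw] using (hgwi x hx).abs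
  set m : Euc d → ℝ := fun x => ∫ z, g z * w x z ∂muB d with hm
  set c : Euc d → ℝ := fun x => m x / (muB d).real (B x) with hc
  have hμB : ∀ x ∈ s, 0 < (muB d).real (B x) := fun x hx =>
    muB_real_closedBall_pos (hs x hx).norm_le (hs x hx).pos
  have hmle : ∀ x, |m x| ≤ ∫ z, |g z| * w x z ∂muB d := fun x => by
    simpa only [hagw] using abs_integral_le_integral_abs (f := fun z => g z * w x z) (μ := muB d)
  have hsumN : ∑ x ∈ s, ∫ z, |g z| * w x z ∂muB d ≤ N := by
    rw [← integral_finsetSum s hagwi]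
    refine integral_mono (integrable_finsetSum s hagwi) hgi.abs fun z => ?_
    change ∑ x ∈ s, |g z| * w x z ≤ |g z|
    rw [← Finset.mul_sum]
    exact mul_le_of_le_one_right (abs_nonneg _) (hw1 z)
  have hcle : ∀ x ∈ s, |c x| ≤ 10 ^ d * α := by
    intro x hx
    have hx' := hs x hx
    rw [hc]
    simp only
    rw [abs_div, abs_of_pos (hμB x hx), div_le_iff₀ (hμB x hx)]
    have h1 : ∫ z, |g z| * w x z ∂muB d ≤ ∫ z in E x, |g z| ∂muB d := by
      rw [← integral_indicator (hEm x)]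
      refine integral_mono (hagwi x hx) (hgi.abs.indicator (hEm x)) fun z => ?_
      by_cases hz : z ∈ E x
      · rw [indicator_of_mem hz]
        exact mul_le_of_le_one_right (abs_nonneg _) (hwle x hx z)
      · rw [indicator_of_notMem hz]
        simp [hwE x z hz]
    have h2 := hx'.le (5 * r x) (by linarith [hx'.pos])
    have h3 := muB_real_closedBall_le x (r := 5 * r x) (by linarith [hx'.pos])
    have h4 := le_muB_real_closedBall hx'.norm_le hx'.pos hx'.le_two
    have h5 : (5 * r x) ^ d * vol1 d = 10 ^ d * ((r x / 2) ^ d * vol1 d) := by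
      rw [← mul_assoc, ← mul_pow]
      congr 2
      ring
    rw [h5] at h3
    calc |m x| ≤ α * (muB d).real (closedBall x (5 * r x)) := ((hmle x).trans h1).trans h2
      _ ≤ α * (10 ^ d * (muB d).real (B x)) :=
        mul_le_mul_of_nonneg_left (h3.trans (mul_le_mul_of_nonneg_left h4 (by positivity))) hα.le
      _ = _ := by ring
  have hcB : ∀ x, MemLp ((B x).indicator fun _ => c x) 2 (muB d) := fun x =>
    (memLp_const (c x)).indicator (hBm x)
  have hcBi : ∀ x, Integrable ((B x).indicator fun _ => c x) (muB d) := fun x =>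
    (integrable_const (c x)).indicator (hBm x)
  have hcBabs : ∀ x ∈ s, ∫ z, |(B x).indicator (fun _ => c x) z| ∂muB d = |m x| := by
    intro x hx
    have e : ∀ z, |(B x).indicator (fun _ => c x) z| = (B x).indicator (fun _ => |c x|) z := by
      intro z
      by_cases hz : z ∈ B x
      · rw [indicator_of_mem hz, indicator_of_mem hz]
      · rw [indicator_of_notMem hz, indicator_of_notMem hz, abs_zero]
    simp only [e]
    rw [integral_indicator (hBm x), setIntegral_const, smul_eq_mul, hc]
    simp only
    rw [abs_div, abs_of_pos (hμB x hx), mul_div_cancel₀ _ (hμB x hx).ne']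
  set bf : Euc d → Euc d → ℝ := fun x z => g z * w x z - (B x).indicator (fun _ => c x) z with hbf
  have hbm : ∀ x ∈ s, MemLp (bf x) 2 (muB d) := fun x hx => (hgw x hx).sub (hcB x)
  classical
  set b : Euc d → H2 d := fun x => if hx : x ∈ s then (hbm x hx).toLp else 0 with hb
  have hbe : ∀ x (hx : x ∈ s), b x = (hbm x hx).toLp := fun x hx => by
    simp only [hb]
    rw [dif_pos hx]
  have hbae : ∀ x ∈ s, b x =ᵐ[muB d] bf x := fun x hx => by
    rw [hbe x hx]
    exact (hbm x hx).coeFn_toLp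
  set h : H2 d := (memLp_of_continuous hg 2).toLp - ∑ x ∈ s, b x with hh
  have hhae : ∀ᵐ z ∂muB d, h z = g z * (1 - ∑ x ∈ s, w x z)
      + ∑ x ∈ s, (B x).indicator (fun _ => c x) z := by
    have h1 : ∀ᵐ z ∂muB d, ∀ x ∈ s, b x z = bf x z :=
      (Finset.eventually_all s).2 fun x hx => hbae x hx
    filter_upwards [h1, Lp.coeFn_sub (memLp_of_continuous hg 2).toLp (∑ x ∈ s, b x),
      Lp.coeFn_finsetSum s b, (memLp_of_continuous hg 2).coeFn_toLp] with z h1 h2 h3 h4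
    rw [h2, Pi.sub_apply, h3, h4, Finset.sum_apply, Finset.sum_congr rfl h1]
    simp only [hbf, Finset.sum_sub_distrib, ← Finset.mul_sum]
    ring
  have hsumabs : ∀ z, |∑ x ∈ s, (B x).indicator (fun _ => c x) z|
      ≤ ∑ x ∈ s, |(B x).indicator (fun _ => c x) z| := fun z => Finset.abs_sum_le_sum_abs _ _
  refine ⟨s, fun x => 5 * r x, b, h, by rw [hh]; abel, fun x hx => ?_, ?_, ?_, ?_⟩
  · have hx' := hs x hx
    refine ⟨hx'.norm_le, by linarith [hx'.pos], ?_, ?_⟩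
    · filter_upwards [hbae x hx] with z hz hzE
      have hzB : z ∉ B x := fun h => hzE (closedBall_subset_closedBall (by linarith [hx'.pos]) h)
      rw [hz]
      simp only [hbf]
      rw [hwE x z hzE, indicator_of_notMem hzB]
      ring
    · rw [integral_congr_ae (hbae x hx)]
      simp only [hbf]
      rw [integral_sub (hgwi x hx) (hcBi x), integral_indicator (hBm x), setIntegral_const,
        smul_eq_mul]
      simp only [hc]
      rw [mul_div_cancel₀ _ (hμB x hx).ne', sub_self]
  · refine le_trans (Finset.sum_le_sum (g := fun x => 2 * ∫ z, |g z| * w x z ∂muB d)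
      fun x hx => ?_) ?_
    · rw [hbe x hx, integral_abs_eq_integral_toLp]
      calc ∫ z, |bf x z| ∂muB d
          ≤ ∫ z, (|g z| * w x z + |(B x).indicator (fun _ => c x) z|) ∂muB d := by
            refine integral_mono ((hbm x hx).integrable (by norm_num)).abs
              ((hagwi x hx).add (hcBi x).abs) fun z => ?_
            refine (abs_sub _ _).trans ?_
            rw [hagw]
        _ = ∫ z, |g z| * w x z ∂muB d + |m x| := by
            rw [integral_add (hagwi x hx) (hcBi x).abs, hcBabs x hx]
        _ ≤ _ := by linarith [hmle x]
    · rw [← Finset.mul_sum]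
      linarith
  · have hbound : ∀ᵐ z ∂muB d, |h z| ≤ (2 + 10 ^ d) * α := by
      filter_upwards [hhae, ae_muB (P := fun z => z ∈ ball (0 : Euc d) 1) fun z hz => hz]
        with z hz hzb
      rw [hz]
      have h1 := sum_indicator_le_of_pairwiseDisjoint hdisj (c := c) (M := 10 ^ d * α)
        (by positivity) hcle z
      have h2 : |g z * (1 - ∑ x ∈ s, w x z)| ≤ 2 * α := by
        by_cases hgz : 2 * α ≤ |g z|
        · obtain ⟨x, hx, hzx⟩ := hcov z hzb hgz
          rw [hwsum x hx z hzx, sub_self, mul_zero, abs_zero]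
          positivity
        · rw [abs_mul, abs_of_nonneg (sub_nonneg.2 (hw1 z))]
          have : 0 ≤ ∑ x ∈ s, w x z := Finset.sum_nonneg fun x _ => hw0 x z
          exact (mul_le_of_le_one_right (abs_nonneg _) (by linarith)).trans (not_le.1 hgz).le
      refine (abs_add_le _ _).trans ?_
      rw [add_mul]
      exact add_le_add h2 h1
    have hL1 : ∫ z, |h z| ∂muB d ≤ N := by
      have hi1 : Integrable (fun z => |g z| - ∑ x ∈ s, |g z| * w x z) (muB d) :=
        hgi.abs.sub (integrable_finsetSum s hagwi)
      have hi2 : Integrable (fun z => ∑ x ∈ s, |(B x).indicator (fun _ => c x) z|) (muB d) :=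
        integrable_finsetSum s fun x _ => (hcBi x).abs
      calc ∫ z, |h z| ∂muB d
          ≤ ∫ z, ((|g z| - ∑ x ∈ s, |g z| * w x z)
              + ∑ x ∈ s, |(B x).indicator (fun _ => c x) z|) ∂muB d := by
            refine integral_mono_ae (integrable_H2 h).abs (hi1.add hi2) ?_
            filter_upwards [hhae] with z hz
            rw [hz]
            refine (abs_add_le _ _).trans (add_le_add (le_of_eq ?_) (hsumabs z))
            rw [abs_mul, abs_of_nonneg (sub_nonneg.2 (hw1 z)), ← Finset.mul_sum]
            ring
        _ = N - ∑ x ∈ s, ∫ z, |g z| * w x z ∂muB d + ∑ x ∈ s, |m x| := by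
            rw [integral_add hi1 hi2, integral_sub hgi.abs (integrable_finsetSum s hagwi),
              integral_finsetSum s hagwi, integral_finsetSum s fun x _ => (hcBi x).abs,
              Finset.sum_congr rfl hcBabs]
        _ ≤ N := by
            have := Finset.sum_le_sum (s := s) fun x _ => hmle x
            linarith
    rw [norm_sq_H2]
    calc ∫ z, h z ^ 2 ∂muB d ≤ ∫ z, (2 + 10 ^ d) * α * |h z| ∂muB d := by
          refine integral_mono_ae (integrable_sq_H2 h) ((integrable_H2 h).abs.const_mul _) ?_
          filter_upwards [hbound] with z hz
          rw [← sq_abs, pow_two]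
          exact mul_le_mul_of_nonneg_right hz (abs_nonneg _)
      _ = (2 + 10 ^ d) * α * ∫ z, |h z| ∂muB d := integral_const_mul _ _
      _ ≤ _ := mul_le_mul_of_nonneg_left hL1 (by positivity)
  · rw [Finset.mul_sum]
    calc ∑ x ∈ s, α * ((5 * r x) ^ d * vol1 d)
        ≤ ∑ x ∈ s, 10 ^ d * ∫ z in B x, |g z| ∂muB d := by
          refine Finset.sum_le_sum fun x hx => ?_
          have hx' := hs x hx
          have h4 := le_muB_real_closedBall hx'.norm_le hx'.pos hx'.le_two
          have h5 : (5 * r x) ^ d * vol1 d = 10 ^ d * ((r x / 2) ^ d * vol1 d) := by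
            rw [← mul_assoc, ← mul_pow]
            congr 2
            ring
          rw [h5, mul_left_comm]
          exact mul_le_mul_of_nonneg_left
            ((mul_le_mul_of_nonneg_left h4 hα.le).trans hx'.lt.le) (by positivity)
      _ = 10 ^ d * ∫ z in ⋃ x ∈ s, B x, |g z| ∂muB d := by
          rw [← Finset.mul_sum, integral_biUnion_finset s (fun x _ => hBm x) hdisj
            fun x _ => hgi.abs.integrableOn]
      _ ≤ 10 ^ d * N := mul_le_mul_of_nonneg_left
          (setIntegral_le_integral hgi.abs (Eventually.of_forall fun z => abs_nonneg _))
          (by positivity)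

end CalderonZygmund

end WeakType

namespace WeakType

section WeakOneOne

open Filter Topology

variable {d : ℕ} {C κ : ℝ} {T : H2 d →L[ℝ] H2 d}

lemma Hormander.mul_measure_le (hT : Hormander C κ T) (hC : 0 ≤ C) (hκ : 1 ≤ κ) {g : Euc d → ℝ}
    (hg : Continuous g) {α : ℝ} (hα : 0 < α) :
    α * (muB d).real {z | α < |T (memLp_of_continuous hg 2).toLp z|}
      ≤ (1 + 4 * C ^ 2 * (2 + 10 ^ d) + (32 * κ) ^ d * 10 ^ d + 4 * (C * √(16 ^ d * vol1 d)))
        * ∫ z, |g z| ∂muB d := by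
  set G : H2 d := (memLp_of_continuous hg 2).toLp with hG
  set N : ℝ := ∫ z, |g z| ∂muB d with hNdef
  have hN0 : 0 ≤ N := integral_nonneg fun z => abs_nonneg _
  have hv := vol1_pos d
  set D : ℝ := C * √(16 ^ d * vol1 d) with hD
  have hD0 : 0 ≤ D := by positivity
  have hκ0 : 0 < κ := by linarith
  have h2 : 0 ≤ 4 * C ^ 2 * (2 + 10 ^ d) * N := by positivity
  have h3 : 0 ≤ (32 * κ) ^ d * 10 ^ d * N := by positivity
  have h4 : 0 ≤ 4 * D * N := by positivity
  rcases lt_or_ge (α * vol1 d) N with hN | hN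
  · have h1 : (muB d).real {z | α < |T G z|} ≤ vol1 d := by
      refine (measureReal_mono (subset_univ _)).trans (le_of_eq ?_)
      rw [Measure.real, Measure.restrict_apply_univ, vol1, Measure.real]
    have := mul_le_mul_of_nonneg_left h1 hα.le
    linarith
  obtain ⟨s, r, b, h, hgh, hb, hbN, hh, hr⟩ := exists_calderon_zygmund hg hα hN
  set F : Set (Euc d) := ⋃ x ∈ s, ball x (32 * κ * r x) with hF
  have hFm : MeasurableSet F := s.measurableSet_biUnion fun x _ => measurableSet_ball
  set Q : Euc d → ℝ := Fᶜ.indicator fun z => ∑ x ∈ s, |T (b x) z| with hQ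
  have hTb : ∀ x ∈ s, Integrable (fun z => |T (b x) z|) (muB d) := fun x _ =>
    (integrable_H2 _).abs
  have hsum : ∀ᵐ z ∂muB d, T G z = T h z + ∑ x ∈ s, T (b x) z := by
    rw [← hG] at hgh
    rw [hgh, map_add, map_sum]
    filter_upwards [Lp.coeFn_add (T h) (∑ x ∈ s, T (b x)),
      Lp.coeFn_finsetSum s fun x => T (b x)] with z h1 h2
    rw [h1, Pi.add_apply, h2, Finset.sum_apply]
  have hsub : ∀ᵐ z ∂muB d, z ∈ {z | α < |T G z|} →
      z ∈ ({z | α ^ 2 / 4 ≤ T h z ^ 2} ∪ F) ∪ {z | α / 2 ≤ Q z} := by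
    filter_upwards [hsum] with z hz hzα
    by_cases hzF : z ∈ F
    · exact Or.inl (Or.inr hzF)
    by_cases h1 : α / 2 ≤ |T h z|
    · refine Or.inl (Or.inl ?_)
      change α ^ 2 / 4 ≤ T h z ^ 2
      rw [← sq_abs (T h z)]
      nlinarith
    · refine Or.inr ?_
      change α < |T G z| at hzα
      change α / 2 ≤ Q z
      rw [hz] at hzα
      rw [hQ, indicator_of_mem (mem_compl hzF)]
      have := (abs_add_le (T h z) (∑ x ∈ s, T (b x) z)).trans
        (add_le_add_right (Finset.abs_sum_le_sum_abs (fun x => T (b x) z) s) _)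
      push Not at h1
      linarith
  have m1 : α * (muB d).real {z | α ^ 2 / 4 ≤ T h z ^ 2} ≤ 4 * C ^ 2 * (2 + 10 ^ d) * N := by
    have e1 := mul_meas_ge_le_integral_of_nonneg
      (Eventually.of_forall fun z => sq_nonneg (T h z)) (integrable_sq_H2 (T h)) (α ^ 2 / 4)
    rw [← norm_sq_H2] at e1
    have e2 : ‖T h‖ ≤ C * ‖h‖ := (T.le_opNorm h).trans
      (mul_le_mul_of_nonneg_right hT.norm_le (norm_nonneg _))
    have e3 : ‖T h‖ ^ 2 ≤ C ^ 2 * ‖h‖ ^ 2 := by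
      rw [← mul_pow]
      exact pow_le_pow_left₀ (norm_nonneg _) e2 2
    have e4 := e1.trans (e3.trans (mul_le_mul_of_nonneg_left hh (sq_nonneg C)))
    refine le_of_mul_le_mul_left (a := α / 4) ?_ (by positivity)
    refine le_trans (le_of_eq ?_) (e4.trans (le_of_eq ?_)) <;> ring
  have m2 : α * (muB d).real F ≤ (32 * κ) ^ d * 10 ^ d * N := by
    have e1 : (muB d).real F ≤ ∑ x ∈ s, (32 * κ) ^ d * (r x ^ d * vol1 d) := by
      refine (measureReal_biUnion_finset_le s _).trans (Finset.sum_le_sum fun x hx => ?_)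
      refine (muB_real_ball_le x (mul_pos (by positivity) (hb x hx).pos)).trans (le_of_eq ?_)
      rw [mul_pow, mul_assoc]
    rw [← Finset.mul_sum] at e1
    calc α * (muB d).real F ≤ α * ((32 * κ) ^ d * ∑ x ∈ s, r x ^ d * vol1 d) :=
          mul_le_mul_of_nonneg_left e1 hα.le
      _ = (32 * κ) ^ d * (α * ∑ x ∈ s, r x ^ d * vol1 d) := by ring
      _ ≤ (32 * κ) ^ d * (10 ^ d * N) := mul_le_mul_of_nonneg_left hr (by positivity)
      _ = _ := by ring
  have m3 : α * (muB d).real {z | α / 2 ≤ Q z} ≤ 4 * D * N := by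
    have hi : Integrable (fun z => ∑ x ∈ s, |T (b x) z|) (muB d) := integrable_finsetSum s hTb
    have e1 := mul_meas_ge_le_integral_of_nonneg (f := Q) (μ := muB d)
      (Eventually.of_forall fun z => indicator_nonneg
        (fun z _ => Finset.sum_nonneg fun x _ => abs_nonneg _) z)
      (hi.indicator hFm.compl) (α / 2)
    have e2 : ∫ z, Q z ∂muB d ≤ ∑ x ∈ s, D * ∫ z, |b x z| ∂muB d := by
      rw [hQ, integral_indicator hFm.compl,
        integral_finsetSum s fun x hx => (hTb x hx).integrableOn]
      refine Finset.sum_le_sum fun x hx => ?_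
      refine le_trans ?_ (hT.integral_tail_le hC hκ (hb x hx))
      refine setIntegral_mono_set (hTb x hx).integrableOn
        (Eventually.of_forall fun z => abs_nonneg _) (compl_subset_compl.2 ?_).eventuallyLE
      exact subset_biUnion_of_mem (u := fun x => ball x (32 * κ * r x)) hx
    rw [← Finset.mul_sum] at e2
    have e3 := mul_le_mul_of_nonneg_left hbN hD0
    linarith
  have hle : (muB d).real {z | α < |T G z|} ≤ (muB d).real {z | α ^ 2 / 4 ≤ T h z ^ 2}
      + (muB d).real F + (muB d).real {z | α / 2 ≤ Q z} := by
    refine (ENNReal.toReal_mono (measure_ne_top _ _) (measure_mono_ae hsub)).trans ?_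
    refine (measureReal_union_le _ _).trans ?_
    exact add_le_add_left (measureReal_union_le _ _) _
  have := mul_le_mul_of_nonneg_left hle hα.le
  linarith

end WeakOneOne

end WeakType

namespace WeakType

section Adjoint

open Filter Topology

variable {d : ℕ}

lemma Ell.of_matrix {lam Lam : ℝ} {A : Matrix (Fin d) (Fin d) ℝ} (hs : A.IsSymm)
    (hc : ∀ ξ : Fin d → ℝ, lam * ∑ i, ξ i ^ 2 ≤ (A *ᵥ ξ) ⬝ᵥ ξ)
    (hb : Real.sqrt (∑ i, ∑ j, (A i j) ^ 2) ≤ Lam) : Ell lam Lam A where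
  symm i j := (hs.apply i j).symm
  coer ξ := by
    refine (hc ξ).trans (le_of_eq ?_)
    simp only [dotProduct, mulVec, Finset.sum_mul]
    refine Finset.sum_congr rfl fun i _ => Finset.sum_congr rfl fun j _ => ?_
    ring
  bdd i j := by
    refine le_trans (Real.le_sqrt_of_sq_le ?_) hb
    rw [sq_abs]
    exact (Finset.single_le_sum (f := fun j => A i j ^ 2) (fun j _ => sq_nonneg _)
      (Finset.mem_univ j)).trans (Finset.single_le_sum (f := fun i => ∑ j, A i j ^ 2)
      (fun i _ => Finset.sum_nonneg fun j _ => sq_nonneg _) (Finset.mem_univ i))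

lemma memLp_of_continuousOn {u : Euc d → ℝ} (hu : ContinuousOn u (closedBall 0 1)) :
    MemLp u 2 (muB d) := by
  obtain ⟨C, hC⟩ := (isCompact_closedBall (0 : Euc d) 1).exists_bound_of_continuousOn hu
  exact MemLp.of_bound ((hu.mono ball_subset_closedBall).aestronglyMeasurable measurableSet_ball) C
    (ae_muB fun x hx => hC x (ball_subset_closedBall hx))

lemma inner_toLp_toL2 {u : Euc d → ℝ} (hu : MemLp u 2 (muB d)) (p : Pol d) :
    inner ℝ hu.toLp (toL2 p) = ∫ x, u x * ev x p ∂muB d := by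
  rw [inner_H2]
  refine integral_congr_ae ?_
  filter_upwards [hu.coeFn_toLp, coeFn_toL2 p] with x h1 h2
  rw [h1, h2]

lemma adjoint_solution_eq (hd : 1 ≤ d) {A : Matrix (Fin d) (Fin d) ℝ} {V : Pol d →ₗ[ℝ] Pol d}
    (hV : ∀ p, LA A (V p) = p) (hVom : ∀ p, ∃ q, V p = om * q)
    {T : Fin d → Fin d → H2 d →L[ℝ] H2 d}
    (hT : ∀ k l g p, inner ℝ (T k l g) (toL2 p) = inner ℝ g (toL2 (pd k (pd l (V p)))))
    {f : Euc d → Fin d → Fin d → ℝ} (hf : ∀ k l, Continuous fun x => f x k l) {u : Euc d → ℝ}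
    (hu : MemLp u 2 (muB d))
    (h : ∀ v : Euc d → ℝ, ContDiff ℝ (⊤ : ℕ∞) v → (∀ x ∈ sphere (0 : Euc d) 1, v x = 0) →
      ∫ x in ball (0 : Euc d) 1, u x * ∑ i, ∑ j, A i j * hess v x i j
        = ∫ x in ball (0 : Euc d) 1, ∑ k, ∑ l, f x k l * hess v x k l) :
    hu.toLp = ∑ k, ∑ l, T k l (memLp_of_continuous (hf k l) 2).toLp := by
  refine (denseRange_toL2 hd).eq_of_inner_left (𝕜 := ℝ) ?_
  intro p
  obtain ⟨q, hq⟩ := hVom p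
  have hp := h (fun x => ev x (V p)) (contDiff_ev _) fun x hx => by
    rw [hq, ev_om_mul_sphere q hx]
  have e1 : ∀ x, ∑ i, ∑ j, A i j * hess (fun x => ev x (V p)) x i j = ev x p := by
    intro x
    conv_rhs => rw [← hV p, LA_apply]
    simp only [map_sum, ev_smul, hess_ev]
  simp only [e1] at hp
  simp only [hess_ev] at hp
  have hi : ∀ k l, Integrable (fun x => f x k l * ev x (pd k (pd l (V p)))) (muB d) := fun k l =>
    integrable_muB ((hf k l).mul (continuous_ev _))
  rw [inner_toLp_toL2, hp, integral_finsetSum _ fun k _ => integrable_finsetSum _ fun l _ => hi k l,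
    sum_inner]
  refine Finset.sum_congr rfl fun k _ => ?_
  rw [integral_finsetSum _ fun l _ => hi k l, sum_inner]
  refine Finset.sum_congr rfl fun l _ => ?_
  rw [hT, inner_toLp_toL2]

lemma measure_sum_le {ι : Type*} [Fintype ι] {α : ℝ} (hα : 0 < α) {w : ι → Euc d → ℝ}
    {u : Euc d → ℝ} (hu : ∀ᵐ x ∂muB d, u x = ∑ i, w i x) :
    (muB d).real {x | α < |u x|}
      ≤ ∑ i, (muB d).real {x | α / (Fintype.card ι + 1) < |w i x|} := by
  have hsub : ∀ᵐ x ∂muB d, x ∈ {x | α < |u x|} →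
      x ∈ ⋃ i ∈ (Finset.univ : Finset ι), {x | α / (Fintype.card ι + 1) < |w i x|} := by
    filter_upwards [hu] with x hx hxα
    by_contra hcon
    simp only [mem_iUnion, Finset.mem_univ, exists_prop, true_and, not_exists] at hcon
    have hle : ∀ i, |w i x| ≤ α / (Fintype.card ι + 1) := fun i => not_lt.1 (hcon i)
    have h1 : |u x| ≤ ∑ _i : ι, α / (Fintype.card ι + 1) := by
      rw [hx]
      exact (Finset.abs_sum_le_sum_abs _ _).trans (Finset.sum_le_sum fun i _ => hle i)
    rw [Finset.sum_const, Finset.card_univ, nsmul_eq_mul] at h1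
    have h2 : (Fintype.card ι : ℝ) * (α / (Fintype.card ι + 1)) ≤ α := by
      rw [← mul_div_assoc, div_le_iff₀ (by positivity)]
      nlinarith
    have h3 : α < |u x| := hxα
    linarith
  exact (ENNReal.toReal_mono (measure_ne_top _ _) (measure_mono_ae hsub)).trans
    (measureReal_biUnion_finset_le _ _)

end Adjoint

end WeakType

/-- Weak type-(1,1) estimate for adjoint solutions of the constant-coefficient problem
`∑ D_{ij}(a₀^{ij} u) = ∑ D_{kl} f^{kl}` in `B = B(0,1)` with boundary value
`u = (fν·ν)/(A₀ν·ν)` (encoded by testing against all smooth `v` vanishing on `∂B`):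
`|{x ∈ B : |u(x)| > α}| ≤ (C/α) ∫_B |f|` with `C = C(d,λ,Λ)`. -/
theorem weak11_adjoint_constant_coeff
    (d : ℕ) (hd : 1 ≤ d) (lam Lam : ℝ) (hlam : 0 < lam) (hLam : 0 < Lam) :
    ∃ C : ℝ, 0 < C ∧
      ∀ A₀ : Matrix (Fin d) (Fin d) ℝ, A₀.IsSymm →
        (∀ ξ : Fin d → ℝ, lam * ∑ i, ξ i ^ 2 ≤ (A₀ *ᵥ ξ) ⬝ᵥ ξ) →
        Real.sqrt (∑ i, ∑ j, (A₀ i j) ^ 2) ≤ Lam →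
      ∀ f : EuclideanSpace ℝ (Fin d) → Fin d → Fin d → ℝ, ContDiff ℝ (⊤ : ℕ∞) f →
      ∀ u : EuclideanSpace ℝ (Fin d) → ℝ,
        ContinuousOn u (closedBall (0 : EuclideanSpace ℝ (Fin d)) 1) →
        (∀ v : EuclideanSpace ℝ (Fin d) → ℝ, ContDiff ℝ (⊤ : ℕ∞) v →
          (∀ x ∈ sphere (0 : EuclideanSpace ℝ (Fin d)) 1, v x = 0) →
          ∫ x in ball (0 : EuclideanSpace ℝ (Fin d)) 1,
              u x * ∑ i, ∑ j, A₀ i j * hess v x i j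
            = ∫ x in ball (0 : EuclideanSpace ℝ (Fin d)) 1,
                ∑ k, ∑ l, f x k l * hess v x k l) →
      ∀ α : ℝ, 0 < α →
        volume {x ∈ ball (0 : EuclideanSpace ℝ (Fin d)) 1 | α < |u x|}
          ≤ ENNReal.ofReal (C / α * ∫ x in ball (0 : EuclideanSpace ℝ (Fin d)) 1, ‖f x‖) := by
  obtain ⟨C, hC, hCA⟩ := WeakType.exists_hormander hd hlam hLam
  set κ : ℝ := 8 * 2 ^ (d + 3) with hκ
  have hκ1 : 1 ≤ κ := by
    have : (1 : ℝ) ≤ 2 ^ (d + 3) := one_le_pow₀ (by norm_num)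
    linarith
  set K : ℝ := 1 + 4 * C ^ 2 * (2 + 10 ^ d) + (32 * κ) ^ d * 10 ^ d
    + 4 * (C * √(16 ^ d * WeakType.vol1 d)) with hK
  have hK0 : 0 < K := by positivity
  set n : ℝ := (Fintype.card (Fin d × Fin d) : ℝ) with hn
  have hn0 : 0 < n := by
    rw [hn, Fintype.card_prod, Fintype.card_fin]
    exact_mod_cast Nat.mul_pos hd hd
  refine ⟨n * (K * (n + 1)), by positivity, fun A hs hc hb f hf u hu h α hα => ?_⟩
  obtain ⟨V, hV, hVom, T, hT⟩ := hCA A (WeakType.Ell.of_matrix hs hc hb)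
  have hfc : Continuous f := hf.continuous
  have hfkl : ∀ k l, Continuous fun x => f x k l := fun k l =>
    (continuous_apply l).comp ((continuous_apply k).comp hfc)
  have hul := WeakType.memLp_of_continuousOn hu
  have hrep := WeakType.adjoint_solution_eq hd hV hVom (fun k l => (hT k l).2) hfkl hul h
  rw [← Fintype.sum_prod_type' (f := fun k l =>
    T k l (WeakType.memLp_of_continuous (hfkl k l) 2).toLp)] at hrep
  have hae : ∀ᵐ x ∂WeakType.muB d, u x = ∑ i : Fin d × Fin d,
      T i.1 i.2 (WeakType.memLp_of_continuous (hfkl i.1 i.2) 2).toLp x := by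
    filter_upwards [hul.coeFn_toLp, Lp.coeFn_finsetSum Finset.univ fun i : Fin d × Fin d =>
      T i.1 i.2 (WeakType.memLp_of_continuous (hfkl i.1 i.2) 2).toLp] with x h1 h2
    rw [← h1, hrep, h2, Finset.sum_apply]
  have hα' : 0 < α / (n + 1) := by positivity
  have hF : ∀ k l, ∫ x, |f x k l| ∂WeakType.muB d
      ≤ ∫ x in ball (0 : EuclideanSpace ℝ (Fin d)) 1, ‖f x‖ := fun k l =>
    integral_mono (WeakType.integrable_muB (hfkl k l)).abs
      (WeakType.integrable_muB hfc.norm) fun x => by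
        change ‖f x k l‖ ≤ ‖f x‖
        exact (norm_le_pi_norm (f x k) l).trans (norm_le_pi_norm (f x) k)
  set N : ℝ := ∫ x in ball (0 : EuclideanSpace ℝ (Fin d)) 1, ‖f x‖ with hN
  have hmain : (WeakType.muB d).real {x | α < |u x|} ≤ n * (K * (n + 1)) / α * N := by
    calc (WeakType.muB d).real {x | α < |u x|}
        ≤ ∑ i : Fin d × Fin d, (WeakType.muB d).real {x | α / (n + 1)
            < |T i.1 i.2 (WeakType.memLp_of_continuous (hfkl i.1 i.2) 2).toLp x|} :=
          WeakType.measure_sum_le hα hae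
      _ ≤ ∑ _i : Fin d × Fin d, K * N / (α / (n + 1)) := by
          refine Finset.sum_le_sum fun i _ => ?_
          rw [le_div_iff₀' hα']
          exact ((hT i.1 i.2).1.mul_measure_le hC.le hκ1 (hfkl i.1 i.2) hα').trans
            (mul_le_mul_of_nonneg_left (hF i.1 i.2) hK0.le)
      _ = n * (K * (n + 1)) / α * N := by
          rw [Finset.sum_const, Finset.card_univ, nsmul_eq_mul, ← hn]
          field_simp
  have hset : volume {x ∈ ball (0 : EuclideanSpace ℝ (Fin d)) 1 | α < |u x|}
      = WeakType.muB d {x | α < |u x|} := by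
    rw [Measure.restrict_apply' measurableSet_ball, inter_comm]
    rfl
  rw [hset, ← ofReal_measureReal]
  exact ENNReal.ofReal_le_ofReal hmain
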